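/- Let F be an algebraically closed field of characteristic 0 and let g be the simple Lie algebra of type E6 over F (equivalently, a finite-dimensional simple Lie algebra over F with dim g = 78 which is isomorphic neither to the orthogonal Lie algebra so(13, F) nor to the symplectic Lie algebra sp(12, F)). Then there exists a grading of g by the group (ℤ/3ℤ)^3 such that dim g_α = 3 for every nonzero α ∈ (ℤ/3ℤ)^3 (so necessarily g_0 = 0), and any two such gradings of g are equivalent. -/

import Mathlib

open Module

/-- A grading of the Lie algebra `L` over `F` by the additive group `A`:
a direct sum decomposition into subspaces compatible with the bracket. -/
def IsLieGrading (F : Type*) {A L : Type*} [Field F] [AddCommGroup A] [DecidableEq A]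
    [LieRing L] [LieAlgebra F L] (gr : A → Submodule F L) : Prop :=
  DirectSum.IsInternal gr ∧
    ∀ a b : A, ∀ x ∈ gr a, ∀ y ∈ gr b, ⁅x, y⁆ ∈ gr (a + b)

/-- Two gradings of `L` are equivalent if some automorphism of `L` maps each nonzero
homogeneous component of the first grading onto a homogeneous component of the second. -/
def GradingsEquiv (F : Type*) {A B L : Type*} [Field F] [AddCommGroup A] [AddCommGroup B]
    [LieRing L] [LieAlgebra F L] (gr : A → Submodule F L) (gr' : B → Submodule F L) : Prop :=
  ∃ φ : L ≃ₗ⁅F⁆ L, ∀ a : A, gr a ≠ ⊥ →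
    ∃ b : B, (gr a).map φ.toLinearEquiv.toLinearMap = gr' b

namespace LieAlgebra

open LieSubalgebra Set

/-- The Chevalley relations for a triple of families in a Lie algebra. -/
structure ChevalleyRel {ι L : Type*} (F : Type*) [Field F] [LieRing L] [LieAlgebra F L]
    (A : Matrix ι ι ℤ) (h e f : ι → L) : Prop where
  linInd : LinearIndependent F h
  lie_h_h (i j : ι) : ⁅h i, h j⁆ = 0
  lie_h_e (i j : ι) : ⁅h j, e i⁆ = A i j • e i
  lie_h_f (i j : ι) : ⁅h j, f i⁆ = -A i j • f i
  lie_e_f (i : ι) : ⁅e i, f i⁆ = h i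
  lie_e_f_ne (i j : ι) (hij : i ≠ j) : ⁅e i, f j⁆ = 0

namespace ChevalleyRel

variable {ι F L L' : Type*} [Field F] [LieRing L] [LieAlgebra F L] [LieRing L'] [LieAlgebra F L']
  {A : Matrix ι ι ℤ} {h e f : ι → L} {h' e' f' : ι → L'}

/-- Chevalley generators form a basis of the Lie algebra. -/
def toBasis [Finite ι] (c : ChevalleyRel F A h e f) (hA : A.Nondegenerate) (hA2 : ∀ i, A i i = 2)
    (hgen : lieSpan F L (range e ∪ range f) = ⊤) :
    LieAlgebra.Basis ι (lieSpan F L (range h)) where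
  A := A
  h := h
  e := e
  f := f
  cartan_eq_lieSpan := rfl
  span_ef := hgen
  linInd := c.linInd
  nondegen := hA
  sl2 i :=
    { h_ne_zero := c.linInd.ne_zero i
      lie_e_f := c.lie_e_f i
      lie_h_e_nsmul := by rw [c.lie_h_e, hA2]; simp [two_smul]
      lie_h_f_nsmul := by rw [c.lie_h_f, hA2]; simp [two_smul] }
  lie_h_h := c.lie_h_h
  lie_h_e := c.lie_h_e
  lie_h_f := c.lie_h_f
  lie_e_f_ne := c.lie_e_f_ne

theorem exists_lieEquiv [CharZero F] [FiniteDimensional F L] [FiniteDimensional F L']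
    [Finite ι] [Nonempty ι] [IsSimple F L]
    (c : ChevalleyRel F A h e f) (hA : A.Nondegenerate) (hA2 : ∀ i, A i i = 2)
    (hgen : lieSpan F L (range e ∪ range f) = ⊤)
    (c' : ChevalleyRel F A h' e' f') (hdim : finrank F L' ≤ finrank F L) :
    ∃ φ : L ≃ₗ⁅F⁆ L', (∀ i, φ (h i) = h' i) ∧ (∀ i, φ (e i) = e' i) ∧ ∀ i, φ (f i) = f' i := by
  classical
  have := Fintype.ofFinite ι
  let S : Set (L × L') := range (fun i ↦ (e i, e' i)) ∪ range (fun i ↦ (f i, f' i))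
  let D : LieSubalgebra F (L × L') := lieSpan F (L × L') S
  have heD (i) : (e i, e' i) ∈ D := subset_lieSpan (Or.inl ⟨i, rfl⟩)
  have hfD (i) : (f i, f' i) ∈ D := subset_lieSpan (Or.inr ⟨i, rfl⟩)
  have hhD (i) : (h i, h' i) ∈ D := by
    have := D.lie_mem (heD i) (hfD i)
    rwa [show ⁅((e i, e' i) : L × L'), (f i, f' i)⁆ = (h i, h' i) from
      Prod.ext (c.lie_e_f i) (c'.lie_e_f i)] at this
  let E (i : ι) : D := ⟨_, heD i⟩
  let G (i : ι) : D := ⟨_, hfD i⟩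
  let T (i : ι) : D := ⟨_, hhD i⟩
  have cD : ChevalleyRel F A T E G :=
    { linInd := .of_comp D.toSubmodule.subtype <| .of_comp (LinearMap.fst F L L') c.linInd
      lie_h_h i j := Subtype.ext (Prod.ext (c.lie_h_h i j) (c'.lie_h_h i j))
      lie_h_e i j := Subtype.ext (Prod.ext (c.lie_h_e i j) (c'.lie_h_e i j))
      lie_h_f i j := Subtype.ext (Prod.ext (c.lie_h_f i j) (c'.lie_h_f i j))
      lie_e_f i := Subtype.ext (Prod.ext (c.lie_e_f i) (c'.lie_e_f i))
      lie_e_f_ne i j hij := Subtype.ext (Prod.ext (c.lie_e_f_ne i j hij) (c'.lie_e_f_ne i j hij)) }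
  have hgenD : lieSpan F D (range E ∪ range G) = ⊤ := by
    have : range E ∪ range G = Subtype.val ⁻¹' S := by
      ext ⟨x, hx⟩
      simp [S, E, G, Subtype.ext_iff]
    rw [this]
    exact lieSpan_lieSpan_coe_preimage
  let bD := cD.toBasis hA hA2 hgenD
  let p₁ : D →ₗ⁅F⁆ L := (LieHom.fst F L L').comp D.incl
  let p₂ : D →ₗ⁅F⁆ L' := (LieHom.snd F L L').comp D.incl
  have hp₁ : Function.Surjective p₁ := by
    rw [← LieHom.range_eq_top, eq_top_iff, ← hgen, lieSpan_le]
    rintro - (⟨i, rfl⟩ | ⟨i, rfl⟩)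
    exacts [⟨E i, rfl⟩, ⟨G i, rfl⟩]
  have hcart := bD.isCartanSubalgebra
  -- the kernel of the second projection is an ideal of the first factor
  let K : LieIdeal F L :=
    { carrier := {x | (x, (0 : L')) ∈ D}
      add_mem' := fun {a b} ha hb ↦ by simpa using D.add_mem ha hb
      zero_mem' := D.zero_mem
      smul_mem' := fun t a ha ↦ by simpa using D.smul_mem t ha
      lie_mem := fun {x a} ha ↦ by
        obtain ⟨⟨⟨x', y⟩, hy⟩, rfl⟩ := hp₁ x
        simpa [p₁] using D.lie_mem hy ha }
  have hK (x : L) : x ∈ K ↔ (x, (0 : L')) ∈ D := Iff.rfl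
  have hKtop : K ≠ ⊤ := by
    intro hK'
    obtain ⟨i⟩ := ‹Nonempty ι›
    have hx : (h i, (0 : L')) ∈ D := by rw [← hK, hK']; trivial
    have h1 : (⟨_, hx⟩ : D) ∈ lieSpan F D (range T) := by
      rw [← hcart.self_normalizing, LieSubalgebra.mem_normalizer_iff]
      intro y hy
      suffices hz : ⁅(⟨_, hx⟩ : D), y⁆ = 0 by rw [hz]; exact zero_mem _
      rw [← mem_toSubmodule, bD.coe_cartan_eq_span] at hy
      induction hy using Submodule.span_induction with
      | mem v hv =>
        obtain ⟨j, rfl⟩ := hv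
        exact Subtype.ext (Prod.ext (c.lie_h_h i j) (zero_lie _))
      | zero => simp
      | add u v _ _ hu hv => rw [lie_add, hu, hv, add_zero]
      | smul t u _ hu => rw [lie_smul, hu, smul_zero]
    rw [← mem_toSubmodule, bD.coe_cartan_eq_span, Submodule.mem_span_range_iff_exists_fun] at h1
    obtain ⟨t, ht⟩ := h1
    have ht1 : ∑ j, t j • h j = h i := by
      have := congrArg p₁ ht
      simp only [map_sum, map_smul] at this
      exact this
    have ht2 : ∑ j, t j • h' j = 0 := by
      have := congrArg p₂ ht
      simp only [map_sum, map_smul] at this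
      exact this
    have ht3 := Fintype.linearIndependent_iff.mp c'.linInd t ht2
    exact c.linInd.ne_zero i (by rw [← ht1]; simp [ht3])
  have hKbot := (IsSimple.eq_bot_or_eq_top K).resolve_right hKtop
  have hp₂ : Function.Injective p₂ := by
    rw [injective_iff_map_eq_zero]
    rintro ⟨⟨x, y⟩, hxy⟩ hy
    obtain rfl : y = 0 := hy
    obtain rfl : x = 0 := by rwa [← hK, hKbot] at hxy
    rfl
  have d1 : finrank F D ≤ finrank F L' :=
    LinearMap.finrank_le_finrank_of_injective (f := p₂.toLinearMap) hp₂
  have d2 : finrank F L ≤ finrank F D :=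
    LinearMap.finrank_le_finrank_of_surjective (f := p₁.toLinearMap) hp₁
  have hp₁' : Function.Injective p₁ :=
    (LinearMap.injective_iff_surjective_of_finrank_eq_finrank (f := p₁.toLinearMap)
      (by omega)).mpr hp₁
  have hp₂' : Function.Surjective p₂ :=
    (LinearMap.injective_iff_surjective_of_finrank_eq_finrank (f := p₂.toLinearMap)
      (by omega)).mp hp₂
  let e₁ : D ≃ₗ⁅F⁆ L := LieEquiv.ofBijective p₁ ⟨hp₁', hp₁⟩
  let e₂ : D ≃ₗ⁅F⁆ L' := LieEquiv.ofBijective p₂ ⟨hp₂, hp₂'⟩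
  have key (x : D) : (e₁.symm.trans e₂) (p₁ x) = p₂ x := by
    have : e₁.symm (p₁ x) = x := e₁.symm_apply_apply x
    change e₂ (e₁.symm (p₁ x)) = _
    rw [this]; rfl
  exact ⟨e₁.symm.trans e₂, fun i ↦ key (T i), fun i ↦ key (E i), fun i ↦ key (G i)⟩

end ChevalleyRel

end LieAlgebra

namespace LieAlgebra.IsKilling

open LieModule Module LieSubalgebra Set

variable {K L : Type*} [Field K] [CharZero K] [LieRing L] [LieAlgebra K L]
  [IsKilling K L] [FiniteDimensional K L]
  {H : LieSubalgebra K L} [H.IsCartanSubalgebra] [IsTriangularizable K H L]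

theorem exists_smul_eq_of_mem_rootSpace {α : Weight K H L} (hα : α.IsNonZero) {x y : L}
    (hx : x ∈ rootSpace H α) (hx0 : x ≠ 0) (hy : y ∈ rootSpace H α) : ∃ c : K, c • x = y := by
  obtain ⟨c, hc⟩ := (finrank_eq_one_iff_of_nonzero' (⟨x, hx⟩ : rootSpace H α)
    (by simpa using hx0)).mp (finrank_rootSpace_eq_one α hα) ⟨y, hy⟩
  exact ⟨c, congrArg Subtype.val hc⟩

theorem exists_lie_eq_coroot {α : Weight K H L} (hα : α.IsNonZero) {x : L}
    (hx : x ∈ rootSpace H α) (hx0 : x ≠ 0) :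
    ∃ y ∈ rootSpace H (-α), ⁅x, y⁆ = (coroot α : L) := by
  obtain ⟨h, e, f, ht, he, hf⟩ := exists_isSl2Triple_of_weight_isNonZero hα
  obtain ⟨c, rfl⟩ := exists_smul_eq_of_mem_rootSpace hα he ht.e_ne_zero hx
  have hc : c ≠ 0 := by rintro rfl; simp at hx0
  refine ⟨c⁻¹ • f, Submodule.smul_mem _ _ hf, ?_⟩
  rw [← ht.h_eq_coroot hα he hf, ← ht.lie_e_f, lie_smul, smul_lie, smul_smul, inv_mul_cancel₀ hc,
    one_smul]

theorem lie_ne_zero_of_mem_rootSpace {α β γ : Weight K H L} (hα : α.IsNonZero)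
    (hβ : β.IsNonZero) (hγ : (γ : H → K) = α + β) {x y : L}
    (hx : x ∈ rootSpace H α) (hx0 : x ≠ 0) (hy : y ∈ rootSpace H β) (hy0 : y ≠ 0) :
    ⁅x, y⁆ ≠ 0 := by
  obtain ⟨h, f, e, ht, hf, he⟩ := exists_isSl2Triple_of_weight_isNonZero hα
  have hα' : (-α).IsNonZero := hα.neg
  have ht' : IsSl2Triple (-h) e f := ht.symm
  have he' : e ∈ rootSpace H (-α : Weight K H L) := by simpa using he
  have hf' : f ∈ rootSpace H (-(-α : Weight K H L)) := by simpa using hf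
  have hh := ht'.h_eq_coroot hα' he' hf'
  obtain ⟨x', hx', hx'0⟩ := (chainTop (-α) β).exists_ne_zero
  have prim : ht'.HasPrimitiveVectorWith x' (chainLength (-α) β : K) := by
    have := lie_mem_genWeightSpace_of_mem_genWeightSpace he' hx'
    refine ⟨hx'0, ?_, by rwa [genWeightSpace_add_chainTop _ _ hα'] at this⟩
    rw [hh]
    exact (chainLength_smul _ _ hx').symm
  -- `β` and `α + β` both lie on the chain
  have hbot : (1 : ℤ) ≤ chainBotCoeff (-α) β := by
    refine le_chainBotCoeff_of_rootSpace_ne_top (-α) β hα' 1 ?_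
    have : (-(1 : ℤ) • ((-α : Weight K H L) : H → K) + β) = γ := by
      rw [hγ]; simp
    rw [this]
    exact γ.genWeightSpace_ne_bot
  set k := chainTopCoeff (-α) β with hk
  have hle : k + 1 ≤ chainLength (-α) β := by
    have := chainBotCoeff_add_chainTopCoeff (-α) β
    omega
  have hne := prim.pow_toEnd_f_ne_zero_of_eq_nat rfl hle
  have hmem := toEnd_pow_apply_mem hf' hx' k
  have hwt : (k • (-((-α : Weight K H L) : H → K)) + chainTop (-α) β) = β := by
    rw [coe_chainTop, ← hk, Weight.coe_neg, natCast_zsmul]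
    simp
  rw [hwt] at hmem
  obtain ⟨c, hc⟩ := exists_smul_eq_of_mem_rootSpace hβ hy hy0 hmem
  obtain ⟨d, rfl⟩ := exists_smul_eq_of_mem_rootSpace hα hx hx0 hf
  rw [pow_succ', Module.End.mul_apply] at hne
  intro h0
  apply hne
  rw [← hc]
  simp [h0]

theorem finrank_eq_finrank_add_card [Nontrivial L] :
    finrank K L = finrank K H + H.root.card := by
  classical
  have hint : DirectSum.IsInternal fun χ : Weight K H L ↦ (rootSpace H χ).toSubmodule := by
    apply DirectSum.isInternal_submodule_of_iSupIndep_of_iSup_eq_top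
    · exact LieSubmodule.iSupIndep_toSubmodule.mpr (iSupIndep_genWeightSpace' K H L)
    · rw [← LieSubmodule.iSup_toSubmodule, iSup_genWeightSpace_eq_top' K H L,
        LieSubmodule.top_toSubmodule]
  have h1 := LinearEquiv.finrank_eq (LinearEquiv.ofBijective (DirectSum.coeLinearMap
    fun χ : Weight K H L ↦ (rootSpace H χ).toSubmodule) hint)
  rw [Module.finrank_directSum] at h1
  rw [← h1, ← Finset.sum_filter_add_sum_filter_not _ (fun χ : Weight K H L ↦ χ.IsZero)]
  congr 1
  · rw [Finset.sum_eq_single_of_mem (0 : Weight K H L) (by simp [Weight.isZero_zero])]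
    · have : (rootSpace H ((0 : Weight K H L) : H → K)) = H.toLieSubmodule := by
        rw [FunLike.coe_zero, rootSpace_zero_eq]
      rw [this]
      rfl
    · intro χ hχ hχ0
      exact absurd (Weight.isZero_iff_eq_zero.mp (by simpa using hχ)) hχ0
  · rw [Finset.card_eq_sum_ones]
    refine Finset.sum_congr (by ext; simp) fun χ hχ ↦ ?_
    exact finrank_rootSpace_eq_one χ (by simpa using hχ)

theorem exists_chevalleyRel {ι : Type*} (ρ : ι → H.root) (A : Matrix ι ι ℤ)
    (hA : ∀ i j, (ρ i : Weight K H L) (coroot (ρ j : Weight K H L)) = A i j)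
    (hli : LinearIndependent K fun i ↦ coroot (ρ i : Weight K H L))
    (hne : ∀ i j, i ≠ j →
      rootSpace H (((ρ i : Weight K H L) : H → K) - ((ρ j : Weight K H L) : H → K)) = ⊥) :
    ∃ e f : ι → L, (∀ i, e i ∈ rootSpace H (ρ i)) ∧
      (∀ i, f i ∈ rootSpace H (-((ρ i : Weight K H L) : H → K))) ∧
      ChevalleyRel K A (fun i ↦ (coroot (ρ i : Weight K H L) : L)) e f := by
  have hρ (i : ι) : (ρ i : Weight K H L).IsNonZero := isNonZero_coe_root _
  choose e he he0 using fun i ↦ (ρ i : Weight K H L).exists_ne_zero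
  choose f hf hef using fun i ↦ exists_lie_eq_coroot (hρ i) (he i) (he0 i)
  refine ⟨e, f, he, hf, ?_⟩
  constructor
  · exact hli.map' H.toSubmodule.subtype (Submodule.ker_subtype _)
  · intro i j
    have := trivial_lie_zero H H (coroot (ρ i : Weight K H L)) (coroot (ρ j : Weight K H L))
    exact congrArg Subtype.val this
  · intro i j
    have := lie_eq_smul_of_mem_rootSpace (he i) (coroot (ρ j : Weight K H L))
    rw [hA, Int.cast_smul_eq_zsmul] at this
    exact this
  · intro i j
    have := lie_eq_smul_of_mem_rootSpace (hf i) (coroot (ρ j : Weight K H L))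
    rw [Pi.neg_apply, hA, neg_smul, Int.cast_smul_eq_zsmul, ← neg_smul] at this
    exact this
  · exact hef
  · intro i j hij
    have := lie_mem_genWeightSpace_of_mem_genWeightSpace (he i) (hf j)
    rw [← sub_eq_add_neg, show genWeightSpace L _ = ⊥ from hne i j hij] at this
    simpa using this

end LieAlgebra.IsKilling

namespace LieAlgebra.IsKilling

open LieModule Module LieSubalgebra Set

variable {K L : Type*} [Field K] [CharZero K] [LieRing L] [LieAlgebra K L]
  [IsKilling K L] [FiniteDimensional K L]
  {H : LieSubalgebra K L} [H.IsCartanSubalgebra] [IsTriangularizable K H L]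

theorem rootSpace_le_of_add {α β γ : Weight K H L} (hα : α.IsNonZero) (hβ : β.IsNonZero)
    (hγ0 : γ.IsNonZero) (hγ : (γ : H → K) = α + β) {M : LieSubalgebra K L}
    (h1 : ∀ x ∈ rootSpace H α, x ∈ M) (h2 : ∀ x ∈ rootSpace H β, x ∈ M) :
    ∀ x ∈ rootSpace H γ, x ∈ M := by
  intro z hz
  obtain ⟨x, hx, hx0⟩ := α.exists_ne_zero
  obtain ⟨y, hy, hy0⟩ := β.exists_ne_zero
  have hxy : ⁅x, y⁆ ∈ rootSpace H γ := by
    rw [hγ]; exact lie_mem_genWeightSpace_of_mem_genWeightSpace hx hy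
  obtain ⟨c, rfl⟩ := exists_smul_eq_of_mem_rootSpace hγ0 hxy
    (lie_ne_zero_of_mem_rootSpace hα hβ hγ hx hx0 hy hy0) hz
  exact M.smul_mem _ (M.lie_mem (h1 x hx) (h2 y hy))

theorem exists_chevalleyRel_base (b : (rootSystem H).Base) :
    ∃ e f : b.support → L, (∀ i, e i ∈ rootSpace H ((i.1 : Weight K H L) : H → K)) ∧
      (∀ i, f i ∈ rootSpace H (-((i.1 : Weight K H L) : H → K))) ∧
      ChevalleyRel K b.cartanMatrix (fun i ↦ (coroot (i.1 : Weight K H L) : L)) e f ∧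
      lieSpan K L (range e ∪ range f) = ⊤ := by
  have hρ (i : H.root) : (i : Weight K H L).IsNonZero := isNonZero_coe_root _
  obtain ⟨e, f, he, hf, hc⟩ := exists_chevalleyRel (fun i : b.support ↦ i.1) b.cartanMatrix
    (fun i j ↦ by
      have := b.algebraMap_cartanMatrixIn_apply ℤ i j
      rw [rootSystem_pairing_apply] at this
      exact this.symm) b.linearIndepOn_coroot (fun i j hij ↦ by
      by_contra h0
      let γ : Weight K H L := ⟨_, h0⟩
      have hγ : γ.IsNonZero := by
        intro hz
        have h1 : ((i.1 : Weight K H L) : H → K) - (j.1 : Weight K H L) = 0 := hz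
        rw [sub_eq_zero, DFunLike.coe_fn_eq] at h1
        exact hij (Subtype.ext (Subtype.ext h1))
      refine b.sub_notMem_range_root i.2 j.2 ⟨⟨γ, by simpa using hγ⟩, ?_⟩
      ext x
      rfl)
  refine ⟨e, f, he, hf, hc, ?_⟩
  set M := lieSpan K L (range e ∪ range f) with hM
  have hsimple (i : H.root) (hi : i ∈ b.support) :
      (∀ x ∈ rootSpace H (i : Weight K H L), x ∈ M) ∧
      ∀ x ∈ rootSpace H (-(i : Weight K H L) : Weight K H L), x ∈ M := by
    constructor
    · intro x hx
      have he0 : e ⟨i, hi⟩ ≠ 0 := by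
        intro h0
        have := hc.lie_e_f ⟨i, hi⟩
        rw [h0, zero_lie] at this
        exact hc.linInd.ne_zero ⟨i, hi⟩ this.symm
      obtain ⟨c, rfl⟩ := exists_smul_eq_of_mem_rootSpace (hρ i) (he ⟨i, hi⟩) he0 hx
      exact M.smul_mem _ (subset_lieSpan (Or.inl ⟨_, rfl⟩))
    · intro x hx
      have hf0 : f ⟨i, hi⟩ ≠ 0 := by
        intro h0
        have := hc.lie_e_f ⟨i, hi⟩
        rw [h0, lie_zero] at this
        exact hc.linInd.ne_zero ⟨i, hi⟩ this.symm
      have hf' : f ⟨i, hi⟩ ∈ rootSpace H (-(i : Weight K H L) : Weight K H L) := by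
        simpa using hf ⟨i, hi⟩
      obtain ⟨c, rfl⟩ := exists_smul_eq_of_mem_rootSpace (hρ i).neg hf' hf0 hx
      exact M.smul_mem _ (subset_lieSpan (Or.inr ⟨_, rfl⟩))
  have key (i : H.root) (hi : b.IsPos i) : (∀ x ∈ rootSpace H (i : Weight K H L), x ∈ M) ∧
      ∀ x ∈ rootSpace H (-(i : Weight K H L) : Weight K H L), x ∈ M := by
    refine hi.induction_on_add (p := fun i ↦ (∀ x ∈ rootSpace H (i : Weight K H L), x ∈ M) ∧
      ∀ x ∈ rootSpace H (-(i : Weight K H L) : Weight K H L), x ∈ M) hsimple ?_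
    intro i j k hk hi hj
    have hk' : ((k : Weight K H L) : H → K) = (i : Weight K H L) + (j : Weight K H L) := by
      ext x
      exact LinearMap.congr_fun hk x
    refine ⟨rootSpace_le_of_add (hρ i) (hρ j) (hρ k) hk' hi.1 (hsimple j hj).1,
      rootSpace_le_of_add (hρ i).neg (hρ j).neg (hρ k).neg ?_ hi.2 (hsimple j hj).2⟩
    rw [Weight.coe_neg, hk', Weight.coe_neg, Weight.coe_neg, neg_add]
  have key2 (i : H.root) : ∀ x ∈ rootSpace H (i : Weight K H L), x ∈ M := by
    let := (rootSystem H).indexNeg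
    rcases RootPairing.Base.IsPos.or_neg b i with h | h
    · exact (key i h).1
    · have h1 := (key _ h).2
      have h2 : (-((-i : H.root) : Weight K H L)) = i := by
        have h3 : (rootSystem H).root (-i) = -(rootSystem H).root i := by
          rw [RootPairing.indexNeg_neg, RootPairing.root_reflectionPerm,
            RootPairing.reflection_apply_self]
        ext x
        have h4 : ((-i : H.root) : Weight K H L) x = -(i : Weight K H L) x :=
          LinearMap.congr_fun h3 x
        rw [Weight.coe_neg, Pi.neg_apply, h4, neg_neg]
      rwa [h2] at h1
  have key3 : ∀ x ∈ H, x ∈ M := by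
    intro x hx
    have h1 : (⟨x, hx⟩ : H) ∈ Submodule.span K (range (rootSystem H).coroot) := by
      rw [RootPairing.IsRootSystem.span_coroot_eq_top]; trivial
    suffices h2 : Submodule.span K (range (rootSystem H).coroot) ≤
        M.toSubmodule.comap H.toSubmodule.subtype from h2 h1
    rw [Submodule.span_le]
    rintro - ⟨i, rfl⟩
    obtain ⟨x, hx, hx0⟩ := (i : Weight K H L).exists_ne_zero
    obtain ⟨y, hy, hxy⟩ := exists_lie_eq_coroot (hρ i) hx hx0
    change ((coroot (i : Weight K H L) : H) : L) ∈ M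
    rw [← hxy]
    refine M.lie_mem (key2 i x hx) ?_
    have hi' : (-(i : Weight K H L)).IsNonZero := (hρ i).neg
    exact key2 ⟨-(i : Weight K H L), by simpa using hi'⟩ y (by simpa using hy)
  rw [_root_.eq_top_iff]
  intro x _
  have hx : x ∈ (⨆ χ : Weight K H L, genWeightSpace L χ).toSubmodule := by
    rw [iSup_genWeightSpace_eq_top' K H L]; trivial
  suffices h : (⨆ χ : Weight K H L, genWeightSpace L χ).toSubmodule ≤ M.toSubmodule from h hx
  rw [LieSubmodule.iSup_toSubmodule, iSup_le_iff]
  intro χ y hy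
  by_cases hχ : χ.IsZero
  · rw [hχ.eq] at hy
    refine key3 y ?_
    have : y ∈ rootSpace H (0 : H → K) := hy
    rwa [rootSpace_zero_eq] at this
  · exact key2 ⟨χ, by simpa using hχ⟩ y hy

end LieAlgebra.IsKilling

namespace DynkinDiagram

/-- A finite set of vertices is connected with respect to the adjacency relation `adj`. -/
def IsConn {ι : Type*} (adj : ι → ι → Prop) (S : Finset ι) : Prop :=
  ∀ T ⊆ S, T.Nonempty → T ≠ S → ∃ t ∈ T, ∃ u ∈ S, u ∉ T ∧ adj t u

variable {ι : Type*} {adj : ι → ι → Prop}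

theorem isConn_singleton (i : ι) : IsConn adj {i} := by
  intro T hT hne hT'
  rcases Finset.subset_singleton_iff.mp hT with rfl | rfl
  · simp at hne
  · exact absurd rfl hT'

variable [DecidableEq ι]

theorem IsConn.insert_vertex (hsymm : ∀ i j, adj i j → adj j i) {S : Finset ι} (hS : IsConn adj S)
    {a u : ι} (ha : a ∈ S) (hu : u ∉ S) (hau : adj a u) : IsConn adj (Insert.insert u S) := by
  intro T hT hne hT'
  by_cases huT : u ∈ T
  · by_cases h0 : (T.erase u).Nonempty
    · by_cases h1 : T.erase u = S
      · exact absurd (by rw [← h1, Finset.insert_erase huT]) hT'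
      · have hsub : T.erase u ⊆ S := by
          intro x hx
          have := hT (Finset.mem_of_mem_erase hx)
          exact (Finset.mem_insert.mp this).resolve_left (Finset.ne_of_mem_erase hx)
        obtain ⟨t, ht, v, hv, hvT, htv⟩ := hS _ hsub h0 h1
        refine ⟨t, Finset.mem_of_mem_erase ht, v, Finset.mem_insert_of_mem hv, ?_, htv⟩
        intro hv'
        exact hvT (Finset.mem_erase.mpr ⟨fun h ↦ hu (h ▸ hv), hv'⟩)
    · rw [Finset.not_nonempty_iff_eq_empty] at h0
      refine ⟨u, huT, a, Finset.mem_insert_of_mem ha, fun haT ↦ ?_, hsymm _ _ hau⟩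
      have : a ∈ T.erase u := Finset.mem_erase.mpr ⟨fun h ↦ hu (h ▸ ha), haT⟩
      simp [h0] at this
  · have hsub : T ⊆ S := fun x hx ↦
      (Finset.mem_insert.mp (hT hx)).resolve_left fun h ↦ huT (h ▸ hx)
    by_cases h1 : T = S
    · exact ⟨a, h1 ▸ ha, u, Finset.mem_insert_self _ _, huT, hau⟩
    · obtain ⟨t, ht, v, hv, hvT, htv⟩ := hS _ hsub hne h1
      exact ⟨t, ht, v, Finset.mem_insert_of_mem hv, hvT, htv⟩

theorem IsConn.exists_card_eq {S : Finset ι} (hS : IsConn adj S) {R : Finset (Finset ι)}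
    (hR1 : ∀ i, {i} ∈ R) (hR2 : ∀ T ∈ R, ∀ u ∉ T, (∃ t ∈ T, adj t u) → insert u T ∈ R)
    {u : ι} (hu : u ∈ S) (k : ℕ) (hk : k < S.card) :
    ∃ T ∈ R, u ∈ T ∧ T ⊆ S ∧ T.card = k + 1 := by
  induction k with
  | zero => exact ⟨{u}, hR1 u, by simp, by simpa using hu, by simp⟩
  | succ k ih =>
    obtain ⟨T, hTR, huT, hTS, hT⟩ := ih (by omega)
    obtain ⟨t, ht, v, hv, hvT, htv⟩ := hS T hTS ⟨u, huT⟩ (by rintro rfl; omega)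
    exact ⟨insert v T, hR2 T hTR v hvT ⟨t, ht, htv⟩, Finset.mem_insert_of_mem huT,
      Finset.insert_subset hv hTS, by rw [Finset.card_insert_of_notMem hvT, hT]⟩

theorem card_mul_card_add_one_le [Fintype ι] [Nonempty ι] (hsymm : ∀ i j, adj i j → adj j i)
    (hconn : IsConn adj (Finset.univ : Finset ι)) {R : Finset (Finset ι)}
    (hR1 : ∀ i, {i} ∈ R) (hR2 : ∀ T ∈ R, ∀ u ∉ T, (∃ t ∈ T, adj t u) → insert u T ∈ R) :
    Fintype.card ι * (Fintype.card ι + 1) ≤ 2 * R.card := by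
  have key (k : ℕ) (hk : k < Fintype.card ι) : ∃ S : Finset ι, S.card = k + 1 ∧ IsConn adj S ∧
      (k + 1) * (k + 2) ≤ 2 * (R.filter (· ⊆ S)).card := by
    induction k with
    | zero =>
      obtain ⟨i⟩ := ‹Nonempty ι›
      refine ⟨{i}, by simp, isConn_singleton i, ?_⟩
      have : 0 < (R.filter (· ⊆ ({i} : Finset ι))).card :=
        Finset.card_pos.mpr ⟨{i}, by simp [hR1]⟩
      omega
    | succ k ih =>
      obtain ⟨S, hS, hSc, hN⟩ := ih (by omega)
      obtain ⟨a, ha, u, -, hu, hau⟩ := hconn S (Finset.subset_univ _)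
        (Finset.card_pos.mp (by omega)) (by rintro rfl; simp at hS; omega)
      have hS' : IsConn adj (insert u S) := hSc.insert_vertex hsymm ha hu hau
      have hc : (insert u S).card = k + 2 := by rw [Finset.card_insert_of_notMem hu, hS]
      refine ⟨insert u S, hc, hS', ?_⟩
      have h1 : k + 2 ≤ ((R.filter (· ⊆ insert u S)).filter (u ∈ ·)).card := by
        rw [← Finset.card_range (k + 2)]
        refine Finset.card_le_card_of_surjOn (fun T ↦ T.card - 1) ?_
        intro j hj
        obtain ⟨T, hTR, huT, hTS, hT⟩ := IsConn.exists_card_eq hS' hR1 hR2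
          (Finset.mem_insert_self u S) j (by simpa [hc] using hj)
        exact ⟨T, by simp [hTR, hTS, huT], by simp [hT]⟩
      have h2 : R.filter (· ⊆ S) ⊆ (R.filter (· ⊆ insert u S)).filter (u ∉ ·) := by
        intro T hT
        rw [Finset.mem_filter] at hT
        simp only [Finset.mem_filter]
        exact ⟨⟨hT.1, hT.2.trans (Finset.subset_insert _ _)⟩, fun h ↦ hu (hT.2 h)⟩
      have h3 := Finset.card_le_card h2
      have h4 := Finset.card_filter_add_card_filter_not (s := R.filter (· ⊆ insert u S)) (u ∈ ·)
      nlinarith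
  have hpos : 0 < Fintype.card ι := Fintype.card_pos
  obtain ⟨S, hS, -, hN⟩ := key (Fintype.card ι - 1) (by omega)
  have h1 : Fintype.card ι - 1 + 1 = Fintype.card ι := by omega
  have h2 : Fintype.card ι - 1 + 2 = Fintype.card ι + 1 := by omega
  rw [h1, h2] at hN
  exact hN.trans (Nat.mul_le_mul_left 2 (Finset.card_le_card (Finset.filter_subset _ _)))

end DynkinDiagram

namespace DynkinDiagram

/-- The matrix entry at `(p, q)` of the Cartan matrix encoded by a list `D`: the vertex `n + 1` is
joined, among the vertices `0, …, n`, to the vertex `r` only, with entries `a` at `(r, n + 1)` and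
`b` at `(n + 1, r)`, where `(r, a, b)` is the `n`-th element of `D`. -/
def entry (D : List (ℕ × ℤ × ℤ)) (p q : ℕ) : ℤ :=
  if p = q then 2 else
  if p < q then
    match D[q - 1]? with
    | some (r, a, _) => if r = p then a else 0
    | none => 0
  else
    match D[p - 1]? with
    | some (r, _, b) => if r = q then b else 0
    | none => 0

theorem entry_append {D E : List (ℕ × ℤ × ℤ)} {p q : ℕ} (hp : p ≤ D.length) (hq : q ≤ D.length) :
    entry (D ++ E) p q = entry D p q := by
  unfold entry
  split_ifs with h1 h2
  · rfl
  · rw [List.getElem?_append_left (by omega)]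
  · rw [List.getElem?_append_left (by omega)]

theorem entry_concat_right {D : List (ℕ × ℤ × ℤ)} {p r : ℕ} {a b : ℤ} (hp : p ≤ D.length) :
    entry (D ++ [(r, a, b)]) p (D.length + 1) = if r = p then a else 0 := by
  unfold entry
  rw [if_neg (by omega), if_pos (by omega)]
  simp

theorem entry_concat_left {D : List (ℕ × ℤ × ℤ)} {q r : ℕ} {a b : ℤ} (hq : q ≤ D.length) :
    entry (D ++ [(r, a, b)]) (D.length + 1) q = if r = q then b else 0 := by
  unfold entry
  rw [if_neg (by omega), if_neg (by omega)]
  simp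

/-- The sum of the entries of the `j`-th column of a matrix weighted by `w`. -/
def colSum (D : List (ℕ × ℤ × ℤ)) (w : List ℕ) (k j : ℕ) : ℤ :=
  ∑ i : Fin k, (w.getD i 0 : ℤ) * entry D i j

/-- A matrix with the properties of a Cartan matrix of finite type. -/
structure IsFiniteType {ι : Type*} [Fintype ι] (A : Matrix ι ι ℤ) : Prop where
  diag (i : ι) : A i i = 2
  offDiag (i j : ι) (hij : i ≠ j) : A i j = 0 ∨ A i j = -1 ∨ A i j = -2 ∨ A i j = -3
  symm (i j : ι) : A i j = 0 → A j i = 0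
  exists_pos (v : ι → ℕ) (hv : v ≠ 0) : ∃ j, 0 < ∑ i, (v i : ℤ) * A i j

/-- The matrix `A` restricted to the image of `f` is the one encoded by `D`. -/
structure Realizes {ι : Type*} (A : Matrix ι ι ℤ) (D : List (ℕ × ℤ × ℤ)) {k : ℕ}
    (f : Fin k → ι) : Prop where
  inj : Function.Injective f
  eq_entry (i j : Fin k) : A (f i) (f j) = entry D i j

section

variable {ι : Type*} {A : Matrix ι ι ℤ}

theorem Realizes.snoc {D : List (ℕ × ℤ × ℤ)} {k : ℕ} {f : Fin (k + 1) → ι} (hf : Realizes A D f)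
    (hD : D.length = k) (hdiag : ∀ i, A i i = 2) {u : ι} (hu : ∀ i, f i ≠ u) {r : Fin (k + 1)}
    (h1 : ∀ i, i ≠ r → A (f i) u = 0) (h2 : ∀ i, i ≠ r → A u (f i) = 0) :
    Realizes A (D ++ [(r.1, A (f r) u, A u (f r))]) (Fin.snoc f u : Fin (k + 2) → ι) where
  inj := Fin.snoc_injective_of_injective hf.inj (by rintro ⟨i, hi⟩; exact hu i hi)
  eq_entry i j := by
    induction i using Fin.lastCases with
    | last =>
      induction j using Fin.lastCases with
      | last => simp [hdiag, entry]
      | cast j =>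
        subst hD
        rw [Fin.snoc_last, Fin.snoc_castSucc, Fin.val_last, Fin.val_castSucc,
          entry_concat_left (by omega)]
        split_ifs with h
        · rw [Fin.ext h]
        · exact h2 _ fun h' ↦ h (by rw [h'])
    | cast i =>
      induction j using Fin.lastCases with
      | last =>
        subst hD
        rw [Fin.snoc_last, Fin.snoc_castSucc, Fin.val_last, Fin.val_castSucc,
          entry_concat_right (by omega)]
        split_ifs with h
        · rw [Fin.ext h]
        · exact h1 _ fun h' ↦ h (by rw [h'])
      | cast j =>
        rw [Fin.snoc_castSucc, Fin.snoc_castSucc, Fin.val_castSucc, Fin.val_castSucc,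
          entry_append (by omega) (by omega), hf.eq_entry]

theorem Realizes.comp {D E : List (ℕ × ℤ × ℤ)} {k : ℕ} {f : Fin k → ι} (hf : Realizes A D f)
    {σ : Fin k → Fin k} (hσ : Function.Injective σ)
    (h : ∀ p q : Fin k, entry D (σ p) (σ q) = entry E p q) : Realizes A E (f ∘ σ) where
  inj := hf.inj.comp hσ
  eq_entry i j := by rw [← h, ← hf.eq_entry]; rfl

variable [Fintype ι]

theorem IsFiniteType.nonpos (hA : IsFiniteType A) {i j : ι} (hij : i ≠ j) : A i j ≤ 0 := by
  rcases hA.offDiag i j hij with h | h | h | h <;> omega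

theorem IsFiniteType.exists_pos_of_injective (hA : IsFiniteType A) {k : ℕ} {f : Fin k → ι}
    (hf : Function.Injective f) (w : Fin k → ℕ) (hw : w ≠ 0) :
    ∃ q, 0 < ∑ p, (w p : ℤ) * A (f p) (f q) := by
  classical
  let v : ι → ℕ := Function.extend f w 0
  have hvf (p) : v (f p) = w p := hf.extend_apply _ _ _
  have hsum (j : ι) : ∑ i, (v i : ℤ) * A i j = ∑ p, (w p : ℤ) * A (f p) j := by
    rw [← Finset.sum_image (s := Finset.univ) (g := f) (f := fun i ↦ (v i : ℤ) * A i j)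
      (fun x _ y _ h ↦ hf h) |>.trans (Finset.sum_congr rfl fun p _ ↦ by rw [hvf])]
    refine (Finset.sum_subset (Finset.subset_univ _) fun i _ hi ↦ ?_).symm
    have : v i = 0 := Function.extend_apply' _ _ _ (by simpa using hi)
    simp [this]
  obtain ⟨j, hj⟩ := hA.exists_pos v (fun h ↦ hw (by ext p; rw [← hvf, h]; rfl))
  rw [hsum] at hj
  by_cases hjf : ∃ q, f q = j
  · obtain ⟨q, rfl⟩ := hjf
    exact ⟨q, hj⟩
  · refine absurd hj (not_lt.mpr (Finset.sum_nonpos fun p _ ↦ ?_))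
    exact mul_nonpos_of_nonneg_of_nonpos (by positivity) (hA.nonpos fun h ↦ hjf ⟨p, h⟩)

theorem IsFiniteType.not_realizes (hA : IsFiniteType A) {D : List (ℕ × ℤ × ℤ)} {k : ℕ}
    {w : List ℕ} (hw : ∃ i : Fin k, w.getD i 0 ≠ 0) (hcol : ∀ j : Fin k, colSum D w k j ≤ 0)
    {f : Fin k → ι} : ¬ Realizes A D f := by
  intro hf
  obtain ⟨q, hq⟩ := hA.exists_pos_of_injective hf.inj (fun i ↦ w.getD i 0)
    (fun h ↦ by obtain ⟨i, hi⟩ := hw; exact hi (congrFun h i))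
  have := hcol q
  simp only [hf.eq_entry] at hq
  exact absurd hq (not_lt.mpr this)

/-- A set of vertices of a tree containing the path from `i` to `j`, with row sums showing that
no new vertex can be joined to both `i` and `j`. -/
def IsPath (D : List (ℕ × ℤ × ℤ)) (k : ℕ) (i j : ℕ) (w : List ℕ) : Prop :=
  w.getD i 0 = 1 ∧ w.getD j 0 = 1 ∧
    ∀ t : Fin k, colSum D w k t ≤ if (t : ℕ) = i ∨ (t : ℕ) = j then 1 else 0

instance (D : List (ℕ × ℤ × ℤ)) (k : ℕ) (i j : ℕ) (w : List ℕ) : Decidable (IsPath D k i j w) := by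
  unfold IsPath; infer_instance

theorem IsFiniteType.eq_zero_of_isPath (hA : IsFiniteType A) {D : List (ℕ × ℤ × ℤ)} {k : ℕ}
    {f : Fin k → ι} (hf : Realizes A D f) {u : ι} (hu : ∀ i, f i ≠ u) {i j : Fin k} (hij : i ≠ j)
    {w : List ℕ} (hw : IsPath D k i j w) (hi : A (f i) u ≠ 0) : A (f j) u = 0 := by
  by_contra hj
  have neg {x y : ι} (h : x ≠ y) (h0 : A x y ≠ 0) : A x y ≤ -1 := by
    rcases hA.offDiag x y h with h | h | h | h <;> omega
  have hi' : A u (f i) ≤ -1 := neg (hu i).symm fun h ↦ hi (hA.symm _ _ h)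
  have hj' : A u (f j) ≤ -1 := neg (hu j).symm fun h ↦ hj (hA.symm _ _ h)
  have hi := neg (hu i) hi
  have hj := neg (hu j) hj
  obtain ⟨h1, h2, h3⟩ := hw
  obtain ⟨q, hq⟩ := hA.exists_pos_of_injective (f := (Fin.snoc f u : Fin (k + 1) → ι))
    (Fin.snoc_injective_of_injective hf.inj (by rintro ⟨i, hi⟩; exact hu i hi))
    (Fin.snoc (fun t ↦ w.getD t 0) 1) (fun h ↦ by
      have := congrFun h (Fin.last k)
      simp at this)
  rw [Fin.sum_univ_castSucc] at hq
  simp only [Fin.snoc_castSucc, Fin.snoc_last] at hq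
  induction q using Fin.lastCases with
  | last =>
    simp only [Fin.snoc_last, hA.diag] at hq
    have hle : ∑ x : Fin k, ((w.getD x 0 : ℕ) : ℤ) * A (f x) u ≤
        ∑ x ∈ ({i, j} : Finset (Fin k)), ((w.getD x 0 : ℕ) : ℤ) * A (f x) u := by
      rw [← Finset.sum_sdiff (Finset.subset_univ ({i, j} : Finset (Fin k)))]
      have : ∑ x ∈ Finset.univ \ ({i, j} : Finset (Fin k)),
          ((w.getD x 0 : ℕ) : ℤ) * A (f x) u ≤ 0 :=
        Finset.sum_nonpos fun x _ ↦
          mul_nonpos_of_nonneg_of_nonpos (by positivity) (hA.nonpos (hu x))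
      linarith
    rw [Finset.sum_pair hij, h1, h2] at hle
    push_cast at hle hq
    linarith
  | cast q =>
    simp only [Fin.snoc_castSucc, hf.eq_entry] at hq
    have h4 := h3 q
    unfold colSum at h4
    have h5 := hA.nonpos (hu q).symm
    split_ifs at h4 with h
    · rcases h with h | h
      · obtain rfl := Fin.ext h; push_cast at hq; linarith
      · obtain rfl := Fin.ext h; push_cast at hq; linarith
    · push_cast at hq; linarith

theorem IsFiniteType.mem_options (hA : IsFiniteType A) {i j : ι} (hij : i ≠ j) (h : A i j ≠ 0) :
    (A i j, A j i) ∈ [((-1 : ℤ), (-1 : ℤ)), (-1, -2), (-2, -1), (-1, -3), (-3, -1)] := by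
  have h' : A j i ≠ 0 := fun h0 ↦ h (hA.symm _ _ h0)
  have key (p q : ℕ) (hpq : p ≠ 0) : 0 < 2 * p + q * A j i ∨ 0 < p * A i j + 2 * q := by
    obtain ⟨t, ht⟩ := hA.exists_pos_of_injective (f := ![i, j]) (by
      intro a b hab
      fin_cases a <;> fin_cases b <;> simp_all) ![p, q] (fun h0 ↦ hpq (congrFun h0 0))
    rw [Fin.sum_univ_two] at ht
    fin_cases t <;> simp [hA.diag] at ht
    · left; linarith
    · right; linarith
  have h1 := key 1 1 (by simp)
  have h2 := key 2 3 (by simp)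
  have h3 := key 3 2 (by simp)
  have h4 := key 1 2 (by simp)
  have h5 := key 2 1 (by simp)
  rcases hA.offDiag i j hij with e | e | e | e <;>
    rcases hA.offDiag j i hij.symm with e' | e' | e' | e' <;> simp_all

end

end DynkinDiagram

namespace DynkinDiagram

/-- The connected Dynkin diagrams with `k` vertices, in the order `A`, `B`, `C`, `D`, followed by
the exceptional one, if any. -/
def diagrams : ℕ → List (List (ℕ × ℤ × ℤ))
  | 1 => [
    []]
  | 2 => [
    [(0, -1, -1)],
    [(0, -2, -1)],
    [(0, -3, -1)]]
  | 3 => [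
    [(0, -1, -1), (1, -1, -1)],
    [(0, -1, -1), (1, -2, -1)],
    [(0, -1, -1), (1, -1, -2)]]
  | 4 => [
    [(0, -1, -1), (1, -1, -1), (2, -1, -1)],
    [(0, -1, -1), (1, -1, -1), (2, -2, -1)],
    [(0, -1, -1), (1, -1, -1), (2, -1, -2)],
    [(0, -1, -1), (1, -1, -1), (1, -1, -1)],
    [(0, -1, -1), (1, -2, -1), (2, -1, -1)]]
  | 5 => [
    [(0, -1, -1), (1, -1, -1), (2, -1, -1), (3, -1, -1)],
    [(0, -1, -1), (1, -1, -1), (2, -1, -1), (3, -2, -1)],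
    [(0, -1, -1), (1, -1, -1), (2, -1, -1), (3, -1, -2)],
    [(0, -1, -1), (1, -1, -1), (2, -1, -1), (2, -1, -1)]]
  | 6 => [
    [(0, -1, -1), (1, -1, -1), (2, -1, -1), (3, -1, -1), (4, -1, -1)],
    [(0, -1, -1), (1, -1, -1), (2, -1, -1), (3, -1, -1), (4, -2, -1)],
    [(0, -1, -1), (1, -1, -1), (2, -1, -1), (3, -1, -1), (4, -1, -2)],
    [(0, -1, -1), (1, -1, -1), (2, -1, -1), (3, -1, -1), (3, -1, -1)],
    [(0, -1, -1), (1, -1, -1), (2, -1, -1), (3, -1, -1), (2, -1, -1)]]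
  | _ => []

/-- Vectors with nonpositive column sums for the diagrams that are not of finite type. -/
def nullVectors : ℕ → List (List ℕ)
  | 2 =>
    [[2, 1, 1], [2, 1, 3], [1, 2, 1], [1, 2, 3], [2, 2, 1], [1, 1, 1], [1, 2, 2], [2, 3, 1]]
  | 3 =>
    [[2, 1, 0, 1], [2, 1, 0, 3], [1, 2, 1, 1], [1, 2, 1, 2], [0, 1, 2, 1], [0, 1, 2, 3], [2, 2, 2,
     1], [1, 1, 1, 1], [1, 2, 2, 1], [0, 1, 2, 2], [2, 2, 1, 1], [2, 2, 1, 2], [0, 1, 1, 1]]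
  | 4 =>
    [[2, 1, 0, 0, 1], [2, 1, 0, 0, 3], [1, 2, 1, 0, 1], [1, 2, 1, 0, 2], [0, 1, 2, 1, 1], [0, 1,
     2, 1, 2], [0, 0, 1, 2, 1], [0, 0, 1, 2, 3], [2, 2, 2, 2, 1], [1, 1, 1, 1, 1], [1, 2, 2, 2,
     1], [0, 1, 2, 2, 1], [1, 2, 3, 4, 2], [2, 2, 2, 1, 1], [2, 2, 2, 1, 2], [1, 2, 2, 1, 1], [1,
     2, 3, 2, 1], [2, 2, 1, 1, 1], [2, 2, 1, 1, 2], [1, 2, 1, 1, 1], [1, 2, 2, 1, 2], [1, 2, 1, 2,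
     1], [1, 2, 1, 2, 2], [2, 3, 4, 2, 1]]
  | 5 =>
    [[2, 1, 0, 0, 0, 1], [2, 1, 0, 0, 0, 3], [1, 2, 1, 0, 0, 1], [1, 2, 1, 0, 0, 2], [0, 1, 2, 1,
     0, 1], [0, 1, 2, 1, 0, 2], [0, 0, 1, 2, 1, 1], [0, 0, 1, 2, 1, 2], [0, 0, 0, 1, 2, 1], [0, 0,
     0, 1, 2, 3], [2, 2, 2, 2, 2, 1], [1, 1, 1, 1, 1, 1], [1, 2, 2, 2, 2, 1], [0, 1, 2, 2, 2, 1],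
     [0, 0, 1, 2, 2, 1], [0, 1, 2, 3, 4, 2], [2, 2, 2, 2, 1, 1], [2, 2, 2, 2, 1, 2], [1, 2, 2, 2,
     1, 1], [0, 1, 2, 2, 1, 1], [0, 1, 2, 3, 2, 1], [2, 2, 2, 1, 1, 1], [2, 2, 2, 1, 1, 2], [1, 2,
     2, 1, 1, 1], [0, 1, 2, 1, 1, 1], [0, 1, 2, 2, 1, 2], [0, 1, 2, 1, 2, 1], [0, 1, 2, 1, 2, 2]]
  | _ => []

/-- Permutations bringing the extended diagrams to a standard form. -/
def renumberings : ℕ → List (List ℕ)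
  | 1 =>
    [[0, 1], [1, 0]]
  | 2 =>
    [[1, 0, 2], [0, 1, 2], [2, 0, 1], [2, 1, 0]]
  | 3 =>
    [[2, 1, 0, 3], [0, 1, 2, 3], [3, 0, 1, 2], [3, 2, 1, 0]]
  | 4 =>
    [[3, 2, 1, 0, 4], [0, 1, 2, 3, 4], [4, 0, 1, 2, 3], [4, 2, 1, 0, 3], [4, 3, 1, 0, 2]]
  | 5 =>
    [[4, 3, 2, 1, 0, 5], [0, 1, 2, 3, 4, 5], [5, 0, 1, 2, 3, 4], [0, 1, 2, 3, 5, 4], [0, 1, 2, 4,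
     5, 3]]
  | _ => []

/-- All vectors of length `k` with entries `0` and `1`. -/
def bitVectors : ℕ → List (List ℕ)
  | 0 => [[]]
  | k + 1 => (bitVectors k).map (0 :: ·) ++ (bitVectors k).map (1 :: ·)

/-- Every one-vertex extension of a diagram with `k` vertices either is again a Dynkin diagram
or has a vector with nonpositive column sums. -/
def IsStep (k : ℕ) : Prop :=
  ∀ D ∈ diagrams k, D.length + 1 = k ∧
    (∀ i j : Fin k, i ≠ j → ∃ w ∈ bitVectors k, IsPath D k i j w) ∧
    ∀ i : Fin k, ∀ o ∈ [((-1 : ℤ), (-1 : ℤ)), (-1, -2), (-2, -1), (-1, -3), (-3, -1)],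
      (∃ w ∈ nullVectors k, (∃ t : Fin (k + 1), w.getD t 0 ≠ 0) ∧
        ∀ t : Fin (k + 1), colSum (D ++ [(i.1, o)]) w (k + 1) t ≤ 0) ∨
      ∃ σ ∈ renumberings k,
        Function.Injective (fun p : Fin (k + 1) ↦ Fin.ofNat (k + 1) (σ.getD p 0)) ∧
        ∃ E ∈ diagrams (k + 1), ∀ p q : Fin (k + 1),
          entry (D ++ [(i.1, o)]) (Fin.ofNat (k + 1) (σ.getD p 0))
              (Fin.ofNat (k + 1) (σ.getD q 0)) =
            entry E p q

instance (k : ℕ) : Decidable (IsStep k) := by unfold IsStep; infer_instance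

theorem isStep_one : IsStep 1 := by decide +kernel
theorem isStep_two : IsStep 2 := by decide +kernel
theorem isStep_three : IsStep 3 := by decide +kernel
theorem isStep_four : IsStep 4 := by decide +kernel
theorem isStep_five : IsStep 5 := by decide +kernel

section

variable {ι : Type*} [Fintype ι] {A : Matrix ι ι ℤ}

theorem IsFiniteType.exists_realizes_succ (hA : IsFiniteType A)
    (hconn : IsConn (fun i j ↦ A i j ≠ 0) (Finset.univ : Finset ι)) {k : ℕ}
    (hk : IsStep (k + 1)) (hcard : k + 1 < Fintype.card ι) {D : List (ℕ × ℤ × ℤ)}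
    (hD : D ∈ diagrams (k + 1)) {f : Fin (k + 1) → ι} (hf : Realizes A D f) :
    ∃ E ∈ diagrams (k + 2), ∃ g : Fin (k + 2) → ι, Realizes A E g := by
  classical
  obtain ⟨hlen, hpath, hext⟩ := hk D hD
  obtain ⟨t, ht, u, -, hu, htu⟩ := hconn (Finset.univ.image f) (Finset.subset_univ _)
    ⟨f 0, by simp⟩ (fun h ↦ by
      have := Finset.card_image_of_injective Finset.univ hf.inj
      rw [h, Finset.card_univ, Finset.card_univ, Fintype.card_fin] at this
      omega)
  obtain ⟨r, -, rfl⟩ := Finset.mem_image.mp ht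
  have hu' (i) : f i ≠ u := fun h ↦ hu (by simp [← h])
  have h1 (i) (hi : i ≠ r) : A (f i) u = 0 := by
    obtain ⟨w, -, hw⟩ := hpath r i hi.symm
    exact hA.eq_zero_of_isPath hf hu' hi.symm hw htu
  have hg := hf.snoc (by omega) hA.diag hu' h1 (fun i hi ↦ hA.symm _ _ (h1 i hi))
  rcases hext r _ (hA.mem_options (hu' r) htu) with ⟨w, -, hw, hw'⟩ | ⟨σ, -, hσ, E, hE, hσ'⟩
  · exact absurd hg (hA.not_realizes hw hw')
  · exact ⟨E, hE, _, hg.comp hσ hσ'⟩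

theorem IsFiniteType.exists_realizes (hA : IsFiniteType A)
    (hconn : IsConn (fun i j ↦ A i j ≠ 0) (Finset.univ : Finset ι)) (h0 : 0 < Fintype.card ι)
    (hcard : Fintype.card ι ≤ 6) :
    ∃ D ∈ diagrams (Fintype.card ι), ∃ f : Fin (Fintype.card ι) → ι, Realizes A D f := by
  have key (k : ℕ) (hk : k < Fintype.card ι) :
      ∃ D ∈ diagrams (k + 1), ∃ f : Fin (k + 1) → ι, Realizes A D f := by
    induction k with
    | zero =>
      have : Subsingleton (Fin (0 + 1)) := inferInstanceAs (Subsingleton (Fin 1))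
      obtain ⟨i⟩ := Fintype.card_pos_iff.mp h0
      refine ⟨[], by simp [diagrams], fun _ ↦ i, Function.injective_of_subsingleton _, ?_⟩
      intro i j
      simp [hA.diag, entry, Subsingleton.elim i j]
    | succ k ih =>
      obtain ⟨D, hD, f, hf⟩ := ih (by omega)
      refine hA.exists_realizes_succ hconn ?_ hk hD hf
      have : k < 5 := by omega
      interval_cases k
      exacts [isStep_one, isStep_two, isStep_three, isStep_four, isStep_five]
  obtain ⟨n, hn⟩ : ∃ n, Fintype.card ι = n + 1 := ⟨_, (Nat.succ_pred_eq_of_pos h0).symm⟩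
  rw [hn]
  exact key n (by omega)

end

end DynkinDiagram

namespace RootPairing

theorem even_card {ι R M N : Type*} [Finite ι] [Field R] [CharZero R] [AddCommGroup M] [Module R M]
    [AddCommGroup N] [Module R N] (P : RootPairing ι R M N) : Even (Nat.card ι) := by
  have := Fintype.ofFinite ι
  classical
  let := P.indexNeg
  have h : ∑ _i : ι, (1 : ZMod 2) = 0 := by
    refine Finset.sum_involution (fun i _ ↦ -i) (fun _ _ ↦ by decide) (fun i _ _ h ↦ P.ne_zero i ?_)
      (fun _ _ ↦ Finset.mem_univ _) (fun i _ ↦ neg_neg i)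
    have h1 : P.root (-i) = -P.root i := by
      rw [RootPairing.indexNeg_neg, RootPairing.root_reflectionPerm,
        RootPairing.reflection_apply_self]
    rw [h, eq_neg_iff_add_eq_zero, ← two_smul R] at h1
    exact (smul_eq_zero.mp h1).resolve_left two_ne_zero
  rw [Finset.sum_const, nsmul_one, Finset.card_univ, ZMod.natCast_eq_zero_iff_even] at h
  rwa [Nat.card_eq_fintype_card]

namespace Base

open DynkinDiagram

variable {ι R M N : Type*} [Field R] [AddCommGroup M] [Module R M] [AddCommGroup N]
  [Module R N] {P : RootPairing ι R M N} (b : P.Base)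

/-- The integral combination of simple roots with coefficients `v`. -/
def simpleSum (v : b.support → ℤ) : M := ∑ i, v i • P.root i

variable [P.IsCrystallographic] in
theorem coroot'_simpleSum (v : b.support → ℤ) (j : b.support) :
    P.coroot' j (b.simpleSum v) = ((∑ i, v i * b.cartanMatrix i j : ℤ) : R) := by
  simp only [simpleSum, map_sum, map_zsmul, root_coroot'_eq_pairing, Int.cast_sum, Int.cast_mul,
    zsmul_eq_mul]
  refine Finset.sum_congr rfl fun i _ ↦ ?_
  rw [← b.algebraMap_cartanMatrixIn_apply ℤ i j]
  rfl

theorem simpleSum_injective [CharZero R] : Function.Injective b.simpleSum := by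
  intro v w h
  funext i
  exact Fintype.linearIndependent_iffₛ.mp (b.linearIndepOn_root.restrict_scalars' ℤ) v w h i

theorem exists_eq_simpleSum [CharZero R] (i : ι) : ∃ v, P.root i = b.simpleSum v := by
  obtain ⟨v, -, -, hv⟩ := b.exists_root_eq_sum_int i
  refine ⟨fun j ↦ v j, hv.trans ?_⟩
  rw [simpleSum, ← Finset.sum_coe_sort]

variable [P.IsCrystallographic]

theorem root_reflectionPerm_eq (i : ι) {v : b.support → ℤ} (hv : P.root i = b.simpleSum v)
    [DecidableEq b.support] (j : b.support) : P.root (P.reflectionPerm j i) =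
      b.simpleSum (Function.update v j (v j - ∑ k, v k * b.cartanMatrix k j)) := by
  rw [root_reflectionPerm, reflection_apply, hv, coroot'_simpleSum]
  have h : Function.update v j (v j - ∑ k, v k * b.cartanMatrix k j) =
      v - Pi.single j (∑ k, v k * b.cartanMatrix k j) := by
    funext k
    by_cases hk : k = j
    · subst hk; simp
    · simp [hk]
  rw [h]
  simp only [simpleSum, Pi.sub_apply, sub_smul, Finset.sum_sub_distrib, Pi.single_apply, ite_smul,
    zero_smul, Finset.sum_ite_eq', Finset.mem_univ, if_true, Int.cast_smul_eq_zsmul]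

variable [CharZero R] [Finite ι]

theorem isFiniteType_cartanMatrix [P.IsRootSystem] : IsFiniteType b.cartanMatrix where
  diag := b.cartanMatrix_apply_same
  offDiag i j hij := by
    have := b.cartanMatrix_mem_of_ne hij
    simp only [Set.mem_insert_iff, Set.mem_singleton_iff] at this
    tauto
  symm i j := b.cartanMatrix_apply_eq_zero_iff_symm.mp
  exists_pos v hv := by
    classical
    obtain ⟨d, hd, hpos⟩ := b.exists_cartanMatrix_mul_diagaonal_posDef
    have h1 := hpos.dotProduct_mulVec_pos (x := fun i ↦ (v i : ℤ)) (fun h ↦ hv (by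
      funext i
      simpa using congrFun h i))
    by_contra! hcon
    refine absurd h1 (not_lt.mpr ?_)
    have : (star fun i ↦ (v i : ℤ)) ⬝ᵥ
        ((b.cartanMatrix * Matrix.diagonal d).mulVec fun i ↦ (v i : ℤ))
        = ∑ j, (∑ i, (v i : ℤ) * b.cartanMatrix i j) * (d j * v j) := by
      simp only [dotProduct, Matrix.mulVec, Pi.star_apply, star_trivial, Matrix.mul_diagonal,
        Finset.mul_sum, Finset.sum_mul]
      rw [Finset.sum_comm]
      exact Finset.sum_congr rfl fun _ _ ↦ Finset.sum_congr rfl fun _ _ ↦ by ring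
    rw [this]
    exact Finset.sum_nonpos fun j _ ↦ mul_nonpos_of_nonpos_of_nonneg (hcon j)
      (mul_nonneg (hd j).le (by positivity))

variable [P.IsReduced]

theorem isConn_cartanMatrix [P.IsIrreducible] :
    IsConn (fun i j ↦ b.cartanMatrix i j ≠ 0) (Finset.univ : Finset b.support) := by
  rintro T - ⟨t, ht⟩ hT
  by_contra! hcon
  refine hT (Finset.eq_univ_iff_forall.mpr fun j ↦
    b.induction_on_cartanMatrix (fun i ↦ i ∈ T) ht fun i k hi hk ↦ ?_)
  by_contra hkT
  exact hk (b.cartanMatrix_apply_eq_zero_iff_symm.mp (hcon i hi k (Finset.mem_univ _) hkT))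

theorem card_support_mul_le [P.IsRootSystem] [P.IsIrreducible] :
    b.support.card * (b.support.card + 1) ≤ Nat.card ι := by
  classical
  have := Fintype.ofFinite ι
  let ind (T : Finset b.support) (i : b.support) : ℤ := if i ∈ T then 1 else 0
  let Rt : Finset (Finset b.support) :=
    Finset.univ.filter fun T ↦ ∃ i, P.root i = b.simpleSum (ind T)
  rcases isEmpty_or_nonempty b.support with hemp | hne
  · have : b.support = ∅ := Finset.isEmpty_coe_sort.mp hemp
    simp [this]
  have hA := b.isFiniteType_cartanMatrix
  have hgrow := card_mul_card_add_one_le (adj := fun i j ↦ b.cartanMatrix i j ≠ 0) (R := Rt)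
    (fun i j h h' ↦ h (hA.symm _ _ h')) b.isConn_cartanMatrix
    (fun i ↦ by
      simp only [Rt, Finset.mem_filter, Finset.mem_univ, true_and]
      exact ⟨i, by simp [simpleSum, ind]⟩)
    (fun T hT u hu ⟨t, ht, htu⟩ ↦ by
      simp only [Rt, Finset.mem_filter, Finset.mem_univ, true_and] at hT ⊢
      obtain ⟨i, hi⟩ := hT
      have hadd : b.simpleSum (ind (insert u T)) = P.root i + P.root u := by
        rw [hi]
        have : ind (insert u T) = ind T + Pi.single u 1 := by
          funext k
          by_cases hk : k = u
          · subst hk; simp [ind, hu]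
          · simp [ind, hk]
        rw [this]
        simp only [simpleSum, Pi.add_apply, add_smul, Finset.sum_add_distrib]
        congr 1
        simp [Pi.single_apply]
      obtain ⟨k, hk⟩ : P.root i + P.root u ∈ Set.range P.root := by
        refine P.root_add_root_mem_of_pairingIn_neg ?_ ?_
        · have h1 : (P.pairingIn ℤ i u : R) = ((∑ k, ind T k * b.cartanMatrix k u : ℤ) : R) := by
            rw [← b.coroot'_simpleSum, ← hi, root_coroot'_eq_pairing, ← P.algebraMap_pairingIn ℤ]
            rfl
          rw [Int.cast_injective h1]
          refine Finset.sum_neg' (fun k _ ↦ ?_) ⟨t, Finset.mem_univ _, ?_⟩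
          · by_cases hk : k ∈ T
            · simpa [ind, hk] using hA.nonpos (i := k) (j := u) (fun h ↦ hu (h ▸ hk))
            · simp [ind, hk]
          · have := hA.nonpos (i := t) (j := u) (fun h ↦ hu (h ▸ ht))
            simpa [ind, ht] using lt_of_le_of_ne this htu
        · intro h
          have h0 : b.simpleSum (ind (insert u T)) = b.simpleSum 0 := by
            rw [hadd, h]; simp [simpleSum]
          have := congrFun (b.simpleSum_injective h0) u
          simp [ind] at this
      exact ⟨k, by rw [hk, hadd]⟩)
  rw [Fintype.card_coe] at hgrow
  refine hgrow.trans ?_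
  have hRt (T : Rt) : ∃ i, P.root i = b.simpleSum (ind T) :=
    (Finset.mem_filter.mp T.2).2
  choose g hg using hRt
  let := P.indexNeg
  have hneg (i : ι) : P.root (-i) = -P.root i := by
    rw [RootPairing.indexNeg_neg, RootPairing.root_reflectionPerm,
      RootPairing.reflection_apply_self]
  have hind {T T' : Finset b.support} (h : ind T = ind T') : T = T' := by
    ext k
    have := congrFun h k
    by_cases h1 : k ∈ T <;> by_cases h2 : k ∈ T' <;> simp_all [ind]
  have hnonneg (T : Finset b.support) (k : b.support) : 0 ≤ ind T k := by
    simp only [ind]; split_ifs <;> simp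
  have hginj : Function.Injective g := by
    intro T T' h
    exact Subtype.ext (hind (b.simpleSum_injective (by rw [← hg, ← hg, h])))
  have hgneg (T T' : Rt) : g T ≠ -g T' := by
    intro h
    have h1 : b.simpleSum (ind T) = b.simpleSum (-ind T') := by
      rw [← hg, h, hneg, hg]; simp [simpleSum]
    have h2 := b.simpleSum_injective h1
    refine P.ne_zero (g T) ?_
    rw [hg, show ind T = 0 from ?_]
    · simp [simpleSum]
    · funext k
      have h3 : ind T k = -ind T' k := congrFun h2 k
      have h4 := hnonneg T k
      have h5 := hnonneg T' k
      show ind T k = 0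
      omega
  have hinj : Function.Injective (Sum.elim g (fun T ↦ -g T)) := by
    refine Function.Injective.sumElim hginj (neg_injective.comp hginj) hgneg
  have h3 := Fintype.card_le_of_injective _ hinj
  rw [Fintype.card_sum, Fintype.card_coe] at h3
  rw [Nat.card_eq_fintype_card]
  omega

end Base

end RootPairing

namespace DynkinDiagram

/-- The positive roots of some root systems of even rank, in terms of the simple roots. -/
def posRoots : ℕ → List (List (List ℤ))
  | 2 => [
    [[1, 0], [0, 1], [1, 1]],
    [[1, 0], [0, 1], [1, 2], [1, 1]],
    [[1, 0], [0, 1], [1, 3], [1, 1], [2, 3], [1, 2]]]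
  | 4 => [
    [[1, 0, 0, 0], [0, 1, 0, 0], [0, 0, 1, 0], [0, 0, 0, 1], [1, 1, 0, 0], [0, 1, 1, 0], [0, 0, 1,
     1], [1, 1, 1, 0], [0, 1, 1, 1], [1, 1, 1, 1]],
    [[1, 0, 0, 0], [0, 1, 0, 0], [0, 0, 1, 0], [0, 0, 0, 1], [1, 1, 0, 0], [0, 1, 1, 0], [0, 0, 1,
     2], [0, 0, 1, 1], [1, 1, 1, 0], [0, 1, 1, 2], [0, 1, 1, 1], [1, 1, 1, 2], [0, 1, 2, 2], [1,
     1, 1, 1], [1, 1, 2, 2], [1, 2, 2, 2]],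
    [[1, 0, 0, 0], [0, 1, 0, 0], [0, 0, 1, 0], [0, 0, 0, 1], [1, 1, 0, 0], [0, 1, 1, 0], [0, 0, 1,
     1], [0, 0, 2, 1], [1, 1, 1, 0], [0, 1, 1, 1], [0, 2, 2, 1], [1, 1, 1, 1], [0, 1, 2, 1], [2,
     2, 2, 1], [1, 1, 2, 1], [1, 2, 2, 1]],
    [[1, 0, 0, 0], [0, 1, 0, 0], [0, 0, 1, 0], [0, 0, 0, 1], [1, 1, 0, 0], [0, 1, 1, 0], [0, 1, 0,
     1], [1, 1, 1, 0], [1, 1, 0, 1], [0, 1, 1, 1], [1, 1, 1, 1], [1, 2, 1, 1]],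
    [[1, 0, 0, 0], [0, 1, 0, 0], [0, 0, 1, 0], [0, 0, 0, 1], [1, 1, 0, 0], [0, 1, 2, 0], [0, 1, 1,
     0], [0, 0, 1, 1], [1, 1, 2, 0], [0, 1, 2, 2], [1, 1, 1, 0], [0, 1, 1, 1], [1, 2, 2, 0], [1,
     1, 2, 2], [1, 1, 1, 1], [0, 1, 2, 1], [1, 2, 2, 2], [1, 1, 2, 1], [1, 2, 4, 2], [1, 2, 2, 1],
     [1, 3, 4, 2], [1, 2, 3, 1], [2, 3, 4, 2], [1, 2, 3, 2]]]
  | 6 => [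
    [[1, 0, 0, 0, 0, 0], [0, 1, 0, 0, 0, 0], [0, 0, 1, 0, 0, 0], [0, 0, 0, 1, 0, 0], [0, 0, 0, 0,
     1, 0], [0, 0, 0, 0, 0, 1], [1, 1, 0, 0, 0, 0], [0, 1, 1, 0, 0, 0], [0, 0, 1, 1, 0, 0], [0, 0,
     0, 1, 1, 0], [0, 0, 0, 0, 1, 1], [1, 1, 1, 0, 0, 0], [0, 1, 1, 1, 0, 0], [0, 0, 1, 1, 1, 0],
     [0, 0, 0, 1, 1, 1], [1, 1, 1, 1, 0, 0], [0, 1, 1, 1, 1, 0], [0, 0, 1, 1, 1, 1], [1, 1, 1, 1,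
     1, 0], [0, 1, 1, 1, 1, 1], [1, 1, 1, 1, 1, 1]],
    [[1, 0, 0, 0, 0, 0], [0, 1, 0, 0, 0, 0], [0, 0, 1, 0, 0, 0], [0, 0, 0, 1, 0, 0], [0, 0, 0, 0,
     1, 0], [0, 0, 0, 0, 0, 1], [1, 1, 0, 0, 0, 0], [0, 1, 1, 0, 0, 0], [0, 0, 1, 1, 0, 0], [0, 0,
     0, 1, 1, 0], [0, 0, 0, 1, 0, 1], [1, 1, 1, 0, 0, 0], [0, 1, 1, 1, 0, 0], [0, 0, 1, 1, 1, 0],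
     [0, 0, 1, 1, 0, 1], [0, 0, 0, 1, 1, 1], [1, 1, 1, 1, 0, 0], [0, 1, 1, 1, 1, 0], [0, 1, 1, 1,
     0, 1], [0, 0, 1, 1, 1, 1], [1, 1, 1, 1, 1, 0], [1, 1, 1, 1, 0, 1], [0, 1, 1, 1, 1, 1], [0, 0,
     1, 2, 1, 1], [1, 1, 1, 1, 1, 1], [0, 1, 1, 2, 1, 1], [1, 1, 1, 2, 1, 1], [0, 1, 2, 2, 1, 1],
     [1, 1, 2, 2, 1, 1], [1, 2, 2, 2, 1, 1]]]
  | _ => []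

/-- The positive roots of the root system of type `E₆`. -/
def posRootsE6 : List (List ℤ) :=
    [[1, 0, 0, 0, 0, 0], [0, 1, 0, 0, 0, 0], [0, 0, 1, 0, 0, 0], [0, 0, 0, 1, 0, 0], [0, 0, 0, 0,
     1, 0], [0, 0, 0, 0, 0, 1], [1, 1, 0, 0, 0, 0], [0, 1, 1, 0, 0, 0], [0, 0, 1, 1, 0, 0], [0, 0,
     1, 0, 0, 1], [0, 0, 0, 1, 1, 0], [1, 1, 1, 0, 0, 0], [0, 1, 1, 1, 0, 0], [0, 1, 1, 0, 0, 1],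
     [0, 0, 1, 1, 1, 0], [0, 0, 1, 1, 0, 1], [1, 1, 1, 1, 0, 0], [1, 1, 1, 0, 0, 1], [0, 1, 1, 1,
     1, 0], [0, 1, 1, 1, 0, 1], [0, 0, 1, 1, 1, 1], [1, 1, 1, 1, 1, 0], [1, 1, 1, 1, 0, 1], [0, 1,
     1, 1, 1, 1], [0, 1, 2, 1, 0, 1], [1, 1, 1, 1, 1, 1], [1, 1, 2, 1, 0, 1], [0, 1, 2, 1, 1, 1],
     [1, 1, 2, 1, 1, 1], [1, 2, 2, 1, 0, 1], [0, 1, 2, 2, 1, 1], [1, 2, 2, 1, 1, 1], [1, 1, 2, 2,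
     1, 1], [1, 2, 2, 2, 1, 1], [1, 2, 3, 2, 1, 1], [1, 2, 3, 2, 1, 2]]

/-- The list of positive roots together with their negatives. -/
def withNeg (S : List (List ℤ)) : List (List ℤ) := S ++ S.map (·.map (-·))

/-- The list `S` of vectors contains the simple roots and is stable under negation and under the
simple reflections. -/
def IsReflClosed (D : List (ℕ × ℤ × ℤ)) (k : ℕ) (S : List (List ℤ)) : Prop :=
  (∀ l ∈ S, l.length = k) ∧
    (∀ p : Fin k, (List.range k).map (fun i : ℕ ↦ if i = p then 1 else 0) ∈ S) ∧
    (∀ l ∈ S, ∀ j : Fin k, l.set j (l.getD j 0 - ∑ i : Fin k, l.getD i 0 * entry D i j) ∈ S) ∧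
    ∀ l ∈ S, l.map (-·) ∈ S

instance (D : List (ℕ × ℤ × ℤ)) (k : ℕ) (S : List (List ℤ)) : Decidable (IsReflClosed D k S) := by
  unfold IsReflClosed; infer_instance

theorem exists_isReflClosed_two :
    ∀ D ∈ diagrams 2, ∃ S ∈ posRoots 2, IsReflClosed D 2 (withNeg S) ∧ (withNeg S).length < 76 := by
  decide +kernel

theorem exists_isReflClosed_four :
    ∀ D ∈ diagrams 4, ∃ S ∈ posRoots 4, IsReflClosed D 4 (withNeg S) ∧ (withNeg S).length < 74 := by
  decide +kernel

/-- The diagram of type `B₆`. -/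
def diagramB6 : List (ℕ × ℤ × ℤ) :=
  [(0, -1, -1), (1, -1, -1), (2, -1, -1), (3, -1, -1), (4, -2, -1)]

/-- The diagram of type `C₆`. -/
def diagramC6 : List (ℕ × ℤ × ℤ) :=
  [(0, -1, -1), (1, -1, -1), (2, -1, -1), (3, -1, -1), (4, -1, -2)]

/-- The diagram of type `E₆`. -/
def diagramE6 : List (ℕ × ℤ × ℤ) :=
  [(0, -1, -1), (1, -1, -1), (2, -1, -1), (3, -1, -1), (2, -1, -1)]

theorem mem_diagrams_six :
    ∀ D ∈ diagrams 6, D = diagramB6 ∨ D = diagramC6 ∨ D = diagramE6 ∨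
      ∃ S ∈ posRoots 6, IsReflClosed D 6 (withNeg S) ∧ (withNeg S).length < 72 := by
  decide +kernel

theorem isReflClosed_E6 : IsReflClosed diagramE6 6 (withNeg posRootsE6) := by
  decide +kernel

end DynkinDiagram

namespace RootPairing.Base

open DynkinDiagram

variable {ι R M N : Type*} [Field R] [CharZero R] [AddCommGroup M] [Module R M] [AddCommGroup N]
  [Module R N] {P : RootPairing ι R M N} [P.IsCrystallographic] [Finite ι] [P.IsReduced]
  (b : P.Base)

theorem exists_eq_of_isReflClosed {k : ℕ} (f : Fin k ≃ b.support) {D : List (ℕ × ℤ × ℤ)}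
    (hf : ∀ i j, b.cartanMatrix (f i) (f j) = entry D i j) {S : List (List ℤ)}
    (hS : IsReflClosed D k S) (i : ι) :
    ∃ l ∈ S, P.root i = ∑ p : Fin k, l.getD p 0 • P.root (f p) := by
  classical
  obtain ⟨hlen, hunit, hrefl, hneg⟩ := hS
  have key : ∃ l ∈ S, P.root i = b.simpleSum (fun s ↦ l.getD (f.symm s : ℕ) 0) := by
    refine b.induction_reflect i
      (p := fun i ↦ ∃ l ∈ S, P.root i = b.simpleSum (fun s ↦ l.getD (f.symm s : ℕ) 0)) ?_ ?_ ?_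
    · rintro i ⟨l, hl, hi⟩
      refine ⟨_, hneg l hl, ?_⟩
      rw [root_reflectionPerm, reflection_apply_self, hi]
      simp only [simpleSum, ← Finset.sum_neg_distrib, ← neg_smul]
      refine Finset.sum_congr rfl fun s _ ↦ ?_
      congr 1
      have := hlen l hl
      simp [List.getD_eq_getElem?_getD, this]
    · intro i hi
      refine ⟨_, hunit (f.symm ⟨i, hi⟩), ?_⟩
      have (s : b.support) : ((List.range k).map (fun j : ℕ ↦
          if j = (f.symm ⟨i, hi⟩ : ℕ) then (1 : ℤ) else 0)).getD (f.symm s : ℕ) 0 =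
            if s = ⟨i, hi⟩ then 1 else 0 := by
        simp [List.getD_eq_getElem?_getD, Fin.val_inj]
      simp only [simpleSum, this, ite_smul, one_smul, zero_smul, Finset.sum_ite_eq',
        Finset.mem_univ, if_true]
    · rintro i j ⟨l, hl, hi⟩ hj
      refine ⟨_, hrefl l hl (f.symm ⟨j, hj⟩), ?_⟩
      rw [b.root_reflectionPerm_eq i hi ⟨j, hj⟩]
      congr 1
      funext s
      have h1 : ∑ q : b.support, l.getD (f.symm q : ℕ) 0 * b.cartanMatrix q ⟨j, hj⟩ =
          ∑ p : Fin k, l.getD p 0 * entry D p (f.symm ⟨j, hj⟩) := by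
        rw [← f.sum_comp]
        refine Finset.sum_congr rfl fun p _ ↦ ?_
        rw [← hf, f.symm_apply_apply, f.apply_symm_apply]
      rw [h1]
      by_cases hs : s = ⟨j, hj⟩
      · subst hs
        rw [Function.update_self]
        have := hlen l hl
        simp [List.getD_eq_getElem?_getD, this]
      · rw [Function.update_of_ne hs]
        have : (f.symm ⟨j, hj⟩ : ℕ) ≠ (f.symm s : ℕ) := fun h ↦
          hs (f.symm.injective (Fin.ext h)).symm
        simp [List.getD_eq_getElem?_getD, this]
  obtain ⟨l, hl, hi⟩ := key
  refine ⟨l, hl, hi.trans ?_⟩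
  rw [simpleSum, ← f.sum_comp]
  simp

theorem card_le_of_isReflClosed {k : ℕ} (f : Fin k ≃ b.support) {D : List (ℕ × ℤ × ℤ)}
    (hf : ∀ i j, b.cartanMatrix (f i) (f j) = entry D i j) {S : List (List ℤ)}
    (hS : IsReflClosed D k S) : Nat.card ι ≤ S.length := by
  classical
  have := Fintype.ofFinite ι
  choose g hg hi using b.exists_eq_of_isReflClosed f hf hS
  have hinj : Function.Injective g := fun i j h ↦ P.root.injective (by rw [hi, hi j, h])
  rw [Nat.card_eq_fintype_card, ← Finset.card_univ]
  refine (Finset.card_le_card_of_injOn g (t := S.toFinset) ?_ hinj.injOn).trans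
    (List.toFinset_card_le S)
  intro i _
  simpa using hg i

theorem exists_equiv_of_card_add_card [P.IsRootSystem] [P.IsIrreducible]
    (h : Nat.card ι + b.support.card = 78) :
    ∃ f : Fin 6 ≃ b.support, ∃ D : List (ℕ × ℤ × ℤ),
      (D = diagramB6 ∨ D = diagramC6 ∨ D = diagramE6) ∧
      ∀ i j, b.cartanMatrix (f i) (f j) = entry D i j := by
  have h1 := b.card_support_mul_le
  have h2 := even_card P
  have h3 : b.support.card ≤ 7 := by nlinarith
  have h0 : 0 < b.support.card := by
    rw [Finset.card_pos]
    by_contra h0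
    rw [Finset.not_nonempty_iff_eq_empty] at h0
    have : Nonempty ι := (Nat.card_pos_iff.mp (by omega)).1
    obtain ⟨i⟩ := this
    obtain ⟨v, hv⟩ := b.exists_eq_simpleSum i
    have : IsEmpty b.support := Finset.isEmpty_coe_sort.mpr h0
    exact P.ne_zero i (by simp [hv, simpleSum])
  have hcard : Fintype.card b.support = b.support.card := Fintype.card_coe _
  have hreal := b.isFiniteType_cartanMatrix.exists_realizes b.isConn_cartanMatrix
    (by omega) (by
      rw [hcard]
      by_contra h6
      obtain h7 : b.support.card = 7 := by omega
      rw [show Nat.card ι = 71 by omega] at h2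
      revert h2
      decide)
  rw [hcard] at hreal
  obtain ⟨n, hn⟩ : ∃ n, b.support.card = n := ⟨_, rfl⟩
  rw [hn] at hreal h h0 h3
  obtain ⟨D, hD, g, hg⟩ := hreal
  let f : Fin n ≃ b.support := Equiv.ofBijective g
    ((Fintype.bijective_iff_injective_and_card g).mpr ⟨hg.inj, by rw [hcard, Fintype.card_fin, hn]⟩)
  have hf : ∀ i j, b.cartanMatrix (f i) (f j) = entry D i j := hg.eq_entry
  have hle (S : List (List ℤ)) (hS : IsReflClosed D n S) : Nat.card ι ≤ S.length :=
    b.card_le_of_isReflClosed f hf hS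
  have h2' : Even n := by
    have : Even (Nat.card ι + n) := by rw [h]; decide
    exact (Nat.even_add.mp this).mp h2
  have : n = 2 ∨ n = 4 ∨ n = 6 := by
    obtain ⟨m, rfl⟩ := h2'
    omega
  rcases this with rfl | rfl | rfl
  · obtain ⟨S, -, hS, hS'⟩ := exists_isReflClosed_two D hD
    have := hle _ hS
    omega
  · obtain ⟨S, -, hS, hS'⟩ := exists_isReflClosed_four D hD
    have := hle _ hS
    omega
  · rcases mem_diagrams_six D hD with hD | hD | hD | ⟨S, -, hS, hS'⟩
    · exact ⟨f, D, Or.inl hD, hf⟩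
    · exact ⟨f, D, Or.inr (Or.inl hD), hf⟩
    · exact ⟨f, D, Or.inr (Or.inr hD), hf⟩
    · have := hle _ hS
      omega

end RootPairing.Base

namespace LieAlgebra

open Matrix

attribute [local instance] LieRing.ofAssociativeRing

section

variable {R F n ι : Type*} [CommRing R] [Field F] [Fintype n] [DecidableEq n]

/-- The matrix with the listed entries. -/
def sparse (l : List (n × n × ℤ)) : Matrix n n ℤ :=
  Matrix.of fun p q ↦ (l.map fun t ↦ if p = t.1 ∧ q = t.2.1 then t.2.2 else 0).sum

/-- The product of sparse matrices. -/
def sparseMul (l l' : List (n × n × ℤ)) : List (n × n × ℤ) :=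
  l.flatMap fun t ↦ (l'.filter fun s ↦ s.1 = t.2.1).map fun s ↦ (t.1, s.2.1, t.2.2 * s.2.2)

omit [Fintype n] in
theorem sparse_cons (t : n × n × ℤ) (l : List (n × n × ℤ)) :
    sparse (t :: l) = Matrix.single t.1 t.2.1 t.2.2 + sparse l := by
  ext p q
  simp [sparse, Matrix.single_apply, eq_comm]

omit [Fintype n] in
theorem sparse_nil : sparse ([] : List (n × n × ℤ)) = 0 := by
  ext p q
  simp [sparse]

omit [Fintype n] in
theorem sparse_append (l l' : List (n × n × ℤ)) : sparse (l ++ l') = sparse l + sparse l' := by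
  ext p q
  simp [sparse]

omit [Fintype n] in
theorem sparse_sub_eq_smul {l l' k : List (n × n × ℤ)} {c : ℤ}
    (h : ∀ t ∈ l ++ l' ++ k,
      sparse l t.1 t.2.1 - sparse l' t.1 t.2.1 = c * sparse k t.1 t.2.1) :
    sparse l - sparse l' = c • sparse k := by
  have h0 {p q} {l : List (n × n × ℤ)} (hl : ∀ t ∈ l, ¬(p = t.1 ∧ q = t.2.1)) :
      sparse l p q = 0 := by
    refine List.sum_eq_zero fun z hz ↦ ?_
    obtain ⟨t, ht, rfl⟩ := List.mem_map.mp hz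
    exact if_neg (hl t ht)
  ext p q
  by_cases hpq : ∃ t ∈ l ++ l' ++ k, p = t.1 ∧ q = t.2.1
  · obtain ⟨t, ht, rfl, rfl⟩ := hpq
    exact h t ht
  · push Not at hpq
    have h1 (t) (ht : t ∈ l ++ l' ++ k) : ¬(p = t.1 ∧ q = t.2.1) := fun h ↦ hpq t ht h.1 h.2
    rw [Matrix.sub_apply, Matrix.smul_apply, h0 fun t ht ↦ h1 t (by simp [ht]),
      h0 fun t ht ↦ h1 t (by simp [ht]), h0 fun t ht ↦ h1 t (by simp [ht]), sub_zero, smul_zero]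

omit [Fintype n] in
theorem sparse_eq_sparse {l l' : List (n × n × ℤ)}
    (h : ∀ t ∈ l ++ l', sparse l t.1 t.2.1 = sparse l' t.1 t.2.1) : sparse l = sparse l' := by
  have := sparse_sub_eq_smul (l := l) (l' := l') (k := []) (c := 0) fun t ht ↦ by
    rw [zero_mul, sub_eq_zero]
    exact h t (by simpa using ht)
  rwa [zero_smul, sub_eq_zero] at this

omit [Fintype n] in
theorem sparse_eq_neg_sparse {l l' : List (n × n × ℤ)}
    (h : ∀ t ∈ l ++ l', sparse l t.1 t.2.1 = -sparse l' t.1 t.2.1) : sparse l = -sparse l' := by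
  have := sparse_sub_eq_smul (l := l) (l' := []) (k := l') (c := -1) fun t ht ↦ by
    rw [sparse_nil, Matrix.zero_apply, sub_zero, neg_one_mul]
    exact h t (by simpa using ht)
  rwa [sparse_nil, sub_zero, neg_one_smul] at this

omit [Fintype n] in
theorem transpose_sparse (l : List (n × n × ℤ)) :
    (sparse l)ᵀ = sparse (l.map fun t ↦ (t.2.1, t.1, t.2.2)) := by
  ext p q
  simp [sparse, Function.comp_def, and_comm]

theorem sparse_mul_sparse (l l' : List (n × n × ℤ)) :
    sparse l * sparse l' = sparse (sparseMul l l') := by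
  induction l with
  | nil => simp [sparse_nil, sparseMul]
  | cons t l ih =>
    rw [sparse_cons, add_mul, ih, sparseMul, sparseMul, List.flatMap_cons, sparse_append]
    congr 1
    clear ih
    induction l' with
    | nil => simp [sparse_nil]
    | cons s l' ih =>
      rw [sparse_cons, mul_add, ih, List.filter_cons]
      by_cases h : s.1 = t.2.1
      · simp [h, sparse_cons]
      · simp [h, Ne.symm h]

/-- Sparse integral matrices which are skew-adjoint for `J` and satisfy the Chevalley relations for
the Cartan matrix `A`. -/
structure MatrixChevalleyRel (J : List (n × n × ℤ)) (A : Matrix ι ι ℤ)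
    (h e f : ι → List (n × n × ℤ)) : Prop where
  skew_h : ∀ i, sparse (sparseMul ((h i).map fun t ↦ (t.2.1, t.1, t.2.2)) J) =
    -sparse (sparseMul J (h i))
  skew_e : ∀ i, sparse (sparseMul ((e i).map fun t ↦ (t.2.1, t.1, t.2.2)) J) =
    -sparse (sparseMul J (e i))
  skew_f : ∀ i, sparse (sparseMul ((f i).map fun t ↦ (t.2.1, t.1, t.2.2)) J) =
    -sparse (sparseMul J (f i))
  lie_h_h : ∀ i j, sparse (sparseMul (h i) (h j)) = sparse (sparseMul (h j) (h i))
  lie_h_e : ∀ i j, sparse (sparseMul (h j) (e i)) - sparse (sparseMul (e i) (h j)) =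
    A i j • sparse (e i)
  lie_h_f : ∀ i j, sparse (sparseMul (h j) (f i)) - sparse (sparseMul (f i) (h j)) =
    -A i j • sparse (f i)
  lie_e_f : ∀ i, sparse (sparseMul (e i) (f i)) - sparse (sparseMul (f i) (e i)) =
    (1 : ℤ) • sparse (h i)
  lie_e_f_ne : ∀ i j, i ≠ j → sparse (sparseMul (e i) (f j)) = sparse (sparseMul (f j) (e i))
  e_ne_zero : ∀ i, sparse (e i) ≠ 0

theorem linearIndependent_of_lie_eq [CharZero F] [Fintype ι] [DecidableEq ι] {L : Type*} [LieRing L]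
    [LieAlgebra F L] {A : Matrix ι ι ℤ} (hA : A.det ≠ 0) {h e : ι → L}
    (hhe : ∀ i j, ⁅h j, e i⁆ = A i j • e i) (he0 : ∀ i, e i ≠ 0) : LinearIndependent F h := by
  rw [Fintype.linearIndependent_iff]
  intro g hg
  have h1 (i) : ∑ j, g j * A i j = 0 := by
    have h2 : ⁅∑ j, g j • h j, e i⁆ = 0 := by rw [hg, zero_lie]
    rw [sum_lie] at h2
    simp only [smul_lie, hhe] at h2
    simp only [← Int.cast_smul_eq_zsmul F, smul_smul, ← Finset.sum_smul] at h2
    exact (smul_eq_zero.mp h2).resolve_right (he0 i)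
  have h3 : (A.map (Int.cast : ℤ → F)) *ᵥ g = 0 := by
    ext i
    simp [mulVec, dotProduct, mul_comm, ← h1 i]
  have h4 : (A.map (Int.cast : ℤ → F)).det ≠ 0 := by
    have := (Int.castRingHom F).map_det A
    rw [RingHom.mapMatrix_apply] at this
    change _ = (A.map (Int.cast : ℤ → F)).det at this
    rw [← this]
    simpa using hA
  exact congr_fun (Matrix.eq_zero_of_mulVec_eq_zero h4 h3)

variable (F) in
theorem MatrixChevalleyRel.exists_chevalleyRel [CharZero F] [Fintype ι] [DecidableEq ι]
    {J : List (n × n × ℤ)} {A : Matrix ι ι ℤ} {h e f : ι → List (n × n × ℤ)}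
    (c : MatrixChevalleyRel J A h e f) (hA : A.det ≠ 0) :
    ∃ h' e' f' : ι → skewAdjointMatricesLieSubalgebra ((sparse J).map (Int.castRingHom F)),
      ChevalleyRel F A h' e' f' := by
  set φ := Int.castRingHom F with hφ
  have hmem {X : List (n × n × ℤ)} (hX : sparse (sparseMul (X.map fun t ↦ (t.2.1, t.1, t.2.2)) J) =
      -sparse (sparseMul J X)) :
      (sparse X).map φ ∈ skewAdjointMatricesLieSubalgebra ((sparse J).map φ) := by
    rw [mem_skewAdjointMatricesLieSubalgebra, mem_skewAdjointMatricesSubmodule,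
      Matrix.IsSkewAdjoint, Matrix.IsAdjointPair, Matrix.mul_neg, ← Matrix.transpose_map,
      ← Matrix.map_mul, transpose_sparse, sparse_mul_sparse, hX, ← Matrix.map_mul,
      sparse_mul_sparse]
    ext; simp
  let h' (i : ι) : skewAdjointMatricesLieSubalgebra ((sparse J).map φ) := ⟨_, hmem (c.skew_h i)⟩
  let e' (i : ι) : skewAdjointMatricesLieSubalgebra ((sparse J).map φ) := ⟨_, hmem (c.skew_e i)⟩
  let f' (i : ι) : skewAdjointMatricesLieSubalgebra ((sparse J).map φ) := ⟨_, hmem (c.skew_f i)⟩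
  have hmap {X Y : List (n × n × ℤ)} {Z : Matrix n n ℤ}
      (hXY : sparse (sparseMul X Y) - sparse (sparseMul Y X) = Z) :
      (sparse X).map φ * (sparse Y).map φ - (sparse Y).map φ * (sparse X).map φ = Z.map φ := by
    rw [← Matrix.map_mul, ← Matrix.map_mul, sparse_mul_sparse, sparse_mul_sparse, ← hXY]
    ext p q
    simp
  have hsmul (r : ℤ) (Z : Matrix n n ℤ) : (r • Z).map φ = r • Z.map φ := by
    ext p q
    exact map_zsmul φ r (Z p q)
  have hhe (i j) : ⁅h' j, e' i⁆ = A i j • e' i :=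
    Subtype.ext ((hmap (c.lie_h_e i j)).trans (hsmul _ _))
  have he0 (i) : e' i ≠ 0 := by
    intro h0
    refine c.e_ne_zero i ?_
    ext p q
    have := congr_fun₂ (congr_arg Subtype.val h0) p q
    simpa [e', hφ] using this
  refine ⟨h', e', f', ?_, ?_, hhe, ?_, ?_, ?_⟩
  · exact linearIndependent_of_lie_eq hA hhe he0
  · intro i j
    exact Subtype.ext ((hmap (sub_eq_zero.mpr (c.lie_h_h i j))).trans (by ext; simp))
  · intro i j
    exact Subtype.ext ((hmap (c.lie_h_f i j)).trans (hsmul _ _))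
  · intro i
    exact Subtype.ext (hmap ((c.lie_e_f i).trans (one_smul _ _)))
  · intro i j hij
    exact Subtype.ext ((hmap (sub_eq_zero.mpr (c.lie_e_f_ne i j hij))).trans (by ext; simp))

end

/-- The Cartan matrix encoded by `D`. -/
abbrev cartan (D : List (ℕ × ℤ × ℤ)) : Matrix (Fin 6) (Fin 6) ℤ :=
  Matrix.of fun i j ↦ DynkinDiagram.entry D i j

/-- The index of the isotropic vector opposite to the `i`-th one. -/
def opp (i : Fin 6) : Fin 13 := i.natAdd 6 |>.castLE (by norm_num)

/-- The symmetric form on `ℤ¹³`. -/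
def soForm : List (Fin 13 × Fin 13 × ℤ) :=
  [(12, 12, 1)] ++ (List.finRange 6).map (fun i ↦ (i.castLE (by norm_num), opp i, 2)) ++
    (List.finRange 6).map (fun i ↦ (opp i, i.castLE (by norm_num), 2))

def soH (i : Fin 6) : List (Fin 13 × Fin 13 × ℤ) :=
  if i = 5 then [(5, 5, 2), (11, 11, -2)] else
    [(i.castLE (by norm_num), i.castLE (by norm_num), 1), (opp i, opp i, -1),
      ((i + 1).castLE (by norm_num), (i + 1).castLE (by norm_num), -1),
      (opp (i + 1), opp (i + 1), 1)]

def soE (i : Fin 6) : List (Fin 13 × Fin 13 × ℤ) :=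
  if i = 5 then [(5, 12, 1), (12, 11, -2)] else
    [(i.castLE (by norm_num), (i + 1).castLE (by norm_num), 1), (opp (i + 1), opp i, -1)]

def soF (i : Fin 6) : List (Fin 13 × Fin 13 × ℤ) :=
  if i = 5 then [(11, 12, -1), (12, 5, 2)] else
    [((i + 1).castLE (by norm_num), i.castLE (by norm_num), 1), (opp i, opp (i + 1), -1)]

theorem matrixChevalleyRel_so :
    MatrixChevalleyRel soForm (cartan DynkinDiagram.diagramB6) soH soE soF where
  skew_h i := sparse_eq_neg_sparse (by revert i; decide +kernel)
  skew_e i := sparse_eq_neg_sparse (by revert i; decide +kernel)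
  skew_f i := sparse_eq_neg_sparse (by revert i; decide +kernel)
  lie_h_h i j := sparse_eq_sparse (by revert i j; decide +kernel)
  lie_h_e i j := sparse_sub_eq_smul (by revert i j; decide +kernel)
  lie_h_f i j := sparse_sub_eq_smul (by revert i j; decide +kernel)
  lie_e_f i := sparse_sub_eq_smul (by revert i; decide +kernel)
  lie_e_f_ne i j hij := sparse_eq_sparse (by revert i j; decide +kernel)
  e_ne_zero := by decide +kernel

def spForm : List ((Fin 6 ⊕ Fin 6) × (Fin 6 ⊕ Fin 6) × ℤ) :=
  (List.finRange 6).map (fun i ↦ (.inl i, .inr i, -1)) ++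
    (List.finRange 6).map (fun i ↦ (.inr i, .inl i, 1))

def spH (i : Fin 6) : List ((Fin 6 ⊕ Fin 6) × (Fin 6 ⊕ Fin 6) × ℤ) :=
  if i = 5 then [(.inl 5, .inl 5, 1), (.inr 5, .inr 5, -1)] else
    [(.inl i, .inl i, 1), (.inr i, .inr i, -1), (.inl (i + 1), .inl (i + 1), -1),
      (.inr (i + 1), .inr (i + 1), 1)]

def spE (i : Fin 6) : List ((Fin 6 ⊕ Fin 6) × (Fin 6 ⊕ Fin 6) × ℤ) :=
  if i = 5 then [(.inl 5, .inr 5, 1)] else [(.inl i, .inl (i + 1), 1), (.inr (i + 1), .inr i, -1)]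

def spF (i : Fin 6) : List ((Fin 6 ⊕ Fin 6) × (Fin 6 ⊕ Fin 6) × ℤ) :=
  if i = 5 then [(.inr 5, .inl 5, 1)] else [(.inl (i + 1), .inl i, 1), (.inr i, .inr (i + 1), -1)]

theorem matrixChevalleyRel_sp :
    MatrixChevalleyRel spForm (cartan DynkinDiagram.diagramC6) spH spE spF where
  skew_h i := sparse_eq_neg_sparse (by revert i; decide +kernel)
  skew_e i := sparse_eq_neg_sparse (by revert i; decide +kernel)
  skew_f i := sparse_eq_neg_sparse (by revert i; decide +kernel)
  lie_h_h i j := sparse_eq_sparse (by revert i j; decide +kernel)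
  lie_h_e i j := sparse_sub_eq_smul (by revert i j; decide +kernel)
  lie_h_f i j := sparse_sub_eq_smul (by revert i j; decide +kernel)
  lie_e_f i := sparse_sub_eq_smul (by revert i; decide +kernel)
  lie_e_f_ne i j hij := sparse_eq_sparse (by revert i j; decide +kernel)
  e_ne_zero := by decide +kernel

section Bounds

variable {F : Type*} [Field F]

theorem finrank_le_card_entries {n V : Type*} [AddCommGroup V] [Module F V]
    (T : V →ₗ[F] Matrix n n F) (P : Finset (n × n))
    (hT : ∀ v, (∀ t ∈ P, T v t.1 t.2 = 0) → v = 0) :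
    finrank F V ≤ P.card := by
  let S : V →ₗ[F] (P → F) :=
    LinearMap.pi fun t ↦ (LinearMap.proj t.1.2).comp ((LinearMap.proj t.1.1).comp
      ((Matrix.ofLinearEquiv F).symm.toLinearMap.comp T))
  have hS : Function.Injective S := by
    rw [← LinearMap.ker_eq_bot, LinearMap.ker_eq_bot']
    exact fun v hv ↦ hT v fun t ht ↦ congr_fun hv ⟨t, ht⟩
  simpa using LinearMap.finrank_le_finrank_of_injective hS

theorem finrank_so_le [CharZero F] : finrank F (Orthogonal.so (Fin 13) F) ≤ 78 := by
  have h := finrank_le_card_entries (Orthogonal.so (Fin 13) F).toSubmodule.subtype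
    (Finset.univ.filter fun t : Fin 13 × Fin 13 ↦ t.1 < t.2) (by
      rintro ⟨A, hA⟩ h
      rw [LieSubalgebra.mem_toSubmodule, Orthogonal.mem_so] at hA
      have hs (p q) : A q p = -A p q := congr_fun₂ hA p q
      have key (p q) (hpq : p < q) : A p q = 0 := h (p, q) (by simpa using hpq)
      ext p q
      change A p q = 0
      rcases lt_trichotomy p q with hpq | rfl | hpq
      · exact key p q hpq
      · exact self_eq_neg.mp (hs p p)
      · rw [hs, key q p hpq, neg_zero])
  exact h.trans_eq (by decide +kernel)

theorem finrank_sp_le : finrank F (Symplectic.sp (Fin 6) F) ≤ 78 := by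
  have h := finrank_le_card_entries
    ((LinearMap.mulLeft F (Matrix.J (Fin 6) F)).comp
      (Symplectic.sp (Fin 6) F).toSubmodule.subtype)
    (Finset.univ.filter fun t : (Fin 6 ⊕ Fin 6) × (Fin 6 ⊕ Fin 6) ↦
      Sum.elim (fun i : Fin 6 ↦ (i : ℕ)) (fun i : Fin 6 ↦ (i : ℕ) + 6) t.1 ≤
        Sum.elim (fun i : Fin 6 ↦ (i : ℕ)) (fun i : Fin 6 ↦ (i : ℕ) + 6) t.2) (by
      rintro ⟨A, hA⟩ h
      rw [LieSubalgebra.mem_toSubmodule, Symplectic.sp, mem_skewAdjointMatricesLieSubalgebra,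
        mem_skewAdjointMatricesSubmodule, Matrix.IsSkewAdjoint, Matrix.IsAdjointPair] at hA
      have hs : (Matrix.J (Fin 6) F * A)ᵀ = Matrix.J (Fin 6) F * A := by
        rw [Matrix.transpose_mul, Matrix.J_transpose, Matrix.mul_neg, hA, Matrix.mul_neg, neg_neg]
      have hs' (p q) : (Matrix.J (Fin 6) F * A) q p = (Matrix.J (Fin 6) F * A) p q :=
        congr_fun₂ hs p q
      have h0 : Matrix.J (Fin 6) F * A = 0 := by
        ext p q
        change _ = (0 : F)
        rcases le_total (Sum.elim (fun i : Fin 6 ↦ (i : ℕ)) (fun i : Fin 6 ↦ (i : ℕ) + 6) p)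
          (Sum.elim (fun i : Fin 6 ↦ (i : ℕ)) (fun i : Fin 6 ↦ (i : ℕ) + 6) q) with hpq | hpq
        · exact h (p, q) (by simpa using hpq)
        · rw [← hs']
          exact h (q, p) (by simpa using hpq)
      have := congr_arg (Matrix.J (Fin 6) F * ·) h0
      simp only [← Matrix.mul_assoc, Matrix.J_squared, Matrix.mul_zero, neg_mul, one_mul,
        neg_eq_zero] at this
      exact Subtype.ext this)
  exact h.trans_eq (by decide +kernel)

end Bounds

theorem det_ne_zero_of_mul_eq {n : Type*} [Fintype n] [DecidableEq n] {A B : Matrix n n ℤ} {k : ℤ}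
    (hk : k ≠ 0) (h : B * A = k • 1) : A.det ≠ 0 := by
  intro h0
  have := congr_arg Matrix.det h
  rw [Matrix.det_mul, h0, mul_zero, Matrix.det_smul, Matrix.det_one, mul_one] at this
  exact pow_ne_zero _ hk this.symm

theorem cartan_B6_det : (cartan DynkinDiagram.diagramB6).det ≠ 0 :=
  det_ne_zero_of_mul_eq (k := 2) (by decide)
    (B := !![2, 2, 2, 2, 2, 2; 2, 4, 4, 4, 4, 4; 2, 4, 6, 6, 6, 6; 2, 4, 6, 8, 8, 8;
      2, 4, 6, 8, 10, 10; 1, 2, 3, 4, 5, 6])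
    (by decide +kernel)

theorem cartan_C6_det : (cartan DynkinDiagram.diagramC6).det ≠ 0 :=
  det_ne_zero_of_mul_eq (k := 2) (by decide)
    (B := !![2, 2, 2, 2, 2, 1; 2, 4, 4, 4, 4, 2; 2, 4, 6, 6, 6, 3; 2, 4, 6, 8, 8, 4;
      2, 4, 6, 8, 10, 5; 2, 4, 6, 8, 10, 6])
    (by decide +kernel)

theorem cartan_E6_det : (cartan DynkinDiagram.diagramE6).det ≠ 0 :=
  det_ne_zero_of_mul_eq (k := 3) (by decide)
    (B := !![4, 5, 6, 4, 2, 3; 5, 10, 12, 8, 4, 6; 6, 12, 18, 12, 6, 9; 4, 8, 12, 10, 5, 6;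
      2, 4, 6, 5, 4, 3; 3, 6, 9, 6, 3, 6])
    (by decide +kernel)

section

variable (F : Type*) [Field F] [CharZero F]

theorem sparse_spForm : (sparse spForm).map (Int.castRingHom F) = Matrix.J (Fin 6) F := by
  have : sparse spForm = Matrix.J (Fin 6) ℤ := by decide +kernel
  rw [this]
  ext (p | p) (q | q) <;> simp [Matrix.J, Matrix.one_apply, apply_ite]

/-- The columns are the isotropic vectors, with respect to which the standard symmetric form
becomes `soForm`. -/
def isotropicBasis : Matrix (Fin 13) (Fin 13) GaussianInt :=
  Matrix.of fun p k ↦ if k = 12 then if p = 12 then 1 else 0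
    else if (k : ℕ) < 6 then
      if (p : ℕ) = 2 * k then 1 else if (p : ℕ) = 2 * k + 1 then ⟨0, 1⟩ else 0
    else if (p : ℕ) + 12 = 2 * k then 1 else if (p : ℕ) + 11 = 2 * k then ⟨0, -1⟩ else 0

theorem isotropicBasis_transform : isotropicBasisᵀ * isotropicBasis =
    (sparse soForm).map (Int.castRingHom GaussianInt) := by
  decide +kernel

theorem nonempty_equiv_so [IsAlgClosed F] :
    Nonempty (skewAdjointMatricesLieSubalgebra ((sparse soForm).map (Int.castRingHom F)) ≃ₗ⁅F⁆
      Orthogonal.so (Fin 13) F) := by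
  obtain ⟨i, hi⟩ := IsAlgClosed.exists_pow_nat_eq (-1 : F) two_pos
  let φ : GaussianInt →+* F := Zsqrtd.lift ⟨i, by rw [← sq, hi]; simp⟩
  let B := isotropicBasis.map φ
  have hB : Bᵀ * B = (sparse soForm).map (Int.castRingHom F) := by
    rw [← Matrix.transpose_map, ← Matrix.map_mul, isotropicBasis_transform]
    ext p q
    simp
  let J' : Matrix (Fin 13) (Fin 13) ℤ := Matrix.diagonal fun p ↦ if p = 12 then 4 else 1
  have hinv : ((4⁻¹ : F) • (J'.map (Int.castRingHom F) * (sparse soForm).map (Int.castRingHom F) *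
      Bᵀ)) * B = 1 := by
    rw [Matrix.smul_mul, Matrix.mul_assoc, hB, Matrix.mul_assoc, ← Matrix.map_mul, ← Matrix.map_mul]
    have h5 : J' * (sparse soForm * sparse soForm) = (4 : ℤ) • 1 := by decide +kernel
    rw [h5, inv_smul_eq_iff₀ (by norm_num)]
    ext p q
    change ((((4 : ℤ) • (1 : Matrix (Fin 13) (Fin 13) ℤ) p q : ℤ)) : F) =
      4 * (1 : Matrix (Fin 13) (Fin 13) F) p q
    simp [Matrix.one_apply]
  let e := skewAdjointMatricesLieSubalgebraEquiv (1 : Matrix (Fin 13) (Fin 13) F) B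
    (invertibleOfLeftInverse _ _ hinv)
  rw [Matrix.mul_one, hB] at e
  exact ⟨e.symm⟩

variable {F} {L : Type*} [LieRing L] [LieAlgebra F L] [FiniteDimensional F L] [IsSimple F L]
  {h e f : Fin 6 → L}

theorem ChevalleyRel.nonempty_equiv_so [IsAlgClosed F] (hdim : finrank F L = 78)
    (c : ChevalleyRel F (cartan DynkinDiagram.diagramB6) h e f)
    (hgen : LieSubalgebra.lieSpan F L (Set.range e ∪ Set.range f) = ⊤) :
    Nonempty (L ≃ₗ⁅F⁆ Orthogonal.so (Fin 13) F) := by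
  obtain ⟨h', e', f', c'⟩ :=
    matrixChevalleyRel_so.exists_chevalleyRel F cartan_B6_det
  obtain ⟨ψ⟩ := LieAlgebra.nonempty_equiv_so F
  obtain ⟨φ, -⟩ := c.exists_lieEquiv
    (Matrix.nondegenerate_iff_det_ne_zero.mpr cartan_B6_det)
    (by decide) hgen c' (by
      rw [hdim, ψ.toLinearEquiv.finrank_eq]
      exact finrank_so_le)
  exact ⟨φ.trans ψ⟩

theorem ChevalleyRel.nonempty_equiv_sp (hdim : finrank F L = 78)
    (c : ChevalleyRel F (cartan DynkinDiagram.diagramC6) h e f)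
    (hgen : LieSubalgebra.lieSpan F L (Set.range e ∪ Set.range f) = ⊤) :
    Nonempty (L ≃ₗ⁅F⁆ Symplectic.sp (Fin 6) F) := by
  obtain ⟨h', e', f', c'⟩ :=
    matrixChevalleyRel_sp.exists_chevalleyRel F cartan_C6_det
  have hsp : skewAdjointMatricesLieSubalgebra ((sparse spForm).map (Int.castRingHom F)) =
      Symplectic.sp (Fin 6) F := by
    rw [sparse_spForm]
    rfl
  obtain ⟨φ, -⟩ := c.exists_lieEquiv
    (Matrix.nondegenerate_iff_det_ne_zero.mpr cartan_C6_det)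
    (by decide) hgen c' (by
      rw [hdim, (LieEquiv.ofEq _ _ (congr_arg _ hsp)).toLinearEquiv.finrank_eq]
      exact finrank_sp_le)
  exact ⟨φ.trans (LieEquiv.ofEq _ _ (congr_arg _ hsp))⟩

end

end LieAlgebra

namespace LieAlgebra

namespace E6

/-- The form on the root lattice of type `E₆`, in coordinates with respect to the simple roots. -/
def form : (Fin 6 → ℤ) →ₗ[ℤ] (Fin 6 → ℤ) →ₗ[ℤ] ℤ :=
  LinearMap.mk₂ ℤ
    (fun u v ↦ u 0 * (2 * v 0 - v 1) + u 1 * (2 * v 1 - v 0 - v 2) +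
      u 2 * (2 * v 2 - v 1 - v 3 - v 5) + u 3 * (2 * v 3 - v 2 - v 4) + u 4 * (2 * v 4 - v 3) +
      u 5 * (2 * v 5 - v 2))
    (fun u u' v ↦ by simp only [Pi.add_apply]; ring)
    (fun c u v ↦ by simp only [Pi.smul_apply, smul_eq_mul]; ring)
    (fun u v v' ↦ by simp only [Pi.add_apply]; ring)
    (fun c u v ↦ by simp only [Pi.smul_apply, smul_eq_mul]; ring)

/-- The roots of the root system of type `E₆`, in coordinates with respect to the simple roots. -/
def roots : List (Fin 6 → ℤ) :=
  (DynkinDiagram.withNeg DynkinDiagram.posRootsE6).map fun l i ↦ l.getD i 0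

theorem form_comm (u v : Fin 6 → ℤ) : form u v = form v u := by
  simp only [form, LinearMap.mk₂_apply]; ring

theorem form_single (i j : Fin 6) :
    form (Pi.single i 1) (Pi.single j 1) = cartan DynkinDiagram.diagramE6 i j := by
  fin_cases i <;> fin_cases j <;> decide +kernel

theorem form_eq_sum (u v : Fin 6 → ℤ) :
    form u v = ∑ i, u i * form (Pi.single i 1) v := by
  conv_lhs => rw [← Finset.univ_sum_single u]
  simp only [map_sum, LinearMap.sum_apply]
  refine Finset.sum_congr rfl fun i _ ↦ ?_
  rw [← smul_eq_mul, ← LinearMap.smul_apply, ← map_zsmul, ← Pi.single_smul, smul_eq_mul, mul_one]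

theorem form_single_left (j : Fin 6) (v : Fin 6 → ℤ) :
    form (Pi.single j 1) v = ∑ i, v i * cartan DynkinDiagram.diagramE6 i j := by
  rw [form_comm, form_eq_sum]
  exact Finset.sum_congr rfl fun i _ ↦ by rw [form_single]

theorem form_injective : Function.Injective form := by
  refine (injective_iff_map_eq_zero _).mpr fun v hv ↦ ?_
  refine Matrix.eq_zero_of_vecMul_eq_zero cartan_E6_det (funext fun j ↦ ?_)
  have h := LinearMap.congr_fun hv (Pi.single j 1)
  rw [form_comm, form_single_left] at h
  simpa [Matrix.vecMul, dotProduct] using h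

theorem form_self_of_mem_roots : ∀ v ∈ roots, form v v = 2 := by decide +kernel

theorem neg_mem_roots : ∀ v ∈ roots, -v ∈ roots := by decide +kernel

theorem single_mem_roots (i : Fin 6) : Pi.single i 1 ∈ roots := by revert i; decide +kernel

theorem zero_notMem_roots : (0 : Fin 6 → ℤ) ∉ roots := by decide +kernel

end E6

section

variable {F L : Type*} [Field F] [LieRing L] [LieAlgebra F L]

/-- The element of the span of the `h i` with given integral coordinates. -/
def latticeMap {M : Type*} [AddCommGroup M] (h : Fin 6 → M) : (Fin 6 → ℤ) →ₗ[ℤ] M :=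
  Fintype.linearCombination ℤ h

theorem latticeMap_apply {M : Type*} [AddCommGroup M] (h : Fin 6 → M) (v : Fin 6 → ℤ) :
    latticeMap h v = ∑ i, v i • h i := rfl

theorem latticeMap_single {M : Type*} [AddCommGroup M] (h : Fin 6 → M) (i : Fin 6) :
    latticeMap h (Pi.single i 1) = h i := by
  simp [latticeMap, Fintype.linearCombination_apply_single]

variable (F) in
/-- The root space attached to a vector of the root lattice of type `E₆`. -/
def wt (h : Fin 6 → L) (v : Fin 6 → ℤ) : Submodule F L where
  carrier := {x | ∀ u, ⁅latticeMap h u, x⁆ = E6.form u v • x}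
  add_mem' hx hy u := by rw [lie_add, hx, hy, smul_add]
  zero_mem' u := by simp
  smul_mem' c x hx u := by rw [lie_smul, hx, smul_comm]

variable {h e f : Fin 6 → L} {u v : Fin 6 → ℤ} {x y : L}

theorem mem_wt : x ∈ wt F h v ↔ ∀ u, ⁅latticeMap h u, x⁆ = E6.form u v • x := Iff.rfl

theorem mem_wt_iff : x ∈ wt F h v ↔ ∀ j, ⁅h j, x⁆ = E6.form (Pi.single j 1) v • x := by
  refine ⟨fun hx j ↦ by rw [← hx, latticeMap_single], fun hx u ↦ ?_⟩
  rw [E6.form_eq_sum, latticeMap_apply, Finset.sum_smul, sum_lie]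
  exact Finset.sum_congr rfl fun i _ ↦ by rw [mul_smul, ← hx, smul_lie]

theorem lie_mem_wt (hx : x ∈ wt F h u) (hy : y ∈ wt F h v) : ⁅x, y⁆ ∈ wt F h (u + v) := by
  intro z
  rw [leibniz_lie, hx, hy, smul_lie, lie_smul, ← add_smul, map_add]

variable (F) in
/-- Chevalley generators of type `E₆`, together with the properties of the corresponding root space
decomposition. -/
structure E6Frame (h e f : Fin 6 → L) : Prop
    extends ChevalleyRel F (cartan DynkinDiagram.diagramE6) h e f where
  lieSpan_eq_top : LieSubalgebra.lieSpan F L (Set.range e ∪ Set.range f) = ⊤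
  wt_zero : wt F h 0 = Submodule.span F (Set.range h)
  mem_roots : ∀ v, v ≠ 0 → wt F h v ≠ ⊥ → v ∈ E6.roots
  finrank_wt : ∀ v ∈ E6.roots, finrank F (wt F h v) = 1
  exists_lie_eq : ∀ v ∈ E6.roots, ∀ x ∈ wt F h v, x ≠ 0 → ∃ y ∈ wt F h (-v), ⁅x, y⁆ = latticeMap h v
  lie_ne_zero : ∀ u ∈ E6.roots, ∀ v ∈ E6.roots, u + v ∈ E6.roots →
    ∀ x ∈ wt F h u, x ≠ 0 → ∀ y ∈ wt F h v, y ≠ 0 → ⁅x, y⁆ ≠ 0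
  add_mem_roots : ∀ u ∈ E6.roots, ∀ v ∈ E6.roots, E6.form u v = -1 → u + v ∈ E6.roots

end

section

variable {F L : Type*} [Field F] [CharZero F] [LieRing L] [LieAlgebra F L] [FiniteDimensional F L]

variable {h e f : Fin 6 → L}

namespace IsKilling

variable [IsKilling F L] {H : LieSubalgebra F L} [H.IsCartanSubalgebra]
  [LieModule.IsTriangularizable F H L]

variable {ρ : Fin 6 → H.root}
  (hρ : ∀ i j, (rootSystem H).pairing (ρ i) (ρ j) = ((cartan DynkinDiagram.diagramE6 i j : ℤ) : F))
include hρ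

theorem latticeMap_apply_coroot (v : Fin 6 → ℤ) (j : Fin 6) :
    latticeMap (fun i ↦ (rootSystem H).root (ρ i)) v (coroot (ρ j : LieModule.Weight F H L)) =
      ((E6.form (Pi.single j 1) v : ℤ) : F) := by
  rw [E6.form_single_left, latticeMap_apply]
  simp only [LinearMap.sum_apply, LinearMap.smul_apply, Int.cast_sum, Int.cast_mul]
  refine Finset.sum_congr rfl fun i _ ↦ ?_
  rw [← hρ, rootSystem_pairing_apply, rootSystem_root_apply, zsmul_eq_mul]
  rfl

theorem wt_eq_rootSpace
    (hspan : Submodule.span F (Set.range fun i ↦ (coroot (ρ i : LieModule.Weight F H L) : L)) =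
      H.toSubmodule) (v : Fin 6 → ℤ) :
    wt F (fun i ↦ (coroot (ρ i : LieModule.Weight F H L) : L)) v =
      (rootSpace H (latticeMap (fun i ↦ (rootSystem H).root (ρ i)) v)).toSubmodule := by
  ext x
  rw [mem_wt_iff, LieSubmodule.mem_toSubmodule]
  refine ⟨fun hx ↦ LieModule.weightSpace_le_genWeightSpace L _ ?_, fun hx j ↦ ?_⟩
  · rw [LieModule.mem_weightSpace]
    rintro ⟨y, hy⟩
    suffices ∀ y ∈ H.toSubmodule, ∃ hy : y ∈ H,
        ⁅y, x⁆ = latticeMap (fun i ↦ (rootSystem H).root (ρ i)) v ⟨y, hy⟩ • x by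
      exact (this y hy).choose_spec
    intro y hy'
    rw [← hspan] at hy'
    induction hy' using Submodule.span_induction with
    | mem y hy' =>
      obtain ⟨j, rfl⟩ := hy'
      exact ⟨SetLike.coe_mem _, by rw [hx, latticeMap_apply_coroot hρ, Int.cast_smul_eq_zsmul]⟩
    | zero => exact ⟨H.zero_mem, by
        rw [zero_lie, show (⟨0, H.zero_mem⟩ : H) = 0 from rfl, map_zero, zero_smul]⟩
    | add y z _ _ ihy ihz =>
      obtain ⟨hy, h1⟩ := ihy
      obtain ⟨hz, h2⟩ := ihz
      exact ⟨H.add_mem hy hz, by rw [add_lie, h1, h2, ← add_smul, ← map_add]; rfl⟩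
    | smul c y _ ihy =>
      obtain ⟨hy, h1⟩ := ihy
      exact ⟨H.smul_mem c hy, by rw [smul_lie, h1, smul_smul, ← smul_eq_mul, ← map_smul]; rfl⟩
  · have := lie_eq_smul_of_mem_rootSpace hx (coroot (ρ j : LieModule.Weight F H L))
    rw [latticeMap_apply_coroot hρ, Int.cast_smul_eq_zsmul] at this
    exact this

theorem coroot_eq_latticeMap
    (hspan : Submodule.span F (Set.range fun i ↦ (rootSystem H).root (ρ i)) = ⊤)
    {α : H.root} {v : Fin 6 → ℤ} (hv : v ∈ E6.roots)
    (hα : (rootSystem H).root α = latticeMap (fun i ↦ (rootSystem H).root (ρ i)) v) :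
    coroot (α : LieModule.Weight F H L) =
      latticeMap (fun i ↦ coroot (ρ i : LieModule.Weight F H L)) v := by
  set P := rootSystem H
  let B := P.toInvariantForm
  have hsymm (x y) : B.form x y = B.form y x := by
    simpa using B.symm.eq x y
  have h1 (i j) (hij : cartan DynkinDiagram.diagramE6 i j = -1)
      (hji : cartan DynkinDiagram.diagramE6 j i = -1) :
      B.form (P.root (ρ i)) (P.root (ρ i)) = B.form (P.root (ρ j)) (P.root (ρ j)) := by
    have h1 := B.two_mul_apply_root_root (ρ i) (ρ j)
    have h2 := B.two_mul_apply_root_root (ρ j) (ρ i)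
    rw [hρ, hij] at h1
    rw [hρ, hji, hsymm] at h2
    rw [h1] at h2
    simpa using h2.symm
  set c := B.form (P.root (ρ 0)) (P.root (ρ 0)) with hc
  have h2 (i) : B.form (P.root (ρ i)) (P.root (ρ i)) = c := by
    have h01 := h1 0 1 (by decide) (by decide)
    have h12 := h1 1 2 (by decide) (by decide)
    have h23 := h1 2 3 (by decide) (by decide)
    have h34 := h1 3 4 (by decide) (by decide)
    have h25 := h1 2 5 (by decide) (by decide)
    fin_cases i <;> simp_all
  have h3 (i) : 2 * B.form (P.root (ρ i)) (P.root α) = E6.form (Pi.single i 1) v * c := by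
    rw [hα, latticeMap_apply, map_sum, Finset.mul_sum, E6.form_comm, E6.form_eq_sum, Int.cast_sum,
      Finset.sum_mul]
    refine Finset.sum_congr rfl fun j _ ↦ ?_
    rw [map_zsmul, zsmul_eq_mul, mul_left_comm, hsymm, B.two_mul_apply_root_root, hρ, h2,
      E6.form_single, Int.cast_mul, mul_assoc]
  have h4 : B.form (P.root α) (P.root α) = c := by
    have hsum : (∑ i, (v i : F) * (E6.form (Pi.single i 1) v : ℤ)) = 2 := by
      exact_mod_cast (E6.form_eq_sum v v).symm.trans (E6.form_self_of_mem_roots v hv)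
    have : 2 * B.form (P.root α) (P.root α) = 2 * c := by
      conv_lhs => enter [2, 1]; rw [hα]
      rw [latticeMap_apply, map_sum, LinearMap.sum_apply, Finset.mul_sum]
      refine Eq.trans ?_ (congr_arg (· * c) hsum)
      rw [Finset.sum_mul]
      refine Finset.sum_congr rfl fun j _ ↦ ?_
      rw [map_zsmul, LinearMap.smul_apply, zsmul_eq_mul, mul_left_comm, h3, mul_assoc]
    exact mul_left_cancel₀ two_ne_zero this
  have hc0 : c ≠ 0 := B.ne_zero _
  have h5 (i) : P.pairing (ρ i) α = E6.form (Pi.single i 1) v := by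
    have := B.two_mul_apply_root_root (ρ i) α
    rw [h3, h4] at this
    exact (mul_right_cancel₀ hc0 this).symm
  rw [← sub_eq_zero, ← Module.forall_dual_apply_eq_zero_iff F]
  intro χ
  have hχ : χ ∈ Submodule.span F (Set.range fun i ↦ P.root (ρ i)) := hspan ▸ Submodule.mem_top
  induction hχ using Submodule.span_induction with
  | mem χ hχ =>
    obtain ⟨j, rfl⟩ := hχ
    have h6 (β : H.root) : P.root (ρ j) (coroot (β : LieModule.Weight F H L)) =
        P.pairing (ρ j) β := rfl
    rw [latticeMap_apply, map_sub, map_sum, h6, h5, E6.form_single_left, Int.cast_sum, sub_eq_zero]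
    refine Finset.sum_congr rfl fun i _ ↦ ?_
    rw [map_zsmul, h6, hρ, zsmul_eq_mul, Int.cast_mul, ← E6.form_single, E6.form_comm,
      E6.form_single]
  | zero => simp
  | add χ ψ _ _ h1 h2 => rw [LinearMap.add_apply, h1, h2, add_zero]
  | smul a χ _ h1 => rw [LinearMap.smul_apply, h1, smul_zero]

end IsKilling

variable [IsSimple F L] [IsAlgClosed F]

theorem exists_E6Frame (hdim : finrank F L = 78)
    (hso : IsEmpty (L ≃ₗ⁅F⁆ (LieAlgebra.Orthogonal.so (Fin 13) F)))
    (hsp : IsEmpty (L ≃ₗ⁅F⁆ (LieAlgebra.Symplectic.sp (Fin 6) F)))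
    (H : LieSubalgebra F L) [H.IsCartanSubalgebra] :
    ∃ h e f : Fin 6 → L, E6Frame F h e f ∧ Submodule.span F (Set.range h) = H.toSubmodule := by
  let P := IsKilling.rootSystem H
  obtain ⟨b⟩ := P.nonempty_base
  have : Nontrivial L := Module.nontrivial_of_finrank_pos (R := F) (by omega)
  have hcard : Nat.card H.root + b.support.card = 78 := by
    have h1 := IsKilling.finrank_eq_finrank_add_card (K := F) (L := L) (H := H)
    have h2 := Module.finrank_eq_card_basis b.toCoweightBasis
    rw [hdim, h2] at h1
    rw [Nat.card_eq_fintype_card, Fintype.card_coe]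
    rw [Fintype.card_coe] at h1
    omega
  obtain ⟨e, f, he, hf, hc, hgen⟩ := IsKilling.exists_chevalleyRel_base b
  obtain ⟨φ, D, hD, hφ⟩ := b.exists_equiv_of_card_add_card hcard
  have hc' : ChevalleyRel F (cartan D)
      (fun i ↦ (IsKilling.coroot ((φ i).1 : LieModule.Weight F H L) : L)) (fun i ↦ e (φ i))
      (fun i ↦ f (φ i)) :=
    { linInd := hc.linInd.comp φ φ.injective
      lie_h_h i j := hc.lie_h_h _ _
      lie_h_e i j := by rw [hc.lie_h_e, hφ]; rfl
      lie_h_f i j := by rw [hc.lie_h_f, hφ]; rfl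
      lie_e_f i := hc.lie_e_f _
      lie_e_f_ne i j hij := hc.lie_e_f_ne _ _ (φ.injective.ne hij) }
  have hgen' : LieSubalgebra.lieSpan F L
      (Set.range (fun i ↦ e (φ i)) ∪ Set.range (fun i ↦ f (φ i))) = ⊤ := by
    rwa [← Function.comp_def e, ← Function.comp_def f, φ.surjective.range_comp,
      φ.surjective.range_comp]
  obtain rfl : D = DynkinDiagram.diagramE6 := by
    rcases hD with rfl | rfl | rfl
    · exact (hso.false (hc'.nonempty_equiv_so hdim hgen').some).elim
    · exact (hsp.false (hc'.nonempty_equiv_sp hdim hgen').some).elim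
    · rfl
  set ρ : Fin 6 → H.root := fun i ↦ (φ i).1 with hρdef
  have hρ (i j) : P.pairing (ρ i) (ρ j) = ((cartan DynkinDiagram.diagramE6 i j : ℤ) : F) := by
    rw [← b.algebraMap_cartanMatrixIn_apply ℤ (φ i) (φ j)]
    exact congr_arg _ (hφ i j)
  have hspanR : Submodule.span F (Set.range fun i ↦ P.root (ρ i)) = ⊤ := by
    rw [← (b.toWeightBasis.reindex φ.symm).span_eq]
    congr 2
    ext1 i
    simp [hρdef]
  have hspan : Submodule.span F
      (Set.range fun i ↦ (IsKilling.coroot (ρ i : LieModule.Weight F H L) : L)) =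
        H.toSubmodule := by
    have h1 := congr_arg (Submodule.map H.toSubmodule.subtype)
      (b.toCoweightBasis.reindex φ.symm).span_eq
    rw [Submodule.map_span, ← Set.range_comp, Submodule.map_top, Submodule.range_subtype] at h1
    rw [← h1]
    congr 2
    ext1 i
    simp [hρdef, P]
  have hinj : Function.Injective (latticeMap fun i ↦ P.root (ρ i)) := by
    intro u v huv
    have h1 := b.simpleSum_injective (a₁ := u ∘ φ.symm) (a₂ := v ∘ φ.symm) (by
      simp only [RootPairing.Base.simpleSum]
      rw [← φ.sum_comp, ← φ.sum_comp]
      simpa [latticeMap_apply] using huv)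
    exact φ.symm.surjective.injective_comp_right h1
  have hroot (α : H.root) : ∃ v ∈ E6.roots, P.root α = latticeMap (fun i ↦ P.root (ρ i)) v := by
    obtain ⟨l, hl, h1⟩ := b.exists_eq_of_isReflClosed φ hφ DynkinDiagram.isReflClosed_E6 α
    exact ⟨_, List.mem_map_of_mem hl, h1⟩
  have hsurj (v) (hv : v ∈ E6.roots) :
      ∃ α : H.root, P.root α = latticeMap (fun i ↦ P.root (ρ i)) v := by
    choose g hg hg' using hroot
    have h1 : Function.Injective g := fun α β hαβ ↦ P.root.injective (by rw [hg', hg', hαβ])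
    have h2 : E6.roots.toFinset.card ≤ (Finset.univ.image g).card := by
      rw [Finset.card_image_of_injective _ h1, Finset.card_univ, ← Nat.card_eq_fintype_card]
      have h3 : b.support.card = 6 := by
        rw [← Fintype.card_coe, ← Fintype.card_congr φ, Fintype.card_fin]
      have h4 := E6.roots.toFinset_card_le
      have h5 : E6.roots.length = 72 := by decide
      omega
    have h3 := Finset.eq_of_subset_of_card_le
      (Finset.image_subset_iff.mpr fun α _ ↦ List.mem_toFinset.mpr (hg α)) h2
    have h4 := List.mem_toFinset.mpr hv
    rw [← h3, Finset.mem_image] at h4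
    obtain ⟨α, -, rfl⟩ := h4
    exact ⟨α, hg' α⟩
  have hwt := IsKilling.wt_eq_rootSpace hρ hspan
  have hwt' (v) (α : H.root) (h : P.root α = latticeMap (fun i ↦ P.root (ρ i)) v) :
      wt F (fun i ↦ (IsKilling.coroot (ρ i : LieModule.Weight F H L) : L)) v =
        (rootSpace H ((α : LieModule.Weight F H L) : H → F)).toSubmodule := by
    rw [hwt, ← h]
    rfl
  have hne (α : H.root) : (α : LieModule.Weight F H L).IsNonZero :=
    LieSubalgebra.isNonZero_coe_root _
  refine ⟨_, _, _, { hc' with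
    lieSpan_eq_top := hgen'
    wt_zero := ?_
    mem_roots := ?_
    finrank_wt := ?_
    exists_lie_eq := ?_
    lie_ne_zero := ?_
    add_mem_roots := ?_ }, hspan⟩
  · rw [hwt, hspan, map_zero]
    change (rootSpace H 0).toSubmodule = _
    rw [rootSpace_zero_eq]
    rfl
  · intro v hv h0
    rw [hwt, Ne, LieSubmodule.toSubmodule_eq_bot] at h0
    let γ : LieModule.Weight F H L := ⟨_, h0⟩
    have hγ : γ.IsNonZero := by
      intro hz
      refine hv (hinj ?_)
      rw [map_zero]
      exact DFunLike.coe_injective hz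
    obtain ⟨u, hu, h1⟩ := hroot ⟨γ, by simpa using hγ⟩
    have h2 : P.root ⟨γ, by simpa using hγ⟩ = latticeMap (fun i ↦ P.root (ρ i)) v := by
      ext x
      rfl
    rwa [← hinj (h1.symm.trans h2)]
  · intro v hv
    obtain ⟨α, hα⟩ := hsurj v hv
    rw [hwt' v α hα]
    exact IsKilling.finrank_rootSpace_eq_one _ (hne α)
  · intro v hv x hx hx0
    obtain ⟨α, hα⟩ := hsurj v hv
    rw [hwt' v α hα] at hx
    obtain ⟨y, hy, h⟩ := IsKilling.exists_lie_eq_coroot (hne α) hx hx0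
    refine ⟨y, ?_, h.trans ?_⟩
    · rw [hwt, map_neg, ← hα]
      exact hy
    · rw [IsKilling.coroot_eq_latticeMap hρ hspanR hv hα, latticeMap_apply, latticeMap_apply]
      simp [hρdef]
  · intro u hu v hv huv x hx hx0 y hy hy0
    obtain ⟨α, hα⟩ := hsurj u hu
    obtain ⟨β, hβ⟩ := hsurj v hv
    obtain ⟨γ, hγ⟩ := hsurj _ huv
    rw [hwt' u α hα] at hx
    rw [hwt' v β hβ] at hy
    refine IsKilling.lie_ne_zero_of_mem_rootSpace (γ := γ.1) (hne α) (hne β) ?_ hx hx0 hy hy0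
    rw [map_add, ← hα, ← hβ] at hγ
    exact congr_arg DFunLike.coe hγ
  · intro u hu v hv huv
    obtain ⟨α, hα⟩ := hsurj u hu
    obtain ⟨β, hβ⟩ := hsurj v hv
    have h1 : P.pairing α β = -1 := by
      have h2 : P.pairing α β = P.root α (IsKilling.coroot (β : LieModule.Weight F H L)) := rfl
      rw [h2, IsKilling.coroot_eq_latticeMap hρ hspanR hv hβ, latticeMap_apply, map_sum, hα]
      rw [E6.form_comm, E6.form_eq_sum] at huv
      rw [← Int.cast_one, ← Int.cast_neg, ← huv, Int.cast_sum]
      refine Finset.sum_congr rfl fun i _ ↦ ?_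
      rw [map_zsmul, IsKilling.latticeMap_apply_coroot hρ, zsmul_eq_mul, Int.cast_mul]
    have h2 : P.root α + P.root β ∈ Set.range P.root := by
      refine P.root_add_root_mem_of_pairingIn_neg (i := α) (j := β) ?_ ?_
      · have h3 := P.algebraMap_pairingIn ℤ α β
        rw [h1] at h3
        have h4 : P.pairingIn ℤ α β = -1 := by
          rw [eq_intCast] at h3
          exact_mod_cast h3
        omega
      · intro h3
        rw [hα, hβ, ← map_neg] at h3
        have h4 := hinj h3
        have h5 := E6.form_self_of_mem_roots v hv
        rw [h4, map_neg, LinearMap.neg_apply, h5] at huv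
        omega
    obtain ⟨γ, hγ⟩ := h2
    obtain ⟨w, hw, h3⟩ := hroot γ
    rw [h3, hα, hβ, ← map_add] at hγ
    rwa [← hinj hγ]

end

end LieAlgebra

namespace LieAlgebra

section

variable {F L : Type*} [Field F] [LieRing L] [LieAlgebra F L]

theorem _root_.LinearMap.ext_of_iSup_eq_top {ι M N : Type*} [AddCommGroup M] [Module F M]
    [AddCommGroup N] [Module F N] {p : ι → Submodule F M} (hp : ⨆ i, p i = ⊤) {f g : M →ₗ[F] N}
    (h : ∀ i, ∀ x ∈ p i, f x = g x) : f = g := by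
  rw [← LinearMap.eqLocus_eq_top, ← top_le_iff, ← hp, iSup_le_iff]
  exact h

theorem _root_.iSupIndep_of_apply_eq_smul {ι κ M : Type*} [AddCommGroup M] [Module F M]
    {f : ι → Module.End F M} (hf : ∀ i j x, f i (f j x) = f j (f i x)) {χ : κ → ι → F}
    (hχ : Function.Injective χ) {p : κ → Submodule F M}
    (hp : ∀ k, ∀ x ∈ p k, ∀ i, f i x = χ k i • x) : iSupIndep p := by
  refine ((Module.End.independent_iInf_maxGenEigenspace_of_forall_mapsTo f fun i j φ ↦
    Module.End.mapsTo_maxGenEigenspace_of_comm (LinearMap.ext (hf j i)) φ).comp hχ).mono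
    fun k x hx ↦ (Submodule.mem_iInf _).mpr fun i ↦ Module.End.eigenspace_le_maxGenEigenspace ?_
  rw [Module.End.mem_eigenspace_iff, hp k x hx]

/-- A character of the grading group acts on a graded Lie algebra by automorphisms. -/
theorem _root_.IsLieGrading.exists_lieEquiv {A : Type*} [AddCommGroup A] [DecidableEq A]
    {gr : A → Submodule F L} (hgr : IsLieGrading F gr) (χ : AddChar A F) :
    ∃ φ : L ≃ₗ⁅F⁆ L, ∀ a, ∀ x ∈ gr a, φ x = χ a • x := by
  have hex (χ : AddChar A F) : ∃ φ : L →ₗ[F] L, ∀ a, ∀ x ∈ gr a, φ x = χ a • x := by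
    let _ : DirectSum.Decomposition gr := hgr.1.chooseDecomposition
    let ψ : (DirectSum A fun a ↦ gr a) →ₗ[F] L :=
      DirectSum.toModule F A L fun a ↦ χ a • (gr a).subtype
    refine ⟨ψ ∘ₗ (DirectSum.decomposeLinearEquiv gr).toLinearMap, fun a x hx ↦ ?_⟩
    have : DirectSum.decompose gr x = DirectSum.of (fun a ↦ gr a) a ⟨x, hx⟩ :=
      DirectSum.decompose_of_mem _ hx
    rw [LinearMap.comp_apply]
    change ψ (DirectSum.decompose gr x) = _
    rw [this]
    change ψ (DirectSum.lof F A (fun a ↦ gr a) a ⟨x, hx⟩) = _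
    rw [DirectSum.toModule_lof]
    rfl
  have htop := hgr.1.submodule_iSup_eq_top
  obtain ⟨φ, hφ⟩ := hex χ
  obtain ⟨ψ, hψ⟩ := hex χ⁻¹
  have hχ (a : A) : χ⁻¹ a * χ a = 1 := by
    rw [AddChar.inv_apply, ← AddChar.map_add_eq_mul, neg_add_cancel, AddChar.map_zero_eq_one]
  have h1 : ψ ∘ₗ φ = LinearMap.id := LinearMap.ext_of_iSup_eq_top htop fun a x hx ↦ by
    rw [LinearMap.comp_apply, hφ a x hx, hψ a _ ((gr a).smul_mem _ hx), smul_smul, hχ, one_smul,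
      LinearMap.id_apply]
  have h2 : φ ∘ₗ ψ = LinearMap.id := LinearMap.ext_of_iSup_eq_top htop fun a x hx ↦ by
    rw [LinearMap.comp_apply, hψ a x hx, hφ a _ ((gr a).smul_mem _ hx), smul_smul, mul_comm, hχ,
      one_smul, LinearMap.id_apply]
  have hlie (x y) : φ ⁅x, y⁆ = ⁅φ x, φ y⁆ := by
    have hx : x ∈ ⨆ a, gr a := htop ▸ Submodule.mem_top
    have hy : y ∈ ⨆ a, gr a := htop ▸ Submodule.mem_top
    induction hx using Submodule.iSup_induction' with
    | mem a x hx =>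
      induction hy using Submodule.iSup_induction' with
      | mem b y hy =>
        rw [hφ a x hx, hφ b y hy, hφ _ _ (hgr.2 a b x hx y hy), smul_lie, lie_smul, smul_smul,
          AddChar.map_add_eq_mul]
      | zero => simp
      | add y z _ _ h1 h2 => rw [lie_add, map_add, map_add, lie_add, h1, h2]
    | zero => simp
    | add x z _ _ h1 h2 => rw [add_lie, map_add, map_add, add_lie, h1, h2]
  let φ' : L ≃ₗ⁅F⁆ L :=
    { (LinearEquiv.ofLinearMap φ ψ h2 h1 : L ≃ₗ[F] L) with map_lie' := fun {x y} ↦ hlie x y }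
  exact ⟨φ', hφ⟩

/-- Lie algebra automorphisms are determined by their values on generators. -/
theorem ext_of_lieSpan_eq_top {s : Set L} (hs : LieSubalgebra.lieSpan F L s = ⊤)
    {φ ψ : L ≃ₗ⁅F⁆ L} (h : ∀ x ∈ s, φ x = ψ x) : φ = ψ := by
  ext x
  have hx : x ∈ LieSubalgebra.lieSpan F L s := hs ▸ LieSubalgebra.mem_top x
  induction hx using LieSubalgebra.lieSpan_induction with
  | mem x hx => exact h x hx
  | zero => simp
  | add x y _ _ h1 h2 => rw [map_add, map_add, h1, h2]
  | smul c x _ h1 => rw [map_smul, map_smul, h1]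
  | lie x y _ _ h1 h2 => rw [LieEquiv.map_lie, LieEquiv.map_lie, h1, h2]

end

section

variable {F L : Type*} [Field F] [LieRing L] [LieAlgebra F L]
  {h e f : Fin 6 → L} {u v : Fin 6 → ℤ} {x y : L}

theorem map_mem_wt_iff (φ : L ≃ₗ⁅F⁆ L) {h' : Fin 6 → L} (hφ : ∀ i, φ (h i) = h' i) :
    φ x ∈ wt F h' v ↔ x ∈ wt F h v := by
  rw [mem_wt_iff, mem_wt_iff]
  refine forall_congr' fun j ↦ ?_
  rw [← hφ, ← LieEquiv.map_lie, ← map_zsmul]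
  exact φ.toLinearEquiv.injective.eq_iff

theorem map_wt (φ : L ≃ₗ⁅F⁆ L) {h' : Fin 6 → L} (hφ : ∀ i, φ (h i) = h' i) (v : Fin 6 → ℤ) :
    (wt F h v).map φ.toLinearEquiv.toLinearMap = wt F h' v := by
  ext x
  obtain ⟨y, rfl⟩ := φ.toLinearEquiv.surjective x
  exact (φ.toLinearEquiv.injective.mem_set_image (s := (wt F h v : Set L))).trans
    (map_mem_wt_iff φ hφ).symm

theorem latticeMap_comp (w : (Fin 6 → ℤ) →ₗ[ℤ] (Fin 6 → ℤ)) (v : Fin 6 → ℤ) :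
    latticeMap (fun i ↦ latticeMap h (w (Pi.single i 1))) v = latticeMap h (w v) := by
  have : latticeMap (fun i ↦ latticeMap h (w (Pi.single i 1))) = latticeMap h ∘ₗ w := by
    refine LinearMap.pi_ext' fun i ↦ LinearMap.ext_ring ?_
    simp [latticeMap_single]
  rw [this, LinearMap.comp_apply]

theorem wt_comp (w : (Fin 6 → ℤ) →ₗ[ℤ] (Fin 6 → ℤ)) (hw : ∀ u v, E6.form (w u) (w v) = E6.form u v)
    (hsurj : Function.Surjective w) (v : Fin 6 → ℤ) :
    wt F (fun i ↦ latticeMap h (w (Pi.single i 1))) v = wt F h (w v) := by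
  ext x
  rw [mem_wt, mem_wt, hsurj.forall (p := fun u ↦ ⁅latticeMap h u, x⁆ = E6.form u (w v) • x)]
  simp only [latticeMap_comp, hw]

theorem map_latticeMap (φ : L ≃ₗ⁅F⁆ L) {h' : Fin 6 → L} (hφ : ∀ i, φ (h i) = h' i) (v : Fin 6 → ℤ) :
    φ (latticeMap h v) = latticeMap h' v := by
  simp [latticeMap_apply, ← hφ]

end

/-- Characters of the root lattice have arbitrary nonzero values on the simple roots. -/
theorem exists_addChar {F : Type*} [Field F] {c : Fin 6 → F} (hc : ∀ i, c i ≠ 0) :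
    ∃ χ : AddChar (Fin 6 → ℤ) F, ∀ i, χ (Pi.single i 1) = c i := by
  refine ⟨⟨fun v ↦ ∏ i, c i ^ v i, by simp, fun u v ↦ ?_⟩, fun i ↦ ?_⟩
  · simp [zpow_add₀ (hc _), Finset.prod_mul_distrib]
  · change ∏ j, c j ^ (Pi.single i 1 : Fin 6 → ℤ) j = c i
    rw [Finset.prod_eq_single i] <;> simp +contextual

namespace ChevalleyRel

variable {F L : Type*} [Field F] [LieRing L] [LieAlgebra F L] {h e f : Fin 6 → L}
  (c : ChevalleyRel F (cartan DynkinDiagram.diagramE6) h e f)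
include c

theorem e_mem_wt (i : Fin 6) : e i ∈ wt F h (Pi.single i 1) := by
  rw [mem_wt_iff]
  intro j
  rw [c.lie_h_e, E6.form_comm, E6.form_single]

theorem f_mem_wt (i : Fin 6) : f i ∈ wt F h (-Pi.single i 1) := by
  rw [mem_wt_iff]
  intro j
  rw [c.lie_h_f, E6.form_comm, map_neg, LinearMap.neg_apply, E6.form_single]

theorem h_mem_wt (i : Fin 6) : h i ∈ wt F h 0 := by
  simpa [c.lie_e_f] using lie_mem_wt (c.e_mem_wt i) (c.f_mem_wt i)

theorem h_ne_zero (i : Fin 6) : h i ≠ 0 := c.linInd.ne_zero i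

theorem e_ne_zero (i : Fin 6) : e i ≠ 0 := fun h0 ↦ c.h_ne_zero i <| by
  rw [← c.lie_e_f, h0, zero_lie]

theorem latticeMap_ne_zero [CharZero F] {v : Fin 6 → ℤ} (hv : v ≠ 0) : latticeMap h v ≠ 0 := by
  intro h0
  refine hv (funext fun i ↦ ?_)
  have := Fintype.linearIndependent_iff.mp c.linInd (fun i ↦ (v i : F))
    (by simpa [latticeMap_apply, Int.cast_smul_eq_zsmul] using h0) i
  simpa using this

theorem iSupIndep_wt [CharZero F] : iSupIndep (wt F h) := by
  let χ (v : Fin 6 → ℤ) (j : Fin 6) : F := E6.form (Pi.single j 1) v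
  have hχ : Function.Injective χ := fun u v huv ↦ E6.form_injective <| LinearMap.pi_ext' fun j ↦
    LinearMap.ext_ring <| by
      have := congrFun huv j
      simpa [χ, E6.form_comm] using this
  refine iSupIndep_of_apply_eq_smul (f := fun j ↦ (ad F L (h j) : Module.End F L))
    (fun i j x ↦ ?_) hχ fun v x hx j ↦ ?_
  · change ⁅h i, ⁅h j, x⁆⁆ = ⁅h j, ⁅h i, x⁆⁆
    rw [leibniz_lie, c.lie_h_h, zero_lie, zero_add]
  · rw [ad_apply, mem_wt_iff.mp hx, Int.cast_smul_eq_zsmul]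

theorem isLieGrading_wt [CharZero F]
    (hgen : LieSubalgebra.lieSpan F L (Set.range e ∪ Set.range f) = ⊤) :
    IsLieGrading F (wt F h) := by
  let S : LieSubalgebra F L := { (⨆ v, wt F h v : Submodule F L) with
    lie_mem' := fun {x y} hx hy ↦ by
      change x ∈ ⨆ v, wt F h v at hx
      change y ∈ ⨆ v, wt F h v at hy
      change ⁅x, y⁆ ∈ ⨆ v, wt F h v
      induction hx using Submodule.iSup_induction' with
      | mem a x hx =>
        induction hy using Submodule.iSup_induction' with
        | mem b y hy => exact Submodule.mem_iSup_of_mem _ (lie_mem_wt hx hy)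
        | zero => simp
        | add y z _ _ h1 h2 => rw [lie_add]; exact add_mem h1 h2
      | zero => simp
      | add x z _ _ h1 h2 => rw [add_lie]; exact add_mem h1 h2 }
  have hS : LieSubalgebra.lieSpan F L (Set.range e ∪ Set.range f) ≤ S := by
    refine LieSubalgebra.lieSpan_le.mpr ?_
    rintro _ (⟨i, rfl⟩ | ⟨i, rfl⟩)
    · exact Submodule.mem_iSup_of_mem _ (c.e_mem_wt i)
    · exact Submodule.mem_iSup_of_mem _ (c.f_mem_wt i)
  refine ⟨DirectSum.isInternal_submodule_of_iSupIndep_of_iSup_eq_top c.iSupIndep_wt ?_,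
    fun u v x hx y hy ↦ lie_mem_wt hx hy⟩
  refine top_le_iff.mp fun x _ ↦ hS ?_
  rw [hgen]
  exact LieSubalgebra.mem_top x

end ChevalleyRel

namespace E6Frame

variable {F L : Type*} [Field F] [LieRing L] [LieAlgebra F L] {h e f : Fin 6 → L}

theorem map (fr : E6Frame F h e f) (φ : L ≃ₗ⁅F⁆ L) : E6Frame F (φ ∘ h) (φ ∘ e) (φ ∘ f) := by
  have hφ (i) : φ (h i) = (φ ∘ h) i := rfl
  have hm (v) : wt F (φ ∘ h) v = (wt F h v).map φ.toLinearEquiv.toLinearMap :=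
    (map_wt φ hφ v).symm
  have hl (v) : latticeMap (φ ∘ h) v = φ (latticeMap h v) := (map_latticeMap φ hφ v).symm
  constructor
  · constructor
    · exact fr.linInd.map' φ.toLinearEquiv.toLinearMap φ.toLinearEquiv.ker
    · intro i j
      simp [← LieEquiv.map_lie, fr.lie_h_h]
    · intro i j
      simp [← LieEquiv.map_lie, fr.lie_h_e]
    · intro i j
      simp [← LieEquiv.map_lie, fr.lie_h_f]
    · intro i
      simp [← LieEquiv.map_lie, fr.lie_e_f]
    · intro i j hij
      simp [← LieEquiv.map_lie, fr.lie_e_f_ne i j hij]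
  · refine top_le_iff.mp fun x _ ↦ ?_
    obtain ⟨x, rfl⟩ := φ.toLinearEquiv.surjective x
    clear * - fr
    have hx : x ∈ LieSubalgebra.lieSpan F L (Set.range e ∪ Set.range f) :=
      fr.lieSpan_eq_top ▸ LieSubalgebra.mem_top x
    change φ x ∈ _
    induction hx using LieSubalgebra.lieSpan_induction with
    | mem x hx =>
      apply LieSubalgebra.subset_lieSpan
      rcases hx with ⟨i, rfl⟩ | ⟨i, rfl⟩
      · exact .inl ⟨i, rfl⟩
      · exact .inr ⟨i, rfl⟩
    | zero => simp
    | add x y _ _ h1 h2 => rw [map_add]; exact add_mem h1 h2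
    | smul c x _ h1 => rw [map_smul]; exact LieSubalgebra.smul_mem _ _ h1
    | lie x y _ _ h1 h2 => rw [LieEquiv.map_lie]; exact LieSubalgebra.lie_mem _ h1 h2
  · rw [hm, fr.wt_zero, Submodule.map_span, ← Set.range_comp]
    rfl
  · intro v hv
    rw [hm, ne_eq, Submodule.map_eq_bot_iff]
    exact fr.mem_roots v hv
  · intro v hv
    rw [hm, ← fr.finrank_wt v hv]
    exact LinearEquiv.finrank_map_eq φ.toLinearEquiv _
  · intro v hv x hx hx0
    rw [hm] at hx
    obtain ⟨x, hx, rfl⟩ := hx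
    obtain ⟨y, hy, hxy⟩ := fr.exists_lie_eq v hv x hx fun h0 ↦ hx0 (by simp [h0])
    refine ⟨φ y, (map_mem_wt_iff φ hφ).mpr hy, ?_⟩
    rw [hl, ← hxy, LieEquiv.map_lie]
    rfl
  · intro u hu v hv huv x hx hx0 y hy hy0
    rw [hm] at hx hy
    obtain ⟨x, hx, rfl⟩ := hx
    obtain ⟨y, hy, rfl⟩ := hy
    have := fr.lie_ne_zero u hu v hv huv x hx (fun h0 ↦ hx0 (by simp [h0])) y hy
      fun h0 ↦ hy0 (by simp [h0])
    change ⁅φ x, φ y⁆ ≠ 0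
    rw [← LieEquiv.map_lie]
    exact fun h0 ↦ this (φ.toLinearEquiv.map_eq_zero_iff.mp h0)
  · exact fr.add_mem_roots

variable [CharZero F] [FiniteDimensional F L] [IsSimple F L]

theorem exists_lieEquiv (fr : E6Frame F h e f) {h' e' f' : Fin 6 → L}
    (c' : ChevalleyRel F (cartan DynkinDiagram.diagramE6) h' e' f') :
    ∃ φ : L ≃ₗ⁅F⁆ L, (∀ i, φ (h i) = h' i) ∧ (∀ i, φ (e i) = e' i) ∧ ∀ i, φ (f i) = f' i :=
  fr.toChevalleyRel.exists_lieEquiv (Matrix.nondegenerate_iff_det_ne_zero.mpr cartan_E6_det)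
    (by decide) fr.lieSpan_eq_top c' le_rfl

/-- Any set of Chevalley generators is a frame if there is one. -/
theorem of_chevalleyRel (fr : E6Frame F h e f) {h' e' f' : Fin 6 → L}
    (c' : ChevalleyRel F (cartan DynkinDiagram.diagramE6) h' e' f') : E6Frame F h' e' f' := by
  obtain ⟨φ, h1, h2, h3⟩ := fr.exists_lieEquiv c'
  obtain rfl : φ ∘ h = h' := funext h1
  obtain rfl : φ ∘ e = e' := funext h2
  obtain rfl : φ ∘ f = f' := funext h3
  exact fr.map φ

end E6Frame

namespace E6Frame

variable {F L : Type*} [Field F] [LieRing L] [LieAlgebra F L] {h e f : Fin 6 → L}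
  (fr : E6Frame F h e f) {u v : Fin 6 → ℤ} {x y : L}
include fr

theorem exists_smul_eq (hv : v ∈ E6.roots) (hx : x ∈ wt F h v) (hx0 : x ≠ 0) (hy : y ∈ wt F h v) :
    ∃ c : F, c • x = y := by
  obtain ⟨c, hc⟩ := (finrank_eq_one_iff_of_nonzero' (⟨x, hx⟩ : wt F h v)
    (by simpa using hx0)).mp (fr.finrank_wt v hv) ⟨y, hy⟩
  exact ⟨c, congrArg Subtype.val hc⟩

theorem exists_ne_zero (hv : v ∈ E6.roots) : ∃ x ∈ wt F h v, x ≠ 0 := by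
  have : wt F h v ≠ ⊥ := fun h0 ↦ by
    have := fr.finrank_wt v hv
    rw [h0, finrank_bot] at this
    exact zero_ne_one this
  obtain ⟨x, hx, hx0⟩ := (wt F h v).ne_bot_iff.mp this
  exact ⟨x, hx, hx0⟩

theorem wt_eq_bot (hv0 : v ≠ 0) (hv : v ∉ E6.roots) : wt F h v = ⊥ :=
  of_not_not fun h0 ↦ hv (fr.mem_roots v hv0 h0)

theorem exists_lie_eq_smul [CharZero F] (hv : v ∈ E6.roots)
    (hx : x ∈ wt F h v) (hy : y ∈ wt F h (-v)) :
    ∃ c : F, ⁅x, y⁆ = c • latticeMap h v := by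
  rcases eq_or_ne x 0 with rfl | hx0
  · exact ⟨0, by simp⟩
  obtain ⟨z, hz, hxz⟩ := fr.exists_lie_eq v hv x hx hx0
  have hz0 : z ≠ 0 := by
    rintro rfl
    rw [lie_zero] at hxz
    exact fr.latticeMap_ne_zero (fun h0 ↦ E6.zero_notMem_roots (h0 ▸ hv)) hxz.symm
  obtain ⟨c, rfl⟩ := fr.exists_smul_eq (E6.neg_mem_roots v hv) hz hz0 hy
  exact ⟨c, by rw [lie_smul, hxz]⟩

theorem latticeMap_mem_wt (u : Fin 6 → ℤ) : latticeMap h u ∈ wt F h 0 := by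
  rw [latticeMap_apply]
  exact sum_mem fun i _ ↦ zsmul_mem (fr.h_mem_wt i) _

/-- Simple roots may be replaced by any other system of roots with the same Cartan matrix. -/
theorem exists_chevalleyRel [CharZero F] {ρ : Fin 6 → Fin 6 → ℤ} (hρ : ∀ i, ρ i ∈ E6.roots)
    (hform : ∀ i j, E6.form (ρ i) (ρ j) = cartan DynkinDiagram.diagramE6 i j) {e' : Fin 6 → L}
    (he' : ∀ i, e' i ∈ wt F h (ρ i)) (he0 : ∀ i, e' i ≠ 0) :
    ∃ f' : Fin 6 → L, (∀ i, f' i ∈ wt F h (-ρ i)) ∧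
      ChevalleyRel F (cartan DynkinDiagram.diagramE6) (fun i ↦ latticeMap h (ρ i)) e' f' := by
  choose f' hf' hef using fun i ↦ fr.exists_lie_eq (ρ i) (hρ i) (e' i) (he' i) (he0 i)
  have hhe (i j) : ⁅latticeMap h (ρ j), e' i⁆ = cartan DynkinDiagram.diagramE6 i j • e' i := by
    rw [he', E6.form_comm, hform]
  refine ⟨f', hf', linearIndependent_of_lie_eq cartan_E6_det hhe he0, fun i j ↦ ?_, hhe,
    fun i j ↦ ?_, hef, fun i j hij ↦ ?_⟩
  · have := fr.latticeMap_mem_wt (ρ j) (ρ i)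
    rwa [map_zero, zero_smul] at this
  · rw [hf', E6.form_comm, map_neg, LinearMap.neg_apply, hform]
  · have hA : cartan DynkinDiagram.diagramE6 i j ≤ 0 := by
      revert hij
      fin_cases i <;> fin_cases j <;> decide +kernel
    have h4 : E6.form (ρ i + -ρ j) (ρ i + -ρ j) = 4 - 2 * cartan DynkinDiagram.diagramE6 i j := by
      simp only [map_add, map_neg, LinearMap.add_apply, LinearMap.neg_apply]
      rw [E6.form_comm (ρ j) (ρ i), E6.form_self_of_mem_roots _ (hρ i),
        E6.form_self_of_mem_roots _ (hρ j), hform]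
      ring
    have hbot : wt F h (ρ i + -ρ j) = ⊥ := by
      refine fr.wt_eq_bot (fun h0 ↦ ?_) (fun hr ↦ ?_)
      · rw [h0, map_zero] at h4
        omega
      · rw [E6.form_self_of_mem_roots _ hr] at h4
        omega
    have := lie_mem_wt (he' i) (hf' j)
    rwa [hbot] at this

/-- Characters of the root lattice act on a Lie algebra with a frame. -/
theorem exists_toral [CharZero F] (χ : AddChar (Fin 6 → ℤ) F) :
    ∃ φ : L ≃ₗ⁅F⁆ L, ∀ v, ∀ x ∈ wt F h v, φ x = χ v • x :=
  (fr.isLieGrading_wt fr.lieSpan_eq_top).exists_lieEquiv χ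

theorem iSup_wt [CharZero F] : ⨆ v, wt F h v = ⊤ :=
  (fr.isLieGrading_wt fr.lieSpan_eq_top).1.submodule_iSup_eq_top

/-- An automorphism fixing the Cartan subalgebra pointwise is toral. -/
theorem exists_eq_smul [CharZero F] {φ : L ≃ₗ⁅F⁆ L} (hφ : ∀ i, φ (h i) = h i) :
    ∃ χ : AddChar (Fin 6 → ℤ) F, ∀ v, ∀ x ∈ wt F h v, φ x = χ v • x := by
  have hc (i) : ∃ c : F, c ≠ 0 ∧ φ (e i) = c • e i := by
    have hm := (map_mem_wt_iff φ hφ).mpr (fr.e_mem_wt i)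
    obtain ⟨c, hc⟩ := fr.exists_smul_eq (E6.single_mem_roots i) (fr.e_mem_wt i) (fr.e_ne_zero i) hm
    refine ⟨c, ?_, hc.symm⟩
    rintro rfl
    rw [zero_smul] at hc
    exact fr.e_ne_zero i (φ.toLinearEquiv.map_eq_zero_iff.mp hc.symm)
  choose c hc0 hc using hc
  obtain ⟨χ, hχ⟩ := exists_addChar hc0
  obtain ⟨ψ, hψ⟩ := fr.exists_toral χ
  have hψe (i) : ψ (e i) = c i • e i := by rw [hψ _ _ (fr.e_mem_wt i), hχ]
  suffices φ = ψ from ⟨χ, fun v x hx ↦ by rw [this, hψ v x hx]⟩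
  refine ext_of_lieSpan_eq_top fr.lieSpan_eq_top ?_
  rintro _ (⟨i, rfl⟩ | ⟨i, rfl⟩)
  · rw [hc, hψe]
  · have hm := (map_mem_wt_iff φ hφ).mpr (fr.f_mem_wt i)
    have hr := E6.neg_mem_roots _ (E6.single_mem_roots i)
    have hf0 : f i ≠ 0 := fun h0 ↦ fr.h_ne_zero i <| by rw [← fr.lie_e_f, h0, lie_zero]
    obtain ⟨a, ha⟩ := fr.exists_smul_eq hr (fr.f_mem_wt i) hf0 hm
    have hψf : ψ (f i) = (c i)⁻¹ • f i := by
      rw [hψ _ _ (fr.f_mem_wt i), ← hχ, AddChar.map_neg_eq_inv]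
    have h1 := congrArg φ (fr.lie_e_f i)
    rw [LieEquiv.map_lie, hc, ← ha, hφ, smul_lie, lie_smul, fr.lie_e_f, smul_smul] at h1
    have h2 : c i * a = 1 := by
      have : (c i * a - 1) • h i = 0 := by rw [sub_smul, h1, one_smul, sub_self]
      exact sub_eq_zero.mp ((smul_eq_zero_iff_left (fr.h_ne_zero i)).mp this)
    rw [hψf, ← ha, eq_inv_of_mul_eq_one_right h2]

end E6Frame

end LieAlgebra

section

variable {F M : Type*} [Field F] [AddCommGroup M] [Module F M]

theorem exists_addChar_injective (F : Type*) [Field F] [IsAlgClosed F] [CharZero F] :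
    ∃ E : AddChar (ZMod 3) F, Function.Injective E := by
  obtain ⟨ζ, hζ⟩ := HasEnoughRootsOfUnity.exists_primitiveRoot F 3
  refine ⟨AddChar.zmodChar 3 hζ.pow_eq_one, fun a b hab ↦ ?_⟩
  rw [AddChar.zmodChar_apply, AddChar.zmodChar_apply] at hab
  exact ZMod.val_injective 3 (hζ.pow_inj (ZMod.val_lt a) (ZMod.val_lt b) hab)

variable {E : AddChar (ZMod 3) F}

theorem AddChar.zmod_three_pow (E : AddChar (ZMod 3) F) (i : ZMod 3) : E i ^ 3 = 1 := by
  rw [← AddChar.map_nsmul_eq_pow, show 3 • i = 0 by revert i; decide, AddChar.map_zero_eq_one]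

theorem AddChar.zmod_three_eq (E : AddChar (ZMod 3) F) (i : ZMod 3) : E i = E (-i) ^ 2 := by
  rw [← AddChar.map_nsmul_eq_pow, show 2 • -i = i by revert i; decide]

theorem AddChar.zmod_three_sum (hE : Function.Injective E) {i : ZMod 3} (hi : i ≠ 0) :
    1 + E i + E i ^ 2 = 0 := by
  have h1 : E i - 1 ≠ 0 := fun h ↦ hi <| hE <| by
    rw [AddChar.map_zero_eq_one, sub_eq_zero.mp h]
  have h3 := E.zmod_three_pow i
  refine (mul_eq_zero.mp ?_ : E i - 1 = 0 ∨ _).resolve_left h1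
  linear_combination h3

/-- The projection onto an eigenspace of an endomorphism with cube one. -/
def eigenProj (E : AddChar (ZMod 3) F) (i : ZMod 3) (t : M →ₗ[F] M) : M →ₗ[F] M :=
  (3⁻¹ : F) • (LinearMap.id + E (-i) • t + E i • t ∘ₗ t)

theorem eigenProj_apply (i : ZMod 3) (t : M →ₗ[F] M) (x : M) :
    eigenProj E i t x = (3⁻¹ : F) • (x + E (-i) • t x + E i • t (t x)) := rfl

theorem eigenProj_of_eq_smul [CharZero F] (hE : Function.Injective E) {i j : ZMod 3}
    {t : M →ₗ[F] M} {x : M} (hx : t x = E j • x) :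
    eigenProj E i t x = if j = i then x else 0 := by
  have h : eigenProj E i t x = (3⁻¹ * (1 + E (-i + j) + E (-i + j) ^ 2) : F) • x := by
    rw [eigenProj_apply, hx, map_smul, hx, E.zmod_three_eq i, AddChar.map_add_eq_mul]
    module
  rw [h]
  split_ifs with hij
  · rw [hij, neg_add_cancel, AddChar.map_zero_eq_one]
    norm_num
  · rw [AddChar.zmod_three_sum hE, mul_zero, zero_smul]
    rwa [neg_add_eq_sub, sub_ne_zero]

theorem apply_eigenProj {t : M →ₗ[F] M} (ht : ∀ x, t (t (t x)) = x) (i : ZMod 3) (x : M) :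
    t (eigenProj E i t x) = E i • eigenProj E i t x := by
  have h3 := E.zmod_three_pow (-i)
  rw [eigenProj_apply, map_smul, map_add, map_add, map_smul, map_smul, ht, E.zmod_three_eq i]
  match_scalars
  · linear_combination (-3⁻¹ : F) * h3
  · linear_combination (-3⁻¹ * E (-i) : F) * h3
  · ring

theorem map_eigenProj {s t : M →ₗ[F] M} (hst : ∀ x, s (t x) = t (s x)) (i : ZMod 3) (x : M) :
    s (eigenProj E i t x) = eigenProj E i t (s x) := by
  simp only [eigenProj_apply, map_smul, map_add, hst]

theorem sum_eigenProj [CharZero F] (hE : Function.Injective E) (t : M →ₗ[F] M) (x : M) :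
    ∑ i, eigenProj E i t x = x := by
  have h1 := AddChar.zmod_three_sum hE (i := 1) (by decide)
  have h2 : E 2 = E 1 ^ 2 := by rw [← AddChar.map_nsmul_eq_pow]; rfl
  have h3 := E.zmod_three_pow 1
  have hsum (f : ZMod 3 → M) : ∑ i, f i = f 0 + f 1 + f 2 := Fin.sum_univ_three f
  rw [hsum, eigenProj_apply, eigenProj_apply, eigenProj_apply, neg_zero,
    show (-1 : ZMod 3) = 2 from rfl, show (-2 : ZMod 3) = 1 from rfl, AddChar.map_zero_eq_one, h2]
  match_scalars
  · norm_num
  · linear_combination (3⁻¹ : F) * h1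
  · linear_combination (3⁻¹ : F) * h1

/-- Simultaneous eigenvectors lie in the sum of the appropriate homogeneous components. -/
theorem mem_iSup_of_apply_eq_smul [CharZero F] (hE : Function.Injective E) {κ : Type*}
    {p : κ → Submodule F M} (hp : ⨆ k, p k = ⊤) {t : Fin 2 → M →ₗ[F] M} {D : κ → Fin 2 → ZMod 3}
    (ht : ∀ k, ∀ x ∈ p k, ∀ i, t i x = E (D k i) • x) {b : Fin 2 → ZMod 3} {x : M}
    (hx : ∀ i, t i x = E (b i) • x) : x ∈ ⨆ k, ⨆ (_ : D k = b), p k := by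
  have hle : (⊤ : Submodule F M) ≤ (⨆ k, ⨆ (_ : D k = b), p k).comap
      (eigenProj E (b 0) (t 0) ∘ₗ eigenProj E (b 1) (t 1)) := by
    rw [← hp, iSup_le_iff]
    intro k y hy
    rw [Submodule.mem_comap, LinearMap.comp_apply, eigenProj_of_eq_smul hE (ht k y hy 1)]
    split_ifs with h1
    · rw [eigenProj_of_eq_smul hE (ht k y hy 0)]
      split_ifs with h0
      · have hD : D k = b := by
          ext i
          fin_cases i
          exacts [h0, h1]
        exact Submodule.mem_iSup_of_mem k (Submodule.mem_iSup_of_mem hD hy)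
      · exact zero_mem _
    · rw [map_zero]
      exact zero_mem _
  have := hle (Submodule.mem_top (x := x))
  rwa [Submodule.mem_comap, LinearMap.comp_apply, eigenProj_of_eq_smul hE (hx 1), if_pos rfl,
    eigenProj_of_eq_smul hE (hx 0), if_pos rfl] at this

end

namespace LieAlgebra

namespace E6

/-- An automorphism of order three of the root lattice of type `E₆` without nonzero fixed points. -/
def rot : (Fin 6 → ℤ) →ₗ[ℤ] (Fin 6 → ℤ) where
  toFun v := ![-v 1 + v 5, v 0 - v 1 - v 2 + 2 * v 5, -2 * v 2 + 3 * v 5,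
    v 4 - v 3 - v 2 + 2 * v 5, -v 3 + v 5, -v 2 + v 5]
  map_add' u v := by ext i; fin_cases i <;> simp <;> ring
  map_smul' c v := by ext i; fin_cases i <;> simp <;> ring

theorem rot_rot (v : Fin 6 → ℤ) : rot (rot v) = -v - rot v := by
  ext i; fin_cases i <;> simp [rot] <;> ring

theorem form_rot (u v : Fin 6 → ℤ) : form (rot u) (rot v) = form u v := by
  simp only [form, rot, LinearMap.mk₂_apply, LinearMap.coe_mk, AddHom.coe_mk, Matrix.cons_val]
  ring

theorem rot_mem_roots : ∀ v ∈ roots, rot v ∈ roots := by decide +kernel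

/-- A grading of the root lattice of type `E₆` which is invariant under `rot`. -/
def grad : (Fin 6 → ℤ) →+ (Fin 2 → ZMod 3) where
  toFun v := ![((v 0 + v 1 + v 3 + v 4 + v 5 : ℤ) : ZMod 3), (v 2 : ZMod 3)]
  map_zero' := by decide
  map_add' u v := by
    ext i
    fin_cases i
    · simp
      ring
    · simp

theorem grad_rot (v : Fin 6 → ℤ) : grad (rot v) = grad v := by
  have h3 : (3 : ZMod 3) = 0 := rfl
  ext i
  fin_cases i <;>
    simp only [grad, rot, AddMonoidHom.coe_mk, ZeroHom.coe_mk, LinearMap.coe_mk, AddHom.coe_mk,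
      Matrix.cons_val, Fin.zero_eta, Fin.mk_one] <;> push_cast
  · linear_combination (-v 1 - v 3 - v 2 + 2 * v 5 : ZMod 3) * h3
  · linear_combination (-v 2 + v 5 : ZMod 3) * h3

theorem grad_ne_zero : ∀ v ∈ roots, grad v ≠ 0 := by decide +kernel

theorem exists_orbits (u : Fin 2 → ZMod 3) (hu : u ≠ 0) : ∃ r : Fin 3 → Fin 6 → ℤ,
    (∀ i, r i ∈ roots) ∧ ∀ v ∈ roots, grad v = u →
      ∃ i, v = r i ∨ v = rot (r i) ∨ v = rot (rot (r i)) := by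
  obtain ⟨a, b, rfl⟩ : ∃ a b, u = ![a, b] := ⟨u 0, u 1, by ext i; fin_cases i <;> rfl⟩
  fin_cases a <;> fin_cases b
  · exact absurd (by decide) hu
  · exact ⟨![![0, 0, 1, 0, 0, 0], ![1, 1, 1, 1, 0, 0], ![1, 1, 1, 0, 0, 1]],
      by decide +kernel, by decide +kernel⟩
  · exact ⟨![![0, 0, -1, 0, 0, 0], ![0, 0, -1, -1, -1, -1], ![0, -1, -1, -1, -1, 0]],
      by decide +kernel, by decide +kernel⟩
  · exact ⟨![![1, 0, 0, 0, 0, 0], ![0, 0, 0, 1, 0, 0], ![0, 0, 0, 0, 0, 1]],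
      by decide +kernel, by decide +kernel⟩
  · exact ⟨![![0, 1, 1, 0, 0, 0], ![0, 0, 1, 1, 0, 0], ![0, 0, 1, 0, 0, 1]],
      by decide +kernel, by decide +kernel⟩
  · exact ⟨![![0, 0, -1, -1, 0, -1], ![0, 0, -1, -1, -1, 0], ![0, -1, -1, -1, 0, 0]],
      by decide +kernel, by decide +kernel⟩
  · exact ⟨![![0, 0, 0, 0, 0, -1], ![0, 0, 0, 0, -1, 0], ![0, -1, 0, 0, 0, 0]],
      by decide +kernel, by decide +kernel⟩
  · exact ⟨![![1, 1, 1, 0, 0, 0], ![0, 1, 1, 1, 0, 0], ![0, 1, 1, 0, 0, 1]],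
      by decide +kernel, by decide +kernel⟩
  · exact ⟨![![0, 0, -1, 0, 0, -1], ![0, 0, -1, -1, 0, 0], ![0, -1, -1, 0, 0, 0]],
      by decide +kernel, by decide +kernel⟩

end E6

end LieAlgebra

namespace LieAlgebra

namespace E6Frame

variable {F L : Type*} [Field F] [LieRing L] [LieAlgebra F L] {h e f : Fin 6 → L}

/-- Compatibility of an automorphism with the root space decomposition. -/
theorem apply_mem_wt {n : L ≃ₗ⁅F⁆ L} {w : (Fin 6 → ℤ) →ₗ[ℤ] (Fin 6 → ℤ)}
    (hform : ∀ u v, E6.form (w u) (w v) = E6.form u v) (hsurj : Function.Surjective w)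
    (hn : ∀ i, n (h i) = latticeMap h (w (Pi.single i 1))) {v : Fin 6 → ℤ} {x : L}
    (hx : x ∈ wt F h v) : n x ∈ wt F h (w v) := by
  rw [← wt_comp w hform hsurj, map_mem_wt_iff n hn]
  exact hx

/-- An automorphism acting on the roots without fixed points and with cube one has itself
cube one. -/
theorem apply_apply_apply [CharZero F] (fr : E6Frame F h e f) {n : L ≃ₗ⁅F⁆ L}
    {w : (Fin 6 → ℤ) →ₗ[ℤ] (Fin 6 → ℤ)}
    (hform : ∀ u v, E6.form (w u) (w v) = E6.form u v) (hw : ∀ v, w (w v) = -v - w v)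
    (hroots : ∀ v ∈ E6.roots, w v ∈ E6.roots)
    (hn : ∀ i, n (h i) = latticeMap h (w (Pi.single i 1))) (x : L) : n (n (n x)) = x := by
  have hw3 (v) : w (w (w v)) = v := by rw [hw v, map_sub, map_neg, hw]; abel
  have hsurj : Function.Surjective w := fun v ↦ ⟨w (w v), hw3 v⟩
  have hnw {v x} (hx : x ∈ wt F h v) : n x ∈ wt F h (w v) := apply_mem_wt hform hsurj hn hx
  have hnl (v) : n (latticeMap h v) = latticeMap h (w v) := by
    rw [map_latticeMap n hn, latticeMap_comp]
  have hn0 {x : L} (hx : x ≠ 0) : n x ≠ 0 := fun h0 ↦ hx (n.toLinearEquiv.map_eq_zero_iff.mp h0)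
  suffices (n.trans n).trans n = LieEquiv.refl from congrArg (fun φ : L ≃ₗ⁅F⁆ L ↦ φ x) this
  suffices ∀ v ∈ E6.roots, ∀ x ∈ wt F h v, n (n (n x)) = x by
    refine ext_of_lieSpan_eq_top fr.lieSpan_eq_top ?_
    rintro _ (⟨i, rfl⟩ | ⟨i, rfl⟩)
    · exact this _ (E6.single_mem_roots i) _ (fr.e_mem_wt i)
    · exact this _ (E6.neg_mem_roots _ (E6.single_mem_roots i)) _ (fr.f_mem_wt i)
  intro v hv x hx
  rcases eq_or_ne x 0 with rfl | hx0
  · simp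
  have hx1 := hnw hx
  have hx2 := hnw hx1
  have hx3 := hnw hx2
  rw [hw3] at hx3
  obtain ⟨c, hc⟩ := fr.exists_smul_eq hv hx hx0 hx3
  have h22 := E6.form_self_of_mem_roots v hv
  have hm1 : E6.form v (w v) = -1 := by
    have h1 : E6.form (w v) (w (w v)) = E6.form v (w v) := hform _ _
    rw [hw, map_sub, map_neg, E6.form_comm, hform] at h1
    omega
  have hvw : v + w v = -w (w v) := by rw [hw]; abel
  have hr := E6.neg_mem_roots _ (hroots _ (hroots _ hv))
  have hz0 : ⁅x, n x⁆ ≠ 0 := fr.lie_ne_zero v hv _ (hroots v hv) (hvw ▸ hr) x hx hx0 _ hx1 (hn0 hx0)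
  have hz := lie_mem_wt hx hx1
  rw [hvw] at hz
  obtain ⟨y, hy, hzy⟩ := fr.exists_lie_eq _ hr _ hz hz0
  rw [neg_neg] at hy
  obtain ⟨b, rfl⟩ := fr.exists_smul_eq (hroots _ (hroots _ hv)) hx2 (hn0 (hn0 hx0)) hy
  have e0 : b • ⁅⁅x, n x⁆, n (n x)⁆ = latticeMap h (-w (w v)) := by rw [← hzy, lie_smul]
  have e1 : (b * c) • ⁅⁅n x, n (n x)⁆, x⁆ = latticeMap h (-v) := by
    rw [mul_smul, ← lie_smul c, hc, ← hw3 v, ← map_neg, ← map_neg, ← map_neg, ← hnl, map_neg,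
      map_neg, ← e0, map_smul, LieEquiv.map_lie, LieEquiv.map_lie]
  have e2 : (b * c * c) • ⁅⁅n (n x), x⁆, n x⁆ = latticeMap h (-w v) := by
    rw [← map_neg, ← hnl, ← e1, map_smul, LieEquiv.map_lie, LieEquiv.map_lie, ← hc, lie_smul,
      smul_lie, smul_smul]
  have hJ : ⁅⁅x, n x⁆, n (n x)⁆ + ⁅⁅n x, n (n x)⁆, x⁆ + ⁅⁅n (n x), x⁆, n x⁆ = 0 := by
    rw [← neg_eq_zero, neg_add, neg_add, lie_skew, lie_skew, lie_skew,
      ← lie_jacobi x (n x) (n (n x))]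
    abel
  have hA : ⁅latticeMap h v, x⁆ = (2 : F) • x := by
    rw [hx v, h22, ← Int.cast_smul_eq_zsmul F]; norm_num
  have hB : ⁅latticeMap h (w v), x⁆ = (-1 : F) • x := by
    rw [hx (w v), E6.form_comm, hm1, ← Int.cast_smul_eq_zsmul F]; norm_num
  have hAB : (c ^ 2) • (latticeMap h v + latticeMap h (w v)) - c • latticeMap h v
      - latticeMap h (w v) = 0 := by
    have e0' : b • ⁅⁅x, n x⁆, n (n x)⁆ = latticeMap h v + latticeMap h (w v) := by
      rw [e0, ← hvw, map_add]
    rw [map_neg] at e1 e2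
    rw [← e0', sub_eq_add_neg, sub_eq_add_neg, ← smul_neg, ← e1, ← e2,
      ← smul_zero (b * c ^ 2), ← hJ]
    module
  have hfin := congrArg (fun z ↦ ⁅z, x⁆) hAB
  simp only [sub_lie, smul_lie, add_lie, hA, hB, zero_lie] at hfin
  have hc1 : (c - 1) ^ 2 • x = 0 := by rw [← hfin]; module
  have hc2 : c - 1 = 0 := pow_eq_zero_iff two_ne_zero |>.mp ((smul_eq_zero_iff_left hx0).mp hc1)
  rw [← hc, sub_eq_zero.mp hc2, one_smul]

theorem exists_rot [CharZero F] [FiniteDimensional F L] [IsSimple F L] (fr : E6Frame F h e f) :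
    ∃ n : L ≃ₗ⁅F⁆ L, ∀ i, n (h i) = latticeMap h (E6.rot (Pi.single i 1)) := by
  have hr (i) := E6.rot_mem_roots _ (E6.single_mem_roots i)
  choose e' he' he0 using fun i ↦ fr.exists_ne_zero (hr i)
  obtain ⟨f', -, c⟩ := fr.exists_chevalleyRel hr
    (fun i j ↦ by rw [E6.form_rot, E6.form_single]) he' he0
  obtain ⟨n, hn, -⟩ := fr.exists_lieEquiv c
  exact ⟨n, hn⟩

end E6Frame

section

variable {F L : Type*} [Field F] [LieRing L] [LieAlgebra F L]

theorem _root_.IsLieGrading.sum_finrank [FiniteDimensional F L] {A : Type*} [AddCommGroup A]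
    [DecidableEq A] [Fintype A] {gr : A → Submodule F L} (hgr : IsLieGrading F gr) :
    ∑ a, finrank F (gr a) = finrank F L := by
  rw [← (LinearEquiv.ofBijective (DirectSum.coeLinearMap gr) hgr.1).finrank_eq,
    Module.finrank_directSum]

/-- The joint eigenspaces of a triple of automorphisms of order three. -/
def jointEigenspace (E : AddChar (ZMod 3) F) (X : Fin 3 → L ≃ₗ⁅F⁆ L) (a : Fin 3 → ZMod 3) :
    Submodule F L where
  carrier := {x | ∀ i, X i x = E (a i) • x}
  add_mem' hx hy i := by rw [map_add, hx, hy, smul_add]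
  zero_mem' i := by simp
  smul_mem' c x hx i := by rw [map_smul, hx, smul_comm]

variable {E : AddChar (ZMod 3) F} {X : Fin 3 → L ≃ₗ⁅F⁆ L}

theorem isLieGrading_jointEigenspace [CharZero F] (hE : Function.Injective E)
    (hX : ∀ i j x, X i (X j x) = X j (X i x)) (hX3 : ∀ i x, X i (X i (X i x)) = x) :
    IsLieGrading F (jointEigenspace E X) := by
  refine ⟨DirectSum.isInternal_submodule_of_iSupIndep_of_iSup_eq_top
    (iSupIndep_of_apply_eq_smul (f := fun i ↦ (X i).toLinearEquiv.toLinearMap) hX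
      (χ := fun (a : Fin 3 → ZMod 3) i ↦ E (a i))
      (fun a b hab ↦ funext fun i ↦ hE (congrFun hab i)) fun a x hx i ↦ hx i) ?_,
      fun a b x hx y hy i ↦ ?_⟩
  · refine top_le_iff.mp fun x _ ↦ ?_
    let t (i) : L →ₗ[F] L := (X i).toLinearEquiv.toLinearMap
    have ht (i j) : ∀ x, t i (t j x) = t j (t i x) := hX i j
    have ht3 (i) : ∀ x, t i (t i (t i x)) = x := hX3 i
    have hx : ∑ i, ∑ j, ∑ k, eigenProj E i (t 0) (eigenProj E j (t 1) (eigenProj E k (t 2) x)) =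
        x := by
      simp only [← map_sum, sum_eigenProj hE]
    rw [← hx]
    refine sum_mem fun i _ ↦ sum_mem fun j _ ↦ sum_mem fun k _ ↦
      Submodule.mem_iSup_of_mem ![i, j, k] fun l ↦ ?_
    change t l _ = _
    fin_cases l
    · exact apply_eigenProj (ht3 0) _ _
    · change t 1 _ = E j • _
      rw [map_eigenProj (ht 1 0), apply_eigenProj (ht3 1), map_smul]
    · change t 2 _ = E k • _
      rw [map_eigenProj (ht 2 0), map_eigenProj (ht 2 1), apply_eigenProj (ht3 2), map_smul,
        map_smul]
  · rw [LieEquiv.map_lie, hx, hy, smul_lie, lie_smul, smul_smul, Pi.add_apply,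
      AddChar.map_add_eq_mul]

end

namespace E6Frame

variable {F L : Type*} [Field F] [CharZero F] [LieRing L] [LieAlgebra F L] {h e f : Fin 6 → L}

theorem jointEigenspace_le (fr : E6Frame F h e f) {E : AddChar (ZMod 3) F}
    (hE : Function.Injective E) {n : L ≃ₗ⁅F⁆ L} {t : Fin 2 → L ≃ₗ⁅F⁆ L}
    {D : (Fin 6 → ℤ) → Fin 2 → ZMod 3}
    (ht : ∀ k v, ∀ x ∈ wt F h v, t k x = E (D v k) • x) (a : Fin 3 → ZMod 3)
    {S : Submodule F L} (hS : ∀ v, D v = Fin.tail a → ∀ x ∈ wt F h v,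
      eigenProj E (a 0) n.toLinearEquiv.toLinearMap x ∈ S) :
    jointEigenspace E (Fin.cons n t) a ≤ S := by
  intro x hx
  have h1 : x ∈ ⨆ v, ⨆ (_ : D v = Fin.tail a), wt F h v :=
    mem_iSup_of_apply_eq_smul hE fr.iSup_wt (t := fun k ↦ (t k).toLinearEquiv.toLinearMap)
      (fun v y hy k ↦ ht k v y hy) (fun k ↦ hx k.succ)
  have h2 : ⨆ v, ⨆ (_ : D v = Fin.tail a), wt F h v ≤
      S.comap (eigenProj E (a 0) n.toLinearEquiv.toLinearMap) :=
    iSup₂_le fun v hv y hy ↦ hS v hv y hy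
  have h3 : n.toLinearEquiv.toLinearMap x = E (a 0) • x := hx 0
  have h4 := h2 h1
  rwa [Submodule.mem_comap, eigenProj_of_eq_smul hE h3, if_pos rfl] at h4

omit [CharZero F] in
theorem eigenProj_apply_self {E : AddChar (ZMod 3) F} {n : L ≃ₗ⁅F⁆ L}
    (hn3 : ∀ x, n (n (n x)) = x) (i : ZMod 3) (x : L) :
    eigenProj E i n.toLinearEquiv.toLinearMap (n x) =
      E i • eigenProj E i n.toLinearEquiv.toLinearMap x := by
  rw [← apply_eigenProj (t := n.toLinearEquiv.toLinearMap) hn3 i x]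
  exact (map_eigenProj (s := n.toLinearEquiv.toLinearMap) (fun _ ↦ rfl) i x).symm

theorem finrank_jointEigenspace_le [FiniteDimensional F L] (fr : E6Frame F h e f)
    {E : AddChar (ZMod 3) F} (hE : Function.Injective E) {n : L ≃ₗ⁅F⁆ L}
    {w : (Fin 6 → ℤ) → Fin 6 → ℤ} (hnw : ∀ v, ∀ x ∈ wt F h v, n x ∈ wt F h (w v))
    (hn3 : ∀ x, n (n (n x)) = x) {t : Fin 2 → L ≃ₗ⁅F⁆ L} {D : (Fin 6 → ℤ) → Fin 2 → ZMod 3}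
    (ht : ∀ k v, ∀ x ∈ wt F h v, t k x = E (D v k) • x) (a : Fin 3 → ZMod 3) {m : ℕ}
    {r : Fin m → Fin 6 → ℤ} (hr : ∀ i, r i ∈ E6.roots) (hD0 : D 0 ≠ Fin.tail a)
    (hr' : ∀ v ∈ E6.roots, D v = Fin.tail a → ∃ i, v = r i ∨ v = w (r i) ∨ v = w (w (r i))) :
    finrank F (jointEigenspace E (Fin.cons n t) a) ≤ m := by
  choose x hx hx0 using fun i ↦ fr.exists_ne_zero (hr i)
  let y (i : Fin m) := eigenProj E (a 0) n.toLinearEquiv.toLinearMap (x i)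
  have hS (i) : y i ∈ Submodule.span F (Set.range y) := Submodule.subset_span ⟨i, rfl⟩
  have hn0 {x : L} (hx : x ≠ 0) : n x ≠ 0 := fun h0 ↦ hx (n.toLinearEquiv.map_eq_zero_iff.mp h0)
  refine (Submodule.finrank_mono (fr.jointEigenspace_le hE ht a
    (S := Submodule.span F (Set.range y)) fun v hv z hz ↦ ?_)).trans
    ((finrank_range_le_card y).trans_eq (Fintype.card_fin m))
  rcases eq_or_ne z 0 with rfl | hz0
  · rw [map_zero]
    exact zero_mem _
  have hvr : v ∈ E6.roots := fr.mem_roots v (by rintro rfl; exact hD0 hv)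
    ((Submodule.ne_bot_iff _).mpr ⟨z, hz, hz0⟩)
  obtain ⟨i, rfl | rfl | rfl⟩ := hr' v hvr hv
  · obtain ⟨c, rfl⟩ := fr.exists_smul_eq hvr (hx i) (hx0 i) hz
    rw [map_smul]
    exact Submodule.smul_mem _ _ (hS i)
  · obtain ⟨c, rfl⟩ := fr.exists_smul_eq hvr (hnw _ _ (hx i)) (hn0 (hx0 i)) hz
    rw [map_smul, eigenProj_apply_self hn3]
    exact Submodule.smul_mem _ _ (Submodule.smul_mem _ _ (hS i))
  · obtain ⟨c, rfl⟩ := fr.exists_smul_eq hvr (hnw _ _ (hnw _ _ (hx i))) (hn0 (hn0 (hx0 i))) hz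
    rw [map_smul, eigenProj_apply_self hn3, eigenProj_apply_self hn3]
    exact Submodule.smul_mem _ _ (Submodule.smul_mem _ _ (Submodule.smul_mem _ _ (hS i)))

theorem exists_isLieGrading [IsAlgClosed F] [FiniteDimensional F L] [IsSimple F L]
    (fr : E6Frame F h e f) (hdim : finrank F L = 78) :
    ∃ gr : (Fin 3 → ZMod 3) → Submodule F L, IsLieGrading F gr ∧
      ∀ a : Fin 3 → ZMod 3, a ≠ 0 → finrank F (gr a) = 3 := by
  obtain ⟨E, hE⟩ := exists_addChar_injective F
  obtain ⟨n, hn⟩ := fr.exists_rot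
  choose t ht using fun k : Fin 2 ↦ fr.exists_toral
    (E.compAddMonoidHom ((Pi.evalAddMonoidHom (fun _ ↦ ZMod 3) k).comp E6.grad))
  replace ht : ∀ k v, ∀ x ∈ wt F h v, t k x = E (E6.grad v k) • x := ht
  have hrot3 (v) : E6.rot (E6.rot (E6.rot v)) = v := by
    rw [E6.rot_rot v, map_sub, map_neg, E6.rot_rot]; abel
  have hn3 := fr.apply_apply_apply E6.form_rot E6.rot_rot E6.rot_mem_roots hn
  have hnw {v x} (hx : x ∈ wt F h v) : n x ∈ wt F h (E6.rot v) :=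
    apply_mem_wt E6.form_rot (fun v ↦ ⟨_, hrot3 v⟩) hn hx
  have hnl (v) : n (latticeMap h v) = latticeMap h (E6.rot v) := by
    rw [map_latticeMap n hn, latticeMap_comp]
  have hnt (k x) : n (t k x) = t k (n x) := by
    have : n.toLinearEquiv.toLinearMap ∘ₗ (t k).toLinearEquiv.toLinearMap =
        (t k).toLinearEquiv.toLinearMap ∘ₗ n.toLinearEquiv.toLinearMap :=
      LinearMap.ext_of_iSup_eq_top fr.iSup_wt fun v x hx ↦ by
        change n (t k x) = t k (n x)
        rw [ht k v x hx, map_smul, ht k _ _ (hnw hx), E6.grad_rot]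
    exact LinearMap.congr_fun this x
  have htt (j k x) : t j (t k x) = t k (t j x) := by
    have : (t j).toLinearEquiv.toLinearMap ∘ₗ (t k).toLinearEquiv.toLinearMap =
        (t k).toLinearEquiv.toLinearMap ∘ₗ (t j).toLinearEquiv.toLinearMap :=
      LinearMap.ext_of_iSup_eq_top fr.iSup_wt fun v x hx ↦ by
        change t j (t k x) = t k (t j x)
        rw [ht k v x hx, ht j v x hx, map_smul, map_smul, ht k v x hx, ht j v x hx, smul_comm]
    exact LinearMap.congr_fun this x
  have ht3 (k x) : t k (t k (t k x)) = x := by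
    have : (t k).toLinearEquiv.toLinearMap ∘ₗ (t k).toLinearEquiv.toLinearMap ∘ₗ
        (t k).toLinearEquiv.toLinearMap = LinearMap.id :=
      LinearMap.ext_of_iSup_eq_top fr.iSup_wt fun v x hx ↦ by
        change t k (t k (t k x)) = x
        rw [ht k v x hx, map_smul, map_smul, ht k v x hx, map_smul, ht k v x hx, smul_smul,
          smul_smul, ← pow_three', AddChar.zmod_three_pow, one_smul]
    exact LinearMap.congr_fun this x
  have hgr : IsLieGrading F (jointEigenspace E (Fin.cons n t)) := by
    refine isLieGrading_jointEigenspace hE (fun i j x ↦ ?_) (fun i x ↦ ?_)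
    · refine Fin.cases ?_ (fun k ↦ ?_) i <;> refine Fin.cases ?_ (fun l ↦ ?_) j
      exacts [rfl, hnt l x, (hnt k x).symm, htt k l x]
    · refine Fin.cases ?_ (fun k ↦ ?_) i
      exacts [hn3 x, ht3 k x]
  refine ⟨_, hgr, ?_⟩
  have hπ (i x) := eigenProj_apply_self (E := E) (n := n) hn3 i x
  have hle (a : Fin 3 → ZMod 3) : finrank F (jointEigenspace E (Fin.cons n t) a) ≤ 3 := by
    by_cases hb : Fin.tail a = 0
    · let π := eigenProj E (a 0) n.toLinearEquiv.toLinearMap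
      let S := Submodule.span F (Set.range ![π (h 0), π (h 2), π (h 4)])
      refine (Submodule.finrank_mono (fr.jointEigenspace_le hE ht a (S := S)
        fun v hv x hx ↦ ?_)).trans (finrank_range_le_card _)
      rw [hb] at hv
      change π x ∈ S
      rcases eq_or_ne v 0 with rfl | hv0
      · rw [fr.wt_zero] at hx
        refine (Submodule.span_le.mpr ?_ : _ ≤ S.comap π) hx
        rintro _ ⟨i, rfl⟩
        change π (h i) ∈ S
        have h0 : π (h 0) ∈ S := Submodule.subset_span ⟨0, rfl⟩
        have h2 : π (h 2) ∈ S := Submodule.subset_span ⟨1, rfl⟩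
        have h4 : π (h 4) ∈ S := Submodule.subset_span ⟨2, rfl⟩
        have h1 : π (h 1) ∈ S := by
          rw [← latticeMap_single h 1, show (Pi.single 1 1 : Fin 6 → ℤ) = E6.rot (Pi.single 0 1) by
            decide +kernel, ← hn, hπ]
          exact S.smul_mem _ h0
        have h3 : π (h 3) ∈ S := by
          rw [← latticeMap_single h 3, show (Pi.single 3 1 : Fin 6 → ℤ) = E6.rot (Pi.single 4 1) by
            decide +kernel, ← hn, hπ]
          exact S.smul_mem _ h4
        have h5 : π (h 5) ∈ S := by
          rw [← latticeMap_single h 5, show (Pi.single 5 1 : Fin 6 → ℤ) = -Pi.single 1 1 -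
            Pi.single 3 1 - Pi.single 2 1 - Pi.single 2 1 - E6.rot (Pi.single 2 1) by
            decide +kernel]
          simp only [map_sub, map_neg, latticeMap_single, ← hn]
          rw [hπ]
          exact S.sub_mem (S.sub_mem (S.sub_mem (S.sub_mem (S.neg_mem h1) h3) h2) h2)
            (S.smul_mem _ h2)
        fin_cases i
        exacts [h0, h1, h2, h3, h4, h5]
      · have hv' : v ∉ E6.roots := fun h1 ↦ E6.grad_ne_zero v h1 hv
        rw [fr.wt_eq_bot hv0 hv'] at hx
        rw [(Submodule.mem_bot F).mp hx, map_zero]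
        exact zero_mem _
    · obtain ⟨r, hr, hr'⟩ := E6.exists_orbits _ hb
      exact fr.finrank_jointEigenspace_le hE (fun v x ↦ hnw) hn3 ht a hr
        (by rw [map_zero]; exact Ne.symm hb) hr'
  have h0 : jointEigenspace E (Fin.cons n t) 0 = ⊥ := by
    refine le_bot_iff.mp (fr.jointEigenspace_le hE ht 0 fun v hv x hx ↦ ?_)
    rcases eq_or_ne v 0 with rfl | hv0
    · rw [fr.wt_zero] at hx
      refine (Submodule.span_le.mpr ?_ : _ ≤ (⊥ : Submodule F L).comap _) hx
      rintro _ ⟨i, rfl⟩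
      change eigenProj E 0 n.toLinearEquiv.toLinearMap (h i) = 0
      rw [← latticeMap_single h i, eigenProj_apply]
      change _ • (latticeMap h _ + _ • n (latticeMap h _) + _ • n (n (latticeMap h _))) = _
      rw [hnl, hnl, E6.rot_rot, neg_zero, AddChar.map_zero_eq_one, map_sub, map_neg]
      module
    · have hv' : v ∉ E6.roots := fun h1 ↦ E6.grad_ne_zero v h1 hv
      rw [fr.wt_eq_bot hv0 hv'] at hx
      rw [(Submodule.mem_bot F).mp hx, map_zero]
      exact zero_mem _
  intro a ha
  have hle' (a : Fin 3 → ZMod 3) (_ : a ∈ Finset.univ) :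
      finrank F (jointEigenspace E (Fin.cons n t) a) ≤ if a = 0 then 0 else 3 := by
    split_ifs with ha
    · rw [ha, h0, finrank_bot]
    · exact hle a
  have := (Finset.sum_eq_sum_iff_of_le hle').mp
    (by rw [hgr.sum_finrank, hdim]; decide +kernel) a (Finset.mem_univ a)
  rwa [if_neg ha] at this

end E6Frame

end LieAlgebra

namespace LieAlgebra

section

attribute [local instance] LieRing.ofAssociativeRing

variable {F L : Type*} [Field F] [CharZero F] [LieRing L] [LieAlgebra F L]
  [FiniteDimensional F L] [IsSimple F L]

theorem eq_zero_of_forall_lie_eq_zero (F : Type*) {L : Type*} [Field F] [CharZero F] [LieRing L]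
    [LieAlgebra F L] [FiniteDimensional F L] [IsSimple F L] {x : L}
    (hx : ∀ y : L, ⁅x, y⁆ = 0) : x = 0 := by
  have h1 : ad F L x = 0 := LinearMap.ext hx
  have h2 : x ∈ (ad F L).ker := LieHom.mem_ker.mpr h1
  rwa [ad_ker_eq_bot_of_hasTrivialRadical, LieSubmodule.mem_bot] at h2

/-- A weak form of the abstract Jordan decomposition: the nilpotent part of an element. -/
theorem exists_isNilpotent_ad (x : L) : ∃ z : L, IsNilpotent (ad F L z) ∧
    (∀ φ : L ≃ₗ⁅F⁆ L, φ x = x → φ z = z) ∧ (z = 0 → (ad F L x).IsSemisimple) := by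
  obtain ⟨n, hn, s, hs, hnil, hss, hsum⟩ := (ad F L x).exists_isNilpotent_isSemisimple
  have hinj : Function.Injective (ad F L) := by
    rw [← LieHom.ker_eq_bot]
    exact ad_ker_eq_bot_of_hasTrivialRadical F L
  have hcomm : Commute n s := Algebra.commute_of_mem_adjoin_singleton_of_commute hs
    (Algebra.commute_of_mem_adjoin_self hn).symm
  have hadn := ad_mem_adjoin_of_isNilpotent hcomm hnil hss
  rw [← hsum] at hadn
  have hmaps (y : L) : ∃ y' : L, ad F L y' = ⁅n, ad F L y⁆ := by
    suffices ∀ g ∈ Algebra.adjoin F {ad F (Module.End F L) (ad F L x)}, ∀ y : L,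
        ∃ y' : L, ad F L y' = g (ad F L y) from this _ hadn y
    intro g hg
    induction hg using Algebra.adjoin_induction with
    | mem g hg =>
      rw [Set.mem_singleton_iff] at hg
      exact fun y ↦ ⟨⁅x, y⁆, by rw [hg, LieHom.map_lie, ad_apply]⟩
    | algebraMap r => exact fun y ↦ ⟨r • y, by rw [map_smul, Module.algebraMap_end_apply]⟩
    | add g g' _ _ h1 h2 =>
      intro y
      obtain ⟨y1, h1⟩ := h1 y
      obtain ⟨y2, h2⟩ := h2 y
      exact ⟨y1 + y2, by rw [map_add, h1, h2, LinearMap.add_apply]⟩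
    | mul g g' _ _ h1 h2 =>
      intro y
      obtain ⟨y2, h2⟩ := h2 y
      obtain ⟨y1, h1⟩ := h1 y2
      exact ⟨y1, by rw [h1, h2, Module.End.mul_apply]⟩
  choose d hd using hmaps
  let D : LieDerivation F L L :=
    { toFun := d
      map_add' y y' := hinj <| by rw [map_add, hd, hd, hd, map_add, lie_add]
      map_smul' c y := hinj <| by
        rw [RingHom.id_apply, map_smul, hd, hd, map_smul, LieRing.of_associative_ring_bracket,
          LieRing.of_associative_ring_bracket, mul_smul_comm, smul_mul_assoc, smul_sub]
      leibniz' y y' := hinj <| by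
        change ad F L (d _) = ad F L (⁅_, d _⁆ - ⁅_, d _⁆)
        rw [hd, map_sub, LieHom.map_lie, LieHom.map_lie, LieHom.map_lie, hd, hd, leibniz_lie,
          ← lie_skew (ad F L y'), sub_eq_add_neg, neg_neg, add_comm] }
  obtain ⟨z, hz⟩ := LieDerivation.IsKilling.exists_eq_ad D
  have hzd (y : L) : ⁅z, y⁆ = d y := by
    have h1 : LieDerivation.ad F L z y = D y := by rw [hz]
    rwa [LieDerivation.ad_apply_apply] at h1
  refine ⟨z, ?_, fun φ hφ ↦ ?_, ?_⟩
  · obtain ⟨k, hk⟩ := ad_nilpotent_of_nilpotent (R := F) hnil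
    refine ⟨k, LinearMap.ext fun y ↦ hinj ?_⟩
    suffices ∀ k (y : L), ad F L ((ad F L z ^ k) y) = (ad F (Module.End F L) n ^ k) (ad F L y) by
      rw [this, hk]
      simp
    intro k
    induction k with
    | zero => simp
    | succ k ih =>
      intro y
      rw [pow_succ, Module.End.mul_apply, ih, ad_apply, hzd, hd, pow_succ, Module.End.mul_apply,
        ad_apply]
  · have h1 : Commute φ.toLinearEquiv.toLinearMap (ad F L x) := LinearMap.ext fun y ↦ by
      change φ ⁅x, y⁆ = ⁅x, φ y⁆
      rw [LieEquiv.map_lie, hφ]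
    have h2 : Commute φ.toLinearEquiv.toLinearMap n :=
      Algebra.commute_of_mem_adjoin_singleton_of_commute hn h1
    have h3 (y) : φ (n y) = n (φ y) := LinearMap.congr_fun h2.eq y
    have h4 (y) : φ (d y) = d (φ y) := hinj <| LinearMap.ext fun w ↦ by
      have h5 : φ (ad F L (d y) (φ.symm w)) = φ (⁅n, ad F L y⁆ (φ.symm w)) := by rw [hd]
      rw [hd]
      simpa only [ad_apply, LieEquiv.map_lie, LieEquiv.apply_symm_apply, map_sub, h3,
        LieRing.of_associative_ring_bracket, LinearMap.sub_apply, Module.End.mul_apply] using h5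
    rw [← sub_eq_zero]
    refine eq_zero_of_forall_lie_eq_zero F fun y ↦ ?_
    have h5 := h4 (φ.symm y)
    rw [← hzd, ← hzd, LieEquiv.map_lie, LieEquiv.apply_symm_apply] at h5
    rw [sub_lie, h5, sub_self]
  · rintro rfl
    have h1 (y w : L) : n ⁅y, w⁆ = ⁅y, n w⁆ := by
      have h2 := hd y
      rw [← hzd, zero_lie, map_zero] at h2
      have h3 := LinearMap.congr_fun h2 w
      exact (sub_eq_zero.mp h3.symm)
    let I : LieIdeal F L :=
      { LinearMap.ker n with
        lie_mem := fun {y w} (hw : n w = 0) ↦ show n ⁅y, w⁆ = 0 by rw [h1, hw, lie_zero] }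
    rcases IsSimple.eq_bot_or_eq_top I with hI | hI
    · have hker : LinearMap.ker n = ⊥ := congrArg LieSubmodule.toSubmodule hI
      obtain ⟨k, hk⟩ := hnil
      have hinj' : Function.Injective (n ^ k) := by
        rw [Module.End.coe_pow]
        exact (LinearMap.ker_eq_bot.mp hker).iterate k
      exfalso
      have : Nontrivial L := by
        by_contra h0
        rw [not_nontrivial_iff_subsingleton] at h0
        exact IsSimple.non_abelian F (L := L) ⟨fun _ _ ↦ Subsingleton.elim _ _⟩
      obtain ⟨y, hy⟩ := exists_ne (0 : L)
      exact hy (hinj' (by rw [hk]; simp))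
    · have hn0 : n = 0 := LinearMap.ext fun y ↦ by
        have : y ∈ I := hI ▸ LieSubmodule.mem_top y
        exact this
      rw [hsum, hn0, zero_add]
      exact hss

end

end LieAlgebra

namespace LieAlgebra

section

variable {F L : Type*} [Field F] [LieRing L] [LieAlgebra F L]

/-- A toral subalgebra is contained in a Cartan subalgebra. -/
theorem exists_isCartanSubalgebra_le [CharZero F] [FiniteDimensional F L] {N : LieSubalgebra F L}
    (hN : ∀ x ∈ N, ∀ y ∈ N, ⁅x, y⁆ = 0) (hss : ∀ x ∈ N, (ad F L x).IsSemisimple) :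
    ∃ H : LieSubalgebra F L, H.IsCartanSubalgebra ∧ N ≤ H := by
  have hss' (x) (hx : x ∈ N) (y : L) (hy : ⁅x, ⁅x, y⁆⁆ = 0) : ⁅x, y⁆ = 0 := by
    have h1 : y ∈ (ad F L x).maxGenEigenspace 0 := by
      rw [Module.End.mem_maxGenEigenspace]
      exact ⟨2, by simpa [pow_two] using hy⟩
    rw [(hss x hx).isFinitelySemisimple.maxGenEigenspace_eq_eigenspace,
      Module.End.mem_eigenspace_iff, zero_smul] at h1
    exact h1
  let C : LieSubalgebra F L :=
    { carrier := {c | ∀ x ∈ N, ⁅x, c⁆ = 0}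
      add_mem' := fun ha hb x hx ↦ by rw [lie_add, ha x hx, hb x hx, add_zero]
      zero_mem' := fun x _ ↦ lie_zero x
      smul_mem' := fun c _ ha x hx ↦ by rw [lie_smul, ha x hx, smul_zero]
      lie_mem' := fun ha hb x hx ↦ by
        rw [leibniz_lie, ha x hx, hb x hx, zero_lie, lie_zero, add_zero] }
  obtain ⟨y, hy⟩ := exists_isCartanSubalgebra_engel F C
  set H₀ := LieSubalgebra.engel F y
  have hNH (x) (hx : x ∈ N) (hxC : x ∈ C) : (⟨x, hxC⟩ : C) ∈ H₀ := by
    rw [← hy.self_normalizing, LieSubalgebra.mem_normalizer_iff]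
    intro z hz
    have : ⁅(⟨x, hxC⟩ : C), z⁆ = 0 := Subtype.ext (z.2 x hx)
    rw [this]
    exact H₀.zero_mem
  have hNC (x) (hx : x ∈ N) : x ∈ C := fun z hz ↦ hN z hz x hx
  have hmem (z : L) : z ∈ H₀.map C.incl ↔ ∃ hz : z ∈ C, (⟨z, hz⟩ : C) ∈ H₀ := by
    rw [LieSubalgebra.mem_map]
    exact ⟨by rintro ⟨z, hz, rfl⟩; exact ⟨z.2, hz⟩, fun ⟨hz, hz'⟩ ↦ ⟨_, hz', rfl⟩⟩
  refine ⟨H₀.map C.incl, ⟨?_, le_antisymm (fun z hz ↦ ?_) (LieSubalgebra.le_normalizer _)⟩,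
    fun x hx ↦ (hmem x).mpr ⟨hNC x hx, hNH x hx _⟩⟩
  · have := hy.nilpotent
    let g : H₀ →ₗ⁅F⁆ H₀.map C.incl :=
      { toFun := fun z ↦ ⟨z.1.1, (hmem _).mpr ⟨z.1.2, z.2⟩⟩
        map_add' := fun _ _ ↦ rfl
        map_smul' := fun _ _ ↦ rfl
        map_lie' := rfl }
    refine Function.Surjective.lieAlgebra_isNilpotent (f := g) fun z ↦ ?_
    obtain ⟨hz, hz'⟩ := (hmem _).mp z.2
    exact ⟨⟨⟨z.1, hz⟩, hz'⟩, rfl⟩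
  · rw [LieSubalgebra.mem_normalizer_iff'] at hz
    have hzC : z ∈ C := fun x hx ↦ by
      refine hss' x hx z ?_
      obtain ⟨h1, -⟩ := (hmem _).mp (hz x ((hmem x).mpr ⟨hNC x hx, hNH x hx _⟩))
      exact h1 x hx
    refine (hmem z).mpr ⟨hzC, ?_⟩
    rw [← hy.self_normalizing, LieSubalgebra.mem_normalizer_iff']
    intro w hw
    obtain ⟨h1, h2⟩ := (hmem _).mp (hz w.1 ((hmem w.1).mpr ⟨w.2, hw⟩))
    exact h2

/-- The subalgebra of fixed points of a family of automorphisms. -/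
def fixedSubalgebra {ι : Type*} (t : ι → L ≃ₗ⁅F⁆ L) : LieSubalgebra F L where
  carrier := {x | ∀ k, t k x = x}
  add_mem' hx hy k := by rw [map_add, hx, hy]
  zero_mem' k := map_zero _
  smul_mem' c x hx k := by rw [map_smul, hx]
  lie_mem' hx hy k := by rw [LieEquiv.map_lie, hx, hy]

variable [CharZero F] {E : AddChar (ZMod 3) F} {n : L ≃ₗ⁅F⁆ L} {t : Fin 2 → L ≃ₗ⁅F⁆ L}

theorem killingForm_eigenProj_zero (s : L ≃ₗ⁅F⁆ L) {x : L} (hx : s x = x) (y : L) :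
    killingForm F L x (eigenProj E 0 s.toLinearEquiv.toLinearMap y) = killingForm F L x y := by
  have h1 (y) : killingForm F L x (s y) = killingForm F L x y := by
    conv_lhs => rw [← hx]
    exact killingForm_of_equiv_apply s x y
  rw [eigenProj_apply, neg_zero, AddChar.map_zero_eq_one, one_smul, one_smul]
  change killingForm F L x ((3 : F)⁻¹ • (y + s y + s (s y))) = _
  rw [map_smul, map_add, map_add, h1, h1, h1, smul_eq_mul]
  ring

theorem exists_add_of_mem_fixedSubalgebra (hE : Function.Injective E)
    (hnt : ∀ k x, n (t k x) = t k (n x)) (hn3 : ∀ x, n (n (n x)) = x)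
    (h0 : ∀ x ∈ fixedSubalgebra t, n x = x → x = 0) {x : L} (hx : x ∈ fixedSubalgebra t) :
    ∃ p ∈ fixedSubalgebra t, ∃ q ∈ fixedSubalgebra t, n p = E 1 • p ∧ n q = E 2 • q ∧
      x = p + q := by
  have hmem (i) : eigenProj E i n.toLinearEquiv.toLinearMap x ∈ fixedSubalgebra t := fun k ↦ by
    refine (map_eigenProj (s := (t k).toLinearEquiv.toLinearMap) (t := n.toLinearEquiv.toLinearMap)
      (fun y ↦ (hnt k y).symm) i x).trans ?_
    congr 1
    exact hx k
  have happ (i) : n (eigenProj E i n.toLinearEquiv.toLinearMap x) = _ :=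
    apply_eigenProj (t := n.toLinearEquiv.toLinearMap) hn3 i x
  refine ⟨_, hmem 1, _, hmem 2, happ 1, happ 2, ?_⟩
  have h1 := sum_eigenProj hE n.toLinearEquiv.toLinearMap x
  have h2 : eigenProj E 0 n.toLinearEquiv.toLinearMap x = 0 :=
    h0 _ (hmem 0) (by rw [happ, AddChar.map_zero_eq_one, one_smul])
  rw [show (Finset.univ : Finset (ZMod 3)) = {0, 1, 2} by decide] at h1
  rw [Finset.sum_insert (by decide), Finset.sum_pair (by decide), h2, zero_add] at h1
  exact h1.symm

theorem lie_lie_eq_zero_of_mem_fixedSubalgebra (hE : Function.Injective E)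
    (hnt : ∀ k x, n (t k x) = t k (n x)) (hn3 : ∀ x, n (n (n x)) = x)
    (h0 : ∀ x ∈ fixedSubalgebra t, n x = x → x = 0) {x y : L} (hx : x ∈ fixedSubalgebra t)
    (hy : y ∈ fixedSubalgebra t) : ⁅x, ⁅x, y⁆⁆ = 0 := by
  obtain ⟨p, hp, q, hq, hp', hq', rfl⟩ := exists_add_of_mem_fixedSubalgebra hE hnt hn3 h0 hx
  obtain ⟨r, hr, s, hs, hr', hs', rfl⟩ := exists_add_of_mem_fixedSubalgebra hE hnt hn3 h0 hy
  have hE12 : E 1 * E 2 = 1 := by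
    rw [← AddChar.map_add_eq_mul, show (1 + 2 : ZMod 3) = 0 by decide, AddChar.map_zero_eq_one]
  have key (a) (ha : a ∈ fixedSubalgebra t) (b) (hb : b ∈ fixedSubalgebra t) (ha' : n a = E 1 • a)
      (hb' : n b = E 2 • b) : ⁅a, b⁆ = 0 :=
    h0 _ ((fixedSubalgebra t).lie_mem ha hb)
      (by rw [LieEquiv.map_lie, ha', hb', smul_lie, lie_smul, smul_smul, hE12, one_smul])
  have key' (a) (ha : a ∈ fixedSubalgebra t) (b) (hb : b ∈ fixedSubalgebra t) (ha' : n a = E 1 • a)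
      (hb' : n b = E 2 • b) : ⁅b, a⁆ = 0 := by
    rw [← lie_skew, key a ha b hb ha' hb', neg_zero]
  have h11 (a) (b) (ha' : n a = E 1 • a) (hb' : n b = E 1 • b) : n ⁅a, b⁆ = E 2 • ⁅a, b⁆ := by
    rw [LieEquiv.map_lie, ha', hb', smul_lie, lie_smul, smul_smul, ← AddChar.map_add_eq_mul]
    rfl
  have h22 (a) (b) (ha' : n a = E 2 • a) (hb' : n b = E 2 • b) : n ⁅a, b⁆ = E 1 • ⁅a, b⁆ := by
    rw [LieEquiv.map_lie, ha', hb', smul_lie, lie_smul, smul_smul, ← AddChar.map_add_eq_mul]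
    rfl
  have hpr := (fixedSubalgebra t).lie_mem hp hr
  have hqs := (fixedSubalgebra t).lie_mem hq hs
  simp only [add_lie, lie_add, key p hp s hs hp' hs', key' r hr q hq hr' hq',
    key p hp _ hpr hp' (h11 p r hp' hr'), key' _ hqs q hq (h22 q s hq' hs') hq', add_zero, zero_add]
  rw [leibniz_lie q, key' p hp q hq hp' hq', key' r hr q hq hr' hq', leibniz_lie p,
    key p hp q hq hp' hq', key p hp s hs hp' hs']
  simp

variable [FiniteDimensional F L] [IsSimple F L]

theorem eq_zero_of_killingForm_fixedSubalgebra (E : AddChar (ZMod 3) F)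
    (htt : ∀ j k x, t j (t k x) = t k (t j x)) (ht3 : ∀ k x, t k (t k (t k x)) = x) {x : L}
    (hx : x ∈ fixedSubalgebra t) (h : ∀ y ∈ fixedSubalgebra t, killingForm F L x y = 0) :
    x = 0 := by
  refine (IsKilling.killingForm_nondegenerate F L).1 x fun y ↦ ?_
  let T (k) : L →ₗ[F] L := (t k).toLinearEquiv.toLinearMap
  rw [← killingForm_eigenProj_zero (E := E) (t 0) (hx 0),
    ← killingForm_eigenProj_zero (E := E) (t 1) (hx 1)]
  refine h _ fun k ↦ ?_
  change T k (eigenProj E 0 (T 1) (eigenProj E 0 (T 0) y)) = _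
  fin_cases k
  · change T 0 _ = _
    rw [map_eigenProj (s := T 0) (t := T 1) (htt 0 1), apply_eigenProj (t := T 0) (ht3 0),
      AddChar.map_zero_eq_one, one_smul]
  · change T 1 _ = _
    rw [apply_eigenProj (t := T 1) (ht3 1), AddChar.map_zero_eq_one, one_smul]

theorem lie_eq_zero_of_mem_fixedSubalgebra [IsAlgClosed F] (hE : Function.Injective E)
    (htt : ∀ j k x, t j (t k x) = t k (t j x)) (ht3 : ∀ k x, t k (t k (t k x)) = x)
    (hnt : ∀ k x, n (t k x) = t k (n x)) (hn3 : ∀ x, n (n (n x)) = x)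
    (h0 : ∀ x ∈ fixedSubalgebra t, n x = x → x = 0) {x y : L} (hx : x ∈ fixedSubalgebra t)
    (hy : y ∈ fixedSubalgebra t) : ⁅x, y⁆ = 0 := by
  have hnil : LieRing.IsNilpotent (fixedSubalgebra t) := by
    rw [isNilpotent_iff_forall (R := F)]
    refine fun z ↦ ⟨2, LinearMap.ext fun w ↦ Subtype.ext ?_⟩
    rw [pow_two]
    exact lie_lie_eq_zero_of_mem_fixedSubalgebra hE hnt hn3 h0 z.2 w.2
  have hab : IsLieAbelian (fixedSubalgebra t) := by
    refine LieModule.isLieAbelian_of_ker_traceForm_eq_bot F _ L ((LinearMap.ker_eq_bot').mpr ?_)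
    refine fun z hz ↦ Subtype.ext
      (eq_zero_of_killingForm_fixedSubalgebra E htt ht3 z.2 fun w hw ↦ ?_)
    exact LinearMap.congr_fun hz ⟨w, hw⟩
  exact congrArg Subtype.val (hab.trivial (⟨x, hx⟩ : fixedSubalgebra t) ⟨y, hy⟩)

theorem isSemisimple_ad_of_mem_fixedSubalgebra [IsAlgClosed F] (E : AddChar (ZMod 3) F)
    (htt : ∀ j k x, t j (t k x) = t k (t j x)) (ht3 : ∀ k x, t k (t k (t k x)) = x)
    (hab : ∀ x ∈ fixedSubalgebra t, ∀ y ∈ fixedSubalgebra t, ⁅x, y⁆ = 0) {x : L}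
    (hx : x ∈ fixedSubalgebra t) : (ad F L x).IsSemisimple := by
  obtain ⟨z, hz, hφ, hz0⟩ := exists_isNilpotent_ad (F := F) x
  have hzN : z ∈ fixedSubalgebra t := fun k ↦ hφ _ (hx k)
  refine hz0 (eq_zero_of_killingForm_fixedSubalgebra E htt ht3 hzN fun w hw ↦ ?_)
  have hcomm : Commute (ad F L z) (ad F L w) := LinearMap.ext fun y ↦ by
    change ⁅z, ⁅w, y⁆⁆ = ⁅w, ⁅z, y⁆⁆
    rw [leibniz_lie z w, hab z hzN w hw, zero_lie, zero_add]
  have := hcomm.isNilpotent_mul_right hz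
  rw [LieModule.traceForm_apply_apply]
  exact (LinearMap.isNilpotent_trace_of_isNilpotent this).eq_zero

end

end LieAlgebra

namespace LieAlgebra

section

variable {F L : Type*} [Field F] [CharZero F] [LieRing L] [LieAlgebra F L]
  [FiniteDimensional F L] {E : AddChar (ZMod 3) F} {X : Fin 3 → L ≃ₗ⁅F⁆ L}

/-- A grading by a group of exponent three is given by commuting automorphisms. -/
theorem _root_.IsLieGrading.exists_eq_jointEigenspace (hE : Function.Injective E)
    {gr : (Fin 3 → ZMod 3) → Submodule F L} (hgr : IsLieGrading F gr) :
    ∃ X : Fin 3 → L ≃ₗ⁅F⁆ L, (∀ i j x, X i (X j x) = X j (X i x)) ∧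
      (∀ i x, X i (X i (X i x)) = x) ∧ gr = jointEigenspace E X := by
  choose X hX using fun i : Fin 3 ↦ hgr.exists_lieEquiv
    (E.compAddMonoidHom (Pi.evalAddMonoidHom (fun _ ↦ ZMod 3) i))
  replace hX : ∀ i a, ∀ x ∈ gr a, X i x = E (a i) • x := hX
  have htop := hgr.1.submodule_iSup_eq_top
  have hcomm (i j x) : X i (X j x) = X j (X i x) := by
    have : (X i).toLinearEquiv.toLinearMap ∘ₗ (X j).toLinearEquiv.toLinearMap =
        (X j).toLinearEquiv.toLinearMap ∘ₗ (X i).toLinearEquiv.toLinearMap :=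
      LinearMap.ext_of_iSup_eq_top htop fun v x hx ↦ by
        change X i (X j x) = X j (X i x)
        rw [hX j v x hx, hX i v x hx, map_smul, map_smul, hX i v x hx, hX j v x hx, smul_comm]
    exact LinearMap.congr_fun this x
  have h3 (i x) : X i (X i (X i x)) = x := by
    have : (X i).toLinearEquiv.toLinearMap ∘ₗ (X i).toLinearEquiv.toLinearMap ∘ₗ
        (X i).toLinearEquiv.toLinearMap = LinearMap.id :=
      LinearMap.ext_of_iSup_eq_top htop fun v x hx ↦ by
        change X i (X i (X i x)) = x
        rw [hX i v x hx, map_smul, map_smul, hX i v x hx, map_smul, hX i v x hx, smul_smul,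
          smul_smul, ← pow_three', AddChar.zmod_three_pow, one_smul]
    exact LinearMap.congr_fun this x
  have hle (a) : gr a ≤ jointEigenspace E X a := fun x hx i ↦ hX i a x hx
  refine ⟨X, hcomm, h3, funext fun a ↦ Submodule.eq_of_le_of_finrank_eq (hle a) ?_⟩
  exact (Finset.sum_eq_sum_iff_of_le fun a _ ↦ Submodule.finrank_mono (hle a)).mp
    (by rw [hgr.sum_finrank, (isLieGrading_jointEigenspace hE hcomm h3).sum_finrank])
    a (Finset.mem_univ a)

theorem eq_zero_of_forall_apply_eq (hdim : finrank F L = 78) (hE : Function.Injective E)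
    (hX : ∀ i j x, X i (X j x) = X j (X i x)) (hX3 : ∀ i x, X i (X i (X i x)) = x)
    (hd : ∀ a ≠ 0, finrank F (jointEigenspace E X a) = 3) {x : L} (hx : ∀ i, X i x = x) :
    x = 0 := by
  have h1 := (isLieGrading_jointEigenspace hE hX hX3).sum_finrank
  rw [hdim, ← Finset.add_sum_erase _ _ (Finset.mem_univ 0), Finset.sum_congr rfl
    fun a ha ↦ hd a (Finset.ne_of_mem_erase ha), Finset.sum_const, Finset.card_erase_of_mem
    (Finset.mem_univ 0), Finset.card_univ, Fintype.card_fun, ZMod.card, Fintype.card_fin] at h1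
  have h2 : finrank F (jointEigenspace E X 0) = 0 := by simpa using h1
  rw [Submodule.finrank_eq_zero] at h2
  have h3 : x ∈ jointEigenspace E X 0 := fun i ↦ by
    rw [hx, Pi.zero_apply, AddChar.map_zero_eq_one, one_smul]
  rwa [h2, Submodule.mem_bot] at h3

theorem exists_E6Frame_span_eq [IsAlgClosed F] [IsSimple F L] (hdim : finrank F L = 78)
    (hso : IsEmpty (L ≃ₗ⁅F⁆ Orthogonal.so (Fin 13) F))
    (hsp : IsEmpty (L ≃ₗ⁅F⁆ Symplectic.sp (Fin 6) F)) (hE : Function.Injective E)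
    (hX : ∀ i j x, X i (X j x) = X j (X i x)) (hX3 : ∀ i x, X i (X i (X i x)) = x)
    (hd : ∀ a ≠ 0, finrank F (jointEigenspace E X a) = 3) :
    ∃ h e f, E6Frame F h e f ∧
      Submodule.span F (Set.range h) = (fixedSubalgebra (Fin.tail X)).toSubmodule := by
  have h0 : ∀ x ∈ fixedSubalgebra (Fin.tail X), X 0 x = x → x = 0 := fun x hx hx0 ↦
    eq_zero_of_forall_apply_eq hdim hE hX hX3 hd fun i ↦ Fin.cases hx0 hx i
  have hab : ∀ x ∈ fixedSubalgebra (Fin.tail X), ∀ y ∈ fixedSubalgebra (Fin.tail X), ⁅x, y⁆ = 0 :=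
    fun x hx y hy ↦ lie_eq_zero_of_mem_fixedSubalgebra hE (fun j k ↦ hX j.succ k.succ)
      (fun k ↦ hX3 k.succ) (fun k ↦ hX 0 k.succ) (hX3 0) h0 hx hy
  obtain ⟨H, hH, hle⟩ := exists_isCartanSubalgebra_le hab fun x hx ↦
    isSemisimple_ad_of_mem_fixedSubalgebra E (fun j k ↦ hX j.succ k.succ)
      (fun k ↦ hX3 k.succ) hab hx
  obtain ⟨h, e, f, fr, hspan⟩ := exists_E6Frame hdim hso hsp H
  refine ⟨h, e, f, fr, hspan.trans (Submodule.eq_of_le_of_finrank_le hle ?_).symm⟩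
  rw [← hspan, finrank_span_eq_card fr.linInd, Fintype.card_fin]
  have h1 (a : ZMod 3) (ha : a ≠ 0) : finrank F (jointEigenspace E X ![a, 0, 0]) = 3 :=
    hd _ fun h ↦ ha (congrFun h 0)
  have hmem (a : ZMod 3) (x : L) (hx : x ∈ fixedSubalgebra (Fin.tail X)) (hx0 : X 0 x = E a • x) :
      x ∈ jointEigenspace E X ![a, 0, 0] := fun i ↦ by
    refine Fin.cases hx0 (fun k ↦ ?_) i
    rw [show (![a, 0, 0] : Fin 3 → ZMod 3) k.succ = 0 by fin_cases k <;> rfl,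
      AddChar.map_zero_eq_one, one_smul]
    exact hx k
  have hmem' (a : ZMod 3) : jointEigenspace E X ![a, 0, 0] ≤
      (fixedSubalgebra (Fin.tail X)).toSubmodule := fun x hx k ↦ by
    have := hx k.succ
    rwa [show (![a, 0, 0] : Fin 3 → ZMod 3) k.succ = 0 by fin_cases k <;> rfl,
      AddChar.map_zero_eq_one, one_smul] at this
  have h2 := Submodule.finrank_sup_add_finrank_inf_eq (jointEigenspace E X ![1, 0, 0])
    (jointEigenspace E X ![2, 0, 0])
  have h3 : jointEigenspace E X ![1, 0, 0] ⊓ jointEigenspace E X ![2, 0, 0] = ⊥ :=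
    ((isLieGrading_jointEigenspace hE hX hX3).1.submodule_iSupIndep.pairwiseDisjoint
      (by decide)).eq_bot
  rw [h1 _ (by decide), h1 _ (by decide), h3, finrank_bot, add_zero] at h2
  exact h2.symm.trans_le (Submodule.finrank_mono (sup_le (hmem' 1) (hmem' 2)))

end

end LieAlgebra

namespace LieAlgebra

namespace E6

theorem form_self_pos {v : Fin 6 → ℤ} (hv : v ≠ 0) : 0 < form v v := by
  by_contra! h
  have h6 : 6 * form v v = 3 * (2 * v 0 - v 1) ^ 2 + (3 * v 1 - 2 * v 2) ^ 2 +
      3 * (2 * v 4 - v 3) ^ 2 + (3 * v 3 - 2 * v 2) ^ 2 + 3 * (2 * v 5 - v 2) ^ 2 + v 2 ^ 2 := by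
    simp only [form, LinearMap.mk₂_apply]
    ring
  have p1 := sq_nonneg (2 * v 0 - v 1)
  have p2 := sq_nonneg (3 * v 1 - 2 * v 2)
  have p3 := sq_nonneg (2 * v 4 - v 3)
  have p4 := sq_nonneg (3 * v 3 - 2 * v 2)
  have p5 := sq_nonneg (2 * v 5 - v 2)
  have p6 := sq_nonneg (v 2)
  have q1 := pow_eq_zero_iff two_ne_zero |>.mp (show (2 * v 0 - v 1) ^ 2 = 0 by omega)
  have q2 := pow_eq_zero_iff two_ne_zero |>.mp (show (3 * v 1 - 2 * v 2) ^ 2 = 0 by omega)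
  have q3 := pow_eq_zero_iff two_ne_zero |>.mp (show (2 * v 4 - v 3) ^ 2 = 0 by omega)
  have q4 := pow_eq_zero_iff two_ne_zero |>.mp (show (3 * v 3 - 2 * v 2) ^ 2 = 0 by omega)
  have q5 := pow_eq_zero_iff two_ne_zero |>.mp (show (2 * v 5 - v 2) ^ 2 = 0 by omega)
  have q6 := pow_eq_zero_iff two_ne_zero |>.mp (show v 2 ^ 2 = 0 by omega)
  refine hv (funext fun i ↦ ?_)
  fin_cases i <;> simp only [Fin.zero_eta, Fin.mk_one, Fin.reduceFinMk, Pi.zero_apply] <;> omega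

theorem form_le_one {u v : Fin 6 → ℤ} (hu : form u u = 2) (hv : form v v = 2) (huv : u ≠ v) :
    form u v ≤ 1 := by
  have h := form_self_pos (sub_ne_zero.mpr huv)
  simp only [map_sub, LinearMap.sub_apply] at h
  rw [form_comm v u] at h
  omega

section

variable {w : (Fin 6 → ℤ) →ₗ[ℤ] (Fin 6 → ℤ)} (hform : ∀ u v, form (w u) (w v) = form u v)
  (hw : ∀ v, w (w v) = -v - w v)
include hform hw

theorem form_apply_self (v : Fin 6 → ℤ) : 2 * form v (w v) = -form v v := by
  have h1 : form (w v) (w (w v)) = form v (w v) := hform _ _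
  rw [hw, map_sub, map_neg, form_comm, hform] at h1
  omega

/-- Three orthogonal hexagons of roots span a sublattice of index three. -/
theorem three_smul_eq {x : Fin 3 → Fin 6 → ℤ} (hx : ∀ i, form (x i) (x i) = 2)
    (horth : ∀ i j, i ≠ j → form (x i) (x j) = 0 ∧ form (x i) (w (x j)) = 0) (d : Fin 6 → ℤ) :
    (3 : ℤ) • d = ∑ i, ((2 * form d (x i) + form d (w (x i))) • x i +
      (form d (x i) + 2 * form d (w (x i))) • w (x i)) := by
  have hm1 (i) : form (x i) (w (x i)) = -1 := by
    have := form_apply_self hform hw (x i)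
    rw [hx] at this
    omega
  have hsum (a b : Fin 3 → ℤ) (j : Fin 3) :
      form (∑ i, (a i • x i + b i • w (x i))) (x j) = 2 * a j - b j := by
    rw [map_sum, LinearMap.sum_apply, Finset.sum_eq_single j]
    · simp only [map_add, map_smul, LinearMap.add_apply, LinearMap.smul_apply, smul_eq_mul, hx,
        form_comm (w _), hm1]
      ring
    · intro i _ hij
      simp only [map_add, map_smul, LinearMap.add_apply, LinearMap.smul_apply, smul_eq_mul,
        form_comm (w _), (horth i j hij).1, (horth j i hij.symm).2, mul_zero, add_zero]
    · simp
  have hsum' (a b : Fin 3 → ℤ) (j : Fin 3) :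
      form (∑ i, (a i • x i + b i • w (x i))) (w (x j)) = 2 * b j - a j := by
    rw [map_sum, LinearMap.sum_apply, Finset.sum_eq_single j]
    · simp only [map_add, map_smul, LinearMap.add_apply, LinearMap.smul_apply, smul_eq_mul, hx,
        hform, hm1]
      ring
    · intro i _ hij
      simp only [map_add, map_smul, LinearMap.add_apply, LinearMap.smul_apply, smul_eq_mul,
        hform, (horth i j hij).1, (horth i j hij).2, mul_zero, add_zero]
    · simp
  rw [← sub_eq_zero]
  set z := (3 : ℤ) • d - ∑ i, ((2 * form d (x i) + form d (w (x i))) • x i +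
      (form d (x i) + 2 * form d (w (x i))) • w (x i)) with hz
  have hzx (j) : form z (x j) = 0 := by
    rw [hz, map_sub, LinearMap.sub_apply, map_smul, LinearMap.smul_apply, hsum, smul_eq_mul]
    ring
  have hzw (j) : form z (w (x j)) = 0 := by
    rw [hz, map_sub, LinearMap.sub_apply, map_smul, LinearMap.smul_apply, hsum', smul_eq_mul]
    ring
  by_contra hz0
  have hli : LinearIndependent ℤ (Sum.elim (Sum.elim x fun i ↦ w (x i)) fun _ : Unit ↦ z) := by
    rw [Fintype.linearIndependent_iff]
    intro g hg
    simp only [Fintype.sum_sum_type, Sum.elim_inl, Sum.elim_inr, Finset.univ_unique,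
      Finset.sum_singleton, ← Finset.sum_add_distrib] at hg
    have h1 (j) := congrArg (fun y ↦ form y (x j)) hg
    have h2 (j) := congrArg (fun y ↦ form y (w (x j))) hg
    have h3 := congrArg (form z) hg
    simp only [map_add form, LinearMap.add_apply, hsum, map_smul, LinearMap.smul_apply, hzx,
      smul_zero, add_zero, map_zero, LinearMap.zero_apply] at h1
    simp only [map_add form, LinearMap.add_apply, hsum', map_smul, LinearMap.smul_apply, hzw,
      smul_zero, add_zero, map_zero, LinearMap.zero_apply] at h2
    simp only [map_add, map_sum, map_smul, hzx, hzw, map_zero, smul_eq_mul, mul_zero, add_zero,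
      Finset.sum_const_zero, zero_add, mul_eq_zero, (form_self_pos hz0).ne', or_false] at h3
    rintro ((j | j) | j)
    · have := h1 j; have := h2 j; omega
    · have := h1 j; have := h2 j; omega
    · exact h3
  have := hli.fintype_card_le_finrank
  simp at this

theorem sum_form_sq {x : Fin 3 → Fin 6 → ℤ} (hx : ∀ i, form (x i) (x i) = 2)
    (horth : ∀ i j, i ≠ j → form (x i) (x j) = 0 ∧ form (x i) (w (x j)) = 0) {d : Fin 6 → ℤ}
    (hd : form d d = 2) :
    ∑ i, (form d (x i) ^ 2 + form d (x i) * form d (w (x i)) + form d (w (x i)) ^ 2) = 3 := by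
  have h1 := congrArg (form d) (three_smul_eq hform hw hx horth d)
  simp only [map_smul, map_sum, map_add, smul_eq_mul, hd] at h1
  refine mul_left_cancel₀ (two_ne_zero (α := ℤ)) (Eq.trans ?_ h1.symm)
  rw [Finset.mul_sum]
  exact Finset.sum_congr rfl fun i _ ↦ by ring

/-- Orthogonality passes to hexagons. -/
theorem orthogonal_symm {u v : Fin 6 → ℤ} (h : form u v = 0 ∧ form u (w v) = 0) :
    form v u = 0 ∧ form v (w u) = 0 := by
  refine ⟨by rw [form_comm, h.1], ?_⟩
  rw [← hform, hw, form_comm, map_sub, LinearMap.sub_apply, map_neg, LinearMap.neg_apply, hform,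
    h.1, h.2]
  rfl

variable (hroots : ∀ v ∈ roots, w v ∈ roots) {D : (Fin 6 → ℤ) →ₗ[ℤ] (Fin 2 → ZMod 3)}
  (hD : ∀ v, D (w v) = D v)
include hroots hD

omit hform in
theorem form_sq_le_one {x d : Fin 6 → ℤ} (hx : x ∈ roots) (hd : form d d = 2) (hxd : D d ≠ D x)
    (hxd' : D d ≠ -D x) : form d x ^ 2 + form d x * form d (w x) + form d (w x) ^ 2 ≤ 1 := by
  have hb (y) (hy : y ∈ roots) (hyx : D y = D x) : form d y ≤ 1 ∧ -1 ≤ form d y := by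
    refine ⟨form_le_one hd (form_self_of_mem_roots _ hy) ?_, ?_⟩
    · rintro rfl
      exact hxd hyx
    · have := form_le_one hd (form_self_of_mem_roots _ (neg_mem_roots _ hy)) ?_
      · rw [map_neg] at this
        omega
      · rintro rfl
        exact hxd' (by rw [map_neg, hyx])
  have hwx := hroots _ hx
  obtain ⟨a1, b1⟩ := hb x hx rfl
  obtain ⟨a2, b2⟩ := hb _ hwx (hD x)
  obtain ⟨a3, b3⟩ := hb _ (hroots _ hwx) ((hD _).trans (hD x))
  rw [hw, map_sub, map_neg] at a3 b3
  generalize form d x = p at *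
  generalize form d (w x) = q at *
  interval_cases p <;> interval_cases q <;> omega

omit hform in
/-- A root in a given hexagon may be replaced by one in a standard position with respect to
another root. -/
theorem exists_adjusted {x d : Fin 6 → ℤ} (hx : x ∈ roots)
    (hsq : form d x ^ 2 + form d x * form d (w x) + form d (w x) ^ 2 = 1) :
    ∃ y ∈ roots, (D y = D x ∨ D y = -D x) ∧ form d y = 0 ∧ form d (w y) = -1 ∧
      ∀ u, form u x = 0 ∧ form u (w x) = 0 → form u y = 0 ∧ form u (w y) = 0 := by
  have hwx := hroots _ hx
  have hwwx := hroots _ hwx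
  have hw3 : w (w (w x)) = x := by rw [hw (w x), hw]; abel
  have hww (u) : form u (w (w x)) = -form u x - form u (w x) := by rw [hw, map_sub, map_neg]
  have hcases : (form d x = 0 ∧ form d (w x) = -1) ∨ (form d x = 0 ∧ form d (w x) = 1) ∨
      (form d x = 1 ∧ form d (w x) = 0) ∨ (form d x = -1 ∧ form d (w x) = 0) ∨
      (form d x = 1 ∧ form d (w x) = -1) ∨ (form d x = -1 ∧ form d (w x) = 1) := by
    generalize form d x = p at *
    generalize form d (w x) = q at *
    have h1 : p ≤ 1 := by nlinarith [sq_nonneg (p + 2 * q)]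
    have h2 : -1 ≤ p := by nlinarith [sq_nonneg (p + 2 * q)]
    have h3 : q ≤ 1 := by nlinarith [sq_nonneg (q + 2 * p)]
    have h4 : -1 ≤ q := by nlinarith [sq_nonneg (q + 2 * p)]
    interval_cases p <;> interval_cases q <;> omega
  have hDw : D (w x) = D x := hD x
  have hDww : D (w (w x)) = D x := (hD _).trans (hD x)
  rcases hcases with ⟨hp, hq⟩ | ⟨hp, hq⟩ | ⟨hp, hq⟩ | ⟨hp, hq⟩ | ⟨hp, hq⟩ | ⟨hp, hq⟩
  · exact ⟨x, hx, .inl rfl, hp, hq, fun u hu ↦ hu⟩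
  · refine ⟨-x, neg_mem_roots _ hx, .inr (map_neg _ _), ?_, ?_, fun u hu ↦ ?_⟩ <;>
      simp [*]
  · refine ⟨w x, hwx, .inl hDw, hq, ?_, fun u hu ↦ ?_⟩ <;> simp [*]
  · refine ⟨-w x, neg_mem_roots _ hwx, .inr (by rw [map_neg, hDw]), ?_, ?_, fun u hu ↦ ?_⟩ <;>
      simp [*]
  · refine ⟨-w (w x), neg_mem_roots _ hwwx, .inr (by rw [map_neg, hDww]), ?_, ?_, fun u hu ↦ ?_⟩ <;>
      simp [*]
  · refine ⟨w (w x), hwwx, .inl hDww, ?_, ?_, fun u hu ↦ ?_⟩ <;> simp [*]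

end

section

variable {w : (Fin 6 → ℤ) →ₗ[ℤ] (Fin 6 → ℤ)} (hform : ∀ u v, form (w u) (w v) = form u v)
  (hw : ∀ v, w (w v) = -v - w v) (hroots : ∀ v ∈ roots, w v ∈ roots)
  {D : (Fin 6 → ℤ) →ₗ[ℤ] (Fin 2 → ZMod 3)} (hD : ∀ v, D (w v) = D v)
  (hD0 : ∀ v ∈ roots, D v ≠ 0) (hadd : ∀ u ∈ roots, ∀ v ∈ roots, form u v = -1 → u + v ∈ roots)

include hD0 hadd in
theorem form_nonpos {u v : Fin 6 → ℤ} (hu : u ∈ roots) (hv : v ∈ roots) (huv : u ≠ v)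
    (hDuv : D u = D v) : form u v ≤ 0 := by
  have h1 := form_le_one (form_self_of_mem_roots _ hu) (form_self_of_mem_roots _ hv) huv
  by_contra! h2
  refine hD0 _ (hadd u hu (-v) (neg_mem_roots _ hv) ?_) ?_
  · rw [map_neg]
    omega
  · rw [map_add, map_neg, hDuv, add_neg_cancel]

include hw hroots hD hD0 hadd in
/-- Distinct hexagons of the same degree are orthogonal. -/
theorem orthogonal_of_ne {u v : Fin 6 → ℤ} (hu : u ∈ roots) (hv : v ∈ roots) (h0 : u ≠ v)
    (h1 : u ≠ w v) (h2 : u ≠ w (w v)) (hDuv : D u = D v) : form u v = 0 ∧ form u (w v) = 0 := by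
  have hv1 := hroots _ hv
  have p0 := form_nonpos hD0 hadd hu hv h0 hDuv
  have p1 := form_nonpos hD0 hadd hu hv1 h1 (hDuv.trans (hD v).symm)
  have p2 := form_nonpos hD0 hadd hu (hroots _ hv1) h2 (by rw [hD, hD, hDuv])
  rw [hw, map_sub, map_neg] at p2
  constructor <;> omega

include hform hw hroots hD hD0 hadd in
/-- An automorphism of order three of the root lattice without nonzero fixed points, together with
an invariant grading with sufficiently large components, has the standard form with respect to a
suitable basis. -/
theorem exists_adapted_basis (hex : ∀ c ≠ 0, ∀ r : Fin 2 → Fin 6 → ℤ, (∀ i, r i ∈ roots) →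
    ∃ v ∈ roots, D v = c ∧ ∀ i, v ≠ r i ∧ v ≠ w (r i) ∧ v ≠ w (w (r i))) :
    ∃ ρ : Fin 6 → Fin 6 → ℤ, (∀ i, ρ i ∈ roots) ∧
      (∀ i j, form (ρ i) (ρ j) = cartan DynkinDiagram.diagramE6 i j) ∧
      (∀ i, w (ρ i) = latticeMap ρ (rot (Pi.single i 1))) ∧
      ∃ ε : ZMod 3, ε ≠ 0 ∧
        ∀ i, D (ρ i) = ![ε * grad (Pi.single i 1) 0, grad (Pi.single i 1) 1] := by
  have hc : (![1, 0] : Fin 2 → ZMod 3) ≠ 0 := by decide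
  obtain ⟨x, hx, hDx, horth⟩ : ∃ x : Fin 3 → Fin 6 → ℤ, (∀ i, x i ∈ roots) ∧
      (∀ i, D (x i) = ![1, 0]) ∧
      ∀ i j, i ≠ j → form (x i) (x j) = 0 ∧ form (x i) (w (x j)) = 0 := by
    obtain ⟨x, hx, hDx, -⟩ := hex _ hc (fun _ ↦ Pi.single 0 1) fun _ ↦ single_mem_roots 0
    obtain ⟨y, hy, hDy, hyx⟩ := hex _ hc (fun _ ↦ x) fun _ ↦ hx
    obtain ⟨z, hz, hDz, hzr⟩ := hex _ hc ![x, y] (by intro i; fin_cases i; exacts [hx, hy])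
    have hxy := orthogonal_of_ne hw hroots hD hD0 hadd hy hx (hyx 0).1 (hyx 0).2.1 (hyx 0).2.2
      (hDy.trans hDx.symm)
    have hxz := orthogonal_of_ne hw hroots hD hD0 hadd hz hx (hzr 0).1 (hzr 0).2.1 (hzr 0).2.2
      (hDz.trans hDx.symm)
    have hyz := orthogonal_of_ne hw hroots hD hD0 hadd hz hy (hzr 1).1 (hzr 1).2.1 (hzr 1).2.2
      (hDz.trans hDy.symm)
    refine ⟨![x, y, z], ?_, ?_, ?_⟩
    · intro i; fin_cases i; exacts [hx, hy, hz]
    · intro i; fin_cases i; exacts [hDx, hDy, hDz]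
    · intro i j hij
      fin_cases i <;> fin_cases j <;> first | exact absurd rfl hij | skip
      exacts [orthogonal_symm hform hw hxy, orthogonal_symm hform hw hxz, hxy,
        orthogonal_symm hform hw hyz, hxz, hyz]
  obtain ⟨d, hd, hDd, -⟩ := hex ![0, 1] (by decide) (fun _ ↦ Pi.single 0 1)
    fun _ ↦ single_mem_roots 0
  have hd2 := form_self_of_mem_roots _ hd
  have hsum := sum_form_sq hform hw (fun i ↦ form_self_of_mem_roots _ (hx i)) horth hd2
  have hle (i) := form_sq_le_one hw hroots hD (hx i) hd2
    (by rw [hDd, hDx]; decide) (by rw [hDd, hDx]; decide)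
  have hsq (i) : form d (x i) ^ 2 + form d (x i) * form d (w (x i)) + form d (w (x i)) ^ 2 = 1 :=
    (Finset.sum_eq_sum_iff_of_le fun i _ ↦ hle i).mp (by rw [hsum]; rfl) i (Finset.mem_univ i)
  choose y hy hDy hdy hdwy hyu using fun i ↦ exists_adjusted hw hroots hD (hx i) (hsq i)
  have hy2 (i) := form_self_of_mem_roots _ (hy i)
  have horth' (i j) (hij : i ≠ j) : form (y i) (y j) = 0 ∧ form (y i) (w (y j)) = 0 :=
    hyu j _ (orthogonal_symm hform hw (hyu i _ (horth j i hij.symm)))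
  have h3 := three_smul_eq hform hw hy2 horth' d
  simp only [hdy, hdwy, Fin.sum_univ_three] at h3
  have hw3 := congrArg w h3
  simp only [map_smul, map_add, hw] at hw3
  have hwd : w d = -(2 : ℤ) • d - w (y 0) - w (y 1) - w (y 2) := by
    refine smul_right_injective _ (three_ne_zero (α := ℤ)) ?_
    linear_combination (exp := 1) hw3 + (2 : ℤ) • h3
  have hDs : D (y 0) + D (y 1) + D (y 2) = 0 := by
    have h := congrArg D hwd
    simp only [map_sub, map_smul, hD] at h
    have h0 : (3 : ℤ) • D d = 0 := by rw [hDd]; decide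
    linear_combination (exp := 1) h - h0
  simp only [hDx] at hDy
  obtain ⟨ε, hε, hDε⟩ : ∃ ε : ZMod 3, ε ≠ 0 ∧ ∀ i, D (y i) = ![ε, 0] := by
    rcases hDy 0 with h0 | h0 <;> rcases hDy 1 with h1 | h1 <;> rcases hDy 2 with h2 | h2 <;>
      rw [h0, h1, h2] at hDs <;> first | exact absurd hDs (by decide) | skip
    · exact ⟨1, by decide, by intro i; fin_cases i; exacts [h0, h1, h2]⟩
    · refine ⟨-1, by decide, ?_⟩
      have : (-![1, 0] : Fin 2 → ZMod 3) = ![-1, 0] := by decide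
      intro i; fin_cases i; exacts [h0.trans this, h1.trans this, h2.trans this]
  have hm1 (i) : form (y i) (w (y i)) = -1 := by
    have := form_apply_self hform hw (y i)
    rw [hy2] at this
    omega
  refine ⟨![y 0, w (y 0), d, w (y 1), y 1, w (y 2)], ?_, ?_, ?_, ε, hε, ?_⟩
  · intro i
    fin_cases i
    exacts [hy 0, hroots _ (hy 0), hd, hroots _ (hy 1), hy 1, hroots _ (hy 2)]
  · have hm1' (i) : form (w (y i)) (y i) = -1 := by rw [form_comm, hm1]
    have o1 (i j) (hij : i ≠ j) : form (y i) (y j) = 0 := (horth' i j hij).1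
    have o2 (i j) (hij : i ≠ j) : form (y i) (w (y j)) = 0 := (horth' i j hij).2
    have o3 (i j) (hij : i ≠ j) : form (w (y i)) (y j) = 0 := by
      rw [form_comm, o2 _ _ hij.symm]
    have hdy' (i) : form (y i) d = 0 := by rw [form_comm, hdy]
    have hdwy' (i) : form (w (y i)) d = -1 := by rw [form_comm, hdwy]
    intro i j
    fin_cases i <;> fin_cases j <;>
      simp [hform, hm1, hm1', o1, o2, o3, hdy, hdy', hdwy, hdwy', hd2, hy2] <;> decide +kernel
  · have hs (v : Fin 6 → ℤ) (g : Fin 6 → Fin 6 → ℤ) : latticeMap g v = v 0 • g 0 + v 1 • g 1 +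
        v 2 • g 2 + v 3 • g 3 + v 4 • g 4 + v 5 • g 5 := by
      rw [latticeMap_apply, Fin.sum_univ_six]
    have r0 : rot (Pi.single 0 1) = ![0, 1, 0, 0, 0, 0] := by decide +kernel
    have r1 : rot (Pi.single 1 1) = ![-1, -1, 0, 0, 0, 0] := by decide +kernel
    have r2 : rot (Pi.single 2 1) = ![0, -1, -2, -1, 0, -1] := by decide +kernel
    have r3 : rot (Pi.single 3 1) = ![0, 0, 0, -1, -1, 0] := by decide +kernel
    have r4 : rot (Pi.single 4 1) = ![0, 0, 0, 1, 0, 0] := by decide +kernel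
    have r5 : rot (Pi.single 5 1) = ![1, 2, 3, 2, 1, 1] := by decide +kernel
    intro i
    fin_cases i
    · simp [hs, r0]
    · simp [hs, r1, hw, sub_eq_add_neg]
    · simp [hs, r2, hwd, sub_eq_add_neg]
      abel
    · simp [hs, r3, hw, sub_eq_add_neg, add_comm]
    · simp [hs, r4]
    · simp only [hs, r5, Fin.reduceFinMk, Matrix.cons_val, hw]
      linear_combination (exp := 1) -h3
  · intro i
    fin_cases i <;> simp [hD, hDε, hDd, grad]

end

end E6

end LieAlgebra

theorem AddChar.ext_single {F : Type*} [Field F] {χ ψ : AddChar (Fin 6 → ℤ) F}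
    (h : ∀ i, χ (Pi.single i 1) = ψ (Pi.single i 1)) : χ = ψ := by
  have : χ.toAddMonoidHom = ψ.toAddMonoidHom :=
    AddMonoidHom.functions_ext' (Additive F) _ _ fun i ↦ AddMonoidHom.ext_int (h i)
  ext v
  exact DFunLike.congr_fun this v

theorem AddChar.exists_eq_of_pow_three {F : Type*} [Field F] {E : AddChar (ZMod 3) F}
    (hE : Function.Injective E) {c : F} (hc : c ^ 3 = 1) : ∃ i, c = E i := by
  have h1 := AddChar.zmod_three_sum hE (i := 1) (by decide)
  have h2 : E 2 = E 1 ^ 2 := by rw [← AddChar.map_nsmul_eq_pow]; rfl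
  have h : (c - 1) * ((c - E 1) * (c - E 2)) = 0 := by
    rw [h2]
    linear_combination hc + (c - 1) * (E 1 - 1 - c) * h1
  rcases mul_eq_zero.mp h with h | h
  · exact ⟨0, by rw [AddChar.map_zero_eq_one, sub_eq_zero.mp h]⟩
  · rcases mul_eq_zero.mp h with h | h
    exacts [⟨1, sub_eq_zero.mp h⟩, ⟨2, sub_eq_zero.mp h⟩]

namespace LieAlgebra

namespace E6Frame

variable {F L : Type*} [Field F] [CharZero F] [LieRing L] [LieAlgebra F L] {h e f : Fin 6 → L}
  (fr : E6Frame F h e f)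
include fr

theorem eq_of_mem_wt {u v : Fin 6 → ℤ} {x : L} (hx0 : x ≠ 0) (hu : x ∈ wt F h u)
    (hv : x ∈ wt F h v) : u = v := by
  by_contra huv
  exact hx0 ((fr.iSupIndep_wt.pairwiseDisjoint huv).le_bot ⟨hu, hv⟩)

/-- A common eigenvector of the Cartan subalgebra lies in a root space. -/
theorem exists_mem_wt {y : L} (hy0 : y ≠ 0) {c : Fin 6 → F} (hy : ∀ j, ⁅h j, y⁆ = c j • y) :
    ∃ v, y ∈ wt F h v := by
  by_cases hc : ∃ v : Fin 6 → ℤ, c = fun j ↦ (E6.form (Pi.single j 1) v : F)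
  · obtain ⟨v, rfl⟩ := hc
    exact ⟨v, mem_wt_iff.mpr fun j ↦ by rw [hy, Int.cast_smul_eq_zsmul]⟩
  let χ : Option (Fin 6 → ℤ) → Fin 6 → F
    | none => c
    | some v => fun j ↦ (E6.form (Pi.single j 1) v : F)
  let p : Option (Fin 6 → ℤ) → Submodule F L
    | none => Submodule.span F {y}
    | some v => wt F h v
  have hχ : Function.Injective χ := by
    rintro (- | u) (- | v) huv
    · rfl
    · exact absurd ⟨v, huv⟩ hc
    · exact absurd ⟨u, huv.symm⟩ hc
    · refine congrArg some <| E6.form_injective <| LinearMap.pi_ext' fun j ↦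
        LinearMap.ext_ring ?_
      have := congrFun huv j
      simpa [χ, E6.form_comm] using this
  have hind : iSupIndep p := by
    refine iSupIndep_of_apply_eq_smul (f := fun j ↦ (ad F L (h j) : Module.End F L))
      (fun i j x ↦ ?_) hχ fun v x hx j ↦ ?_
    · change ⁅h i, ⁅h j, x⁆⁆ = ⁅h j, ⁅h i, x⁆⁆
      rw [leibniz_lie, fr.lie_h_h, zero_lie, zero_add]
    · rw [ad_apply]
      rcases v with - | v
      · obtain ⟨b, rfl⟩ := Submodule.mem_span_singleton.mp hx
        rw [lie_smul, hy, smul_comm]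
      · rw [mem_wt_iff.mp hx, Int.cast_smul_eq_zsmul]
  have htop : (⊤ : Submodule F L) ≤ ⨆ k, ⨆ (_ : k ≠ none), p k := by
    rw [← fr.iSup_wt]
    exact iSup_le fun v ↦ le_iSup₂_of_le (some v) (Option.some_ne_none v) le_rfl
  exact absurd ((hind none).le_bot ⟨Submodule.mem_span_singleton_self y,
    htop Submodule.mem_top⟩) hy0

omit [CharZero F] fr in
theorem exists_lie_eq_smul_of_mem_span {z x : L} (hz : z ∈ Submodule.span F (Set.range h))
    {v : Fin 6 → ℤ} (hx : x ∈ wt F h v) : ∃ c : F, ⁅z, x⁆ = c • x := by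
  induction hz using Submodule.span_induction with
  | mem z hz =>
    obtain ⟨i, rfl⟩ := hz
    exact ⟨E6.form (Pi.single i 1) v, by rw [mem_wt_iff.mp hx, Int.cast_smul_eq_zsmul]⟩
  | zero => exact ⟨0, by simp⟩
  | add y z _ _ hy hz =>
    obtain ⟨a, ha⟩ := hy
    obtain ⟨b, hb⟩ := hz
    exact ⟨a + b, by rw [add_lie, ha, hb, add_smul]⟩
  | smul a z _ hz =>
    obtain ⟨b, hb⟩ := hz
    exact ⟨a * b, by rw [smul_lie, hb, smul_smul]⟩

/-- An automorphism normalizing the Cartan subalgebra acts on the root lattice. -/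
theorem exists_weyl {n : L ≃ₗ⁅F⁆ L}
    (hn : ∀ z, n z ∈ Submodule.span F (Set.range h) ↔ z ∈ Submodule.span F (Set.range h)) :
    ∃ w : (Fin 6 → ℤ) →ₗ[ℤ] (Fin 6 → ℤ), (∀ u v, E6.form (w u) (w v) = E6.form u v) ∧
      ∀ i, n (h i) = latticeMap h (w (Pi.single i 1)) := by
  have hn0 {x : L} (hx : x ≠ 0) : n x ≠ 0 := fun h0 ↦ hx (n.toLinearEquiv.map_eq_zero_iff.mp h0)
  have hwt {v x} (hx : x ∈ wt F h v) (hx0 : x ≠ 0) : ∃ u, n x ∈ wt F h u := by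
    have (j : Fin 6) : ∃ c : F, ⁅h j, n x⁆ = c • n x := by
      obtain ⟨z, hz⟩ := n.toLinearEquiv.surjective (h j)
      replace hz : n z = h j := hz
      obtain ⟨c, hc⟩ := exists_lie_eq_smul_of_mem_span
        ((hn z).mp (hz ▸ Submodule.subset_span ⟨j, rfl⟩)) hx
      exact ⟨c, by rw [← hz, ← LieEquiv.map_lie, hc, map_smul]⟩
    choose c hc using this
    exact fr.exists_mem_wt (hn0 hx0) hc
  have hf0 (i) : f i ≠ 0 := fun h0 ↦ fr.h_ne_zero i (by rw [← fr.lie_e_f, h0, lie_zero])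
  choose ρ hρ using fun i ↦ hwt (fr.e_mem_wt i) (fr.e_ne_zero i)
  choose σ hσ using fun i ↦ hwt (fr.f_mem_wt i) (hf0 i)
  have hnh (i) : ⁅n (e i), n (f i)⁆ = n (h i) := by rw [← LieEquiv.map_lie, fr.lie_e_f]
  have hσρ (i) : σ i = -ρ i := by
    have h1 : n (h i) ∈ wt F h 0 := by
      rw [fr.wt_zero, hn]
      exact Submodule.subset_span ⟨i, rfl⟩
    have h2 := lie_mem_wt (hρ i) (hσ i)
    rw [hnh] at h2
    exact (neg_eq_of_add_eq_zero_right (fr.eq_of_mem_wt (hn0 (fr.h_ne_zero i)) h2 h1)).symm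
  have hρr (i) : ρ i ∈ E6.roots := by
    refine fr.mem_roots _ (fun h0 ↦ ?_)
      ((Submodule.ne_bot_iff _).mpr ⟨_, hρ i, hn0 (fr.e_ne_zero i)⟩)
    have h1 := hρ i
    rw [h0, fr.wt_zero, hn, ← fr.wt_zero] at h1
    exact E6.zero_notMem_roots
      (fr.eq_of_mem_wt (fr.e_ne_zero i) h1 (fr.e_mem_wt i) ▸ E6.single_mem_roots i)
  have hne (i j) : ⁅n (h j), n (e i)⁆ = cartan DynkinDiagram.diagramE6 i j • n (e i) := by
    rw [← LieEquiv.map_lie, fr.lie_h_e, map_zsmul]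
  have hnρ (i) : n (h i) = latticeMap h (ρ i) := by
    obtain ⟨c, hc⟩ := fr.exists_lie_eq_smul (hρr i) (hρ i) (hσρ i ▸ hσ i)
    rw [hnh] at hc
    have h1 := hne i i
    rw [hc, smul_lie, hρ i, ← E6.form_single, E6.form_self_of_mem_roots _ (hρr i),
      E6.form_self_of_mem_roots _ (E6.single_mem_roots i), ← Int.cast_smul_eq_zsmul F,
      smul_smul] at h1
    have h2 := smul_left_injective F (hn0 (fr.e_ne_zero i)) h1
    have h3 : c = 1 := mul_right_cancel₀ (b := ((2 : ℤ) : F)) (by norm_num) (by rw [h2, one_mul])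
    rw [hc, h3, one_smul]
  refine ⟨latticeMap ρ, fun u v ↦ ?_, fun i ↦ by rw [latticeMap_single, hnρ]⟩
  suffices E6.form.compl₁₂ (latticeMap ρ) (latticeMap ρ) = E6.form from
    congrArg (fun B : (Fin 6 → ℤ) →ₗ[ℤ] (Fin 6 → ℤ) →ₗ[ℤ] ℤ ↦ B u v) this
  refine LinearMap.pi_ext' fun i ↦ LinearMap.ext_ring (LinearMap.pi_ext' fun j ↦
    LinearMap.ext_ring ?_)
  change E6.form (latticeMap ρ (Pi.single i 1)) (latticeMap ρ (Pi.single j 1)) =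
    E6.form (Pi.single i 1) (Pi.single j 1)
  rw [latticeMap_single, latticeMap_single, E6.form_single]
  have h1 := hne i j
  rw [hnρ, hρ i, ← Int.cast_smul_eq_zsmul F, ← Int.cast_smul_eq_zsmul F] at h1
  have h2 := smul_left_injective F (hn0 (fr.e_ne_zero i)) h1
  rw [E6.form_comm]
  exact_mod_cast h2

/-- An automorphism fixing the Cartan subalgebra is determined by its values on the simple root
vectors. -/
theorem apply_eq_smul {φ : L ≃ₗ⁅F⁆ L} (hφ : ∀ i, φ (h i) = h i) {χ : AddChar (Fin 6 → ℤ) F}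
    (hχ : ∀ i, φ (e i) = χ (Pi.single i 1) • e i) {v : Fin 6 → ℤ} {x : L} (hx : x ∈ wt F h v) :
    φ x = χ v • x := by
  obtain ⟨ψ, hψ⟩ := fr.exists_eq_smul hφ
  rw [hψ v x hx, AddChar.ext_single (χ := ψ) (ψ := χ) fun i ↦
    smul_left_injective F (fr.e_ne_zero i) ((hψ _ _ (fr.e_mem_wt i)).symm.trans (hχ i))]

theorem exists_degree {E : AddChar (ZMod 3) F} (hE : Function.Injective E)
    {t : Fin 2 → L ≃ₗ⁅F⁆ L} (ht : ∀ k i, t k (h i) = h i) (ht3 : ∀ k x, t k (t k (t k x)) = x) :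
    ∃ D : (Fin 6 → ℤ) →ₗ[ℤ] (Fin 2 → ZMod 3),
      ∀ k v, ∀ x ∈ wt F h v, t k x = E (D v k) • x := by
  have hd (k i) : ∃ d : ZMod 3, t k (e i) = E d • e i := by
    obtain ⟨χ, hχ⟩ := fr.exists_eq_smul (ht k)
    have h1 := hχ _ _ (fr.e_mem_wt i)
    have h3 := ht3 k (e i)
    rw [h1, map_smul, h1, map_smul, map_smul, h1, smul_smul, smul_smul] at h3
    obtain ⟨d, hd⟩ := AddChar.exists_eq_of_pow_three hE (c := χ (Pi.single i 1))
      (smul_left_injective F (fr.e_ne_zero i)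
        (by simpa only [one_smul, pow_three'] using h3))
    exact ⟨d, by rw [h1, hd]⟩
  choose d hd using hd
  refine ⟨latticeMap fun i k ↦ d k i, fun k v x hx ↦ ?_⟩
  refine fr.apply_eq_smul (ht k) (χ := E.compAddMonoidHom ((Pi.evalAddMonoidHom
    (fun _ ↦ ZMod 3) k).comp (latticeMap fun i k ↦ d k i).toAddMonoidHom)) (fun i ↦ ?_) hx
  rw [hd]
  change _ = E (latticeMap (fun i k ↦ d k i) (Pi.single i 1) k) • _
  rw [latticeMap_single]

end E6Frame

end LieAlgebra

namespace LieAlgebra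

variable {F L : Type*} [Field F] [LieRing L] [LieAlgebra F L]

/-- A frame with respect to which a triple of automorphisms has a standard form. -/
structure AdaptedFrame (E : AddChar (ZMod 3) F) (X : Fin 3 → L ≃ₗ⁅F⁆ L) (ε : ZMod 3)
    (h e f : Fin 6 → L) : Prop extends E6Frame F h e f where
  apply_h : ∀ i, X 0 (h i) = latticeMap h (E6.rot (Pi.single i 1))
  apply_wt : ∀ k v, ∀ x ∈ wt F h v, X (Fin.succ k) x = E (![ε * E6.grad v 0, E6.grad v 1] k) • x

variable [CharZero F] {E : AddChar (ZMod 3) F} {X : Fin 3 → L ≃ₗ⁅F⁆ L} {h e f : Fin 6 → L}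

theorem E6Frame.exists_adaptedFrame [FiniteDimensional F L] [IsSimple F L]
    (fr : E6Frame F h e f) (hE : Function.Injective E)
    (hX : ∀ i j x, X i (X j x) = X j (X i x)) (hX3 : ∀ i x, X i (X i (X i x)) = x)
    (hX0 : ∀ x, (∀ i, X i x = x) → x = 0)
    (hd : ∀ a ≠ 0, finrank F (jointEigenspace E X a) = 3)
    (hspan : Submodule.span F (Set.range h) = (fixedSubalgebra (Fin.tail X)).toSubmodule) :
    ∃ ε h' e' f', ε ≠ 0 ∧ AdaptedFrame E X ε h' e' f' := by
  have hmem (z) : z ∈ Submodule.span F (Set.range h) ↔ ∀ k : Fin 2, X k.succ z = z := by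
    rw [hspan]; rfl
  have hth (k : Fin 2) (i) : X k.succ (h i) = h i :=
    (hmem _).mp (Submodule.subset_span ⟨i, rfl⟩) k
  have hlat (v) : latticeMap h v ∈ Submodule.span F (Set.range h) := by
    rw [← fr.wt_zero]
    exact fr.latticeMap_mem_wt v
  have hn0 {x : L} (hx : x ≠ 0) : X 0 x ≠ 0 :=
    fun h0 ↦ hx ((X 0).toLinearEquiv.map_eq_zero_iff.mp h0)
  have hinj {u v} (huv : latticeMap h u = latticeMap h v) : u = v := by
    by_contra hne
    exact fr.latticeMap_ne_zero (sub_ne_zero.mpr hne) (by rw [map_sub, huv, sub_self])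
  obtain ⟨w, hform, hn⟩ := fr.exists_weyl (n := X 0) fun z ↦ by
    rw [hmem, hmem]
    refine forall_congr' fun k ↦ ?_
    rw [hX]
    exact (X 0).toLinearEquiv.injective.eq_iff
  have hnl (v) : X 0 (latticeMap h v) = latticeMap h (w v) := by
    rw [map_latticeMap (X 0) hn, latticeMap_comp]
  have hw3 (v) : w (w (w v)) = v := hinj (by rw [← hnl, ← hnl, ← hnl, hX3])
  have hw (v) : w (w v) = -v - w v := by
    have h0 : latticeMap h (v + w v + w (w v)) = 0 := by
      refine hX0 _ fun i ↦ Fin.cases ?_ ((hmem _).mp (hlat _)) i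
      rw [hnl, show w (v + w v + w (w v)) = v + w v + w (w v) by rw [map_add, map_add, hw3]; abel]
    have h1 : v + w v + w (w v) = 0 := hinj (by rw [h0, map_zero])
    linear_combination (exp := 1) h1
  have hnw (v x) (hx : x ∈ wt F h v) : X 0 x ∈ wt F h (w v) :=
    E6Frame.apply_mem_wt hform (fun v ↦ ⟨_, hw3 v⟩) hn hx
  have hroots (v) (hv : v ∈ E6.roots) : w v ∈ E6.roots := by
    obtain ⟨x, hx, hx0⟩ := fr.exists_ne_zero hv
    refine fr.mem_roots _ (fun h0 ↦ ?_) ((Submodule.ne_bot_iff _).mpr ⟨_, hnw v x hx, hn0 hx0⟩)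
    have := hw3 v
    rw [h0, map_zero, map_zero] at this
    exact E6.zero_notMem_roots (this ▸ hv)
  obtain ⟨D, hD⟩ := fr.exists_degree hE (t := Fin.tail X) hth (fun k ↦ hX3 k.succ)
  have hDw' (v) (hv : v ∈ E6.roots) : D (w v) = D v := by
    obtain ⟨x, hx, hx0⟩ := fr.exists_ne_zero hv
    ext k
    have h1 := hX k.succ 0 x
    have h2 : X k.succ x = _ := hD k v x hx
    have h3 : X k.succ (X 0 x) = _ := hD k _ _ (hnw v x hx)
    rw [h2, map_smul, h3] at h1
    exact hE (smul_left_injective F (hn0 hx0) h1)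
  have hDw (v) : D (w v) = D v := by
    suffices D ∘ₗ w = D from congrArg (fun g : (Fin 6 → ℤ) →ₗ[ℤ] (Fin 2 → ZMod 3) ↦ g v) this
    exact LinearMap.pi_ext' fun i ↦ LinearMap.ext_ring (hDw' _ (E6.single_mem_roots i))
  have hD0 (v) (hv : v ∈ E6.roots) : D v ≠ 0 := by
    intro h0
    obtain ⟨x, hx, hx0⟩ := fr.exists_ne_zero hv
    have hx' : x ∈ wt F h 0 := by
      rw [fr.wt_zero, hmem]
      intro k
      have : X k.succ x = _ := hD k v x hx
      rw [this, h0, Pi.zero_apply, AddChar.map_zero_eq_one, one_smul]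
    exact E6.zero_notMem_roots (fr.eq_of_mem_wt hx0 hx hx' ▸ hv)
  obtain ⟨ρ, hρ, hρform, hρw, ε, hε, hρD⟩ := E6.exists_adapted_basis hform hw hroots hDw hD0
    fr.add_mem_roots fun c hc r hr ↦ by
      by_contra! hcon
      have h2 := fr.finrank_jointEigenspace_le hE hnw (hX3 0) hD (Fin.cons 0 c) hr
        (by rw [map_zero, Fin.tail_cons]; exact hc.symm) (fun v hv hDv ↦ by
          rw [Fin.tail_cons] at hDv
          obtain ⟨i, hi⟩ := hcon v hv hDv
          exact ⟨i, by tauto⟩)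
      rw [Fin.cons_self_tail, hd _ fun h0 ↦ hc (funext fun k ↦ congrFun h0 k.succ)] at h2
      omega
  choose e' he' he0 using fun i ↦ fr.exists_ne_zero (hρ i)
  obtain ⟨f', -, c⟩ := fr.exists_chevalleyRel hρ hρform he' he0
  have fr' := fr.of_chevalleyRel c
  refine ⟨ε, _, e', f', hε, { fr' with apply_h := fun i ↦ ?_, apply_wt := fun k v x hx ↦ ?_ }⟩
  · rw [hnl, hρw]
    rw [latticeMap_apply ρ, map_sum]
    exact Finset.sum_congr rfl fun _ _ ↦ map_smul _ _ _
  · refine fr'.apply_eq_smul (χ := E.compAddMonoidHom ((Pi.evalAddMonoidHom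
      (fun _ ↦ ZMod 3) k).comp (AddMonoidHom.mk' (fun v ↦ ![ε * E6.grad v 0, E6.grad v 1])
        fun u v ↦ by simp [mul_add]))) (fun i ↦ ?_) (fun i ↦ ?_) hx
    · exact (hmem _).mp (hlat _) k
    · have : X k.succ (e' i) = _ := hD k _ _ (he' i)
      rw [this, hρD]
      rfl

theorem AdaptedFrame.exists_lieEquiv [IsAlgClosed F] [FiniteDimensional F L] [IsSimple F L]
    {X' : Fin 3 → L ≃ₗ⁅F⁆ L} {h' e' f' : Fin 6 → L} {ε ε' : ZMod 3}
    (fr : AdaptedFrame E X ε h e f) (fr' : AdaptedFrame E X' ε' h' e' f') :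
    ∃ ψ : L ≃ₗ⁅F⁆ L, (∀ i, ψ (h i) = h' i) ∧ ∀ x, ψ (X 0 x) = X' 0 (ψ x) := by
  obtain ⟨φ, hφ, -⟩ := fr.toE6Frame.exists_lieEquiv fr'.toChevalleyRel
  let g : L ≃ₗ⁅F⁆ L := ((φ.trans (X' 0)).trans φ.symm).trans (X 0).symm
  have hg (x) : φ (X 0 (g x)) = X' 0 (φ x) := by simp [g]
  have hgh (i) : g (h i) = h i := by
    refine (X 0).toLinearEquiv.injective (φ.toLinearEquiv.injective ?_)
    change φ (X 0 (g (h i))) = φ (X 0 (h i))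
    rw [hg, hφ, fr'.apply_h, fr.apply_h, map_latticeMap φ hφ]
  obtain ⟨χ, hχ⟩ := fr.toE6Frame.exists_eq_smul hgh
  have hχ0 (v) : χ v ≠ 0 := by
    intro h0
    have := χ.map_add_eq_mul v (-v)
    rw [add_neg_cancel, h0, zero_mul, AddChar.map_zero_eq_one] at this
    exact one_ne_zero this
  choose c hc using fun i ↦ IsAlgClosed.exists_pow_nat_eq (χ (Pi.single i 1)) (n := 3) (by norm_num)
  obtain ⟨η, hη⟩ := exists_addChar (c := c) fun i h0 ↦ hχ0 (Pi.single i 1) (by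
    rw [← hc, h0, zero_pow three_ne_zero])
  have hηχ (v) : η (3 • v) = χ v := by
    have : η.compAddMonoidHom (nsmulAddMonoidHom 3) = χ := AddChar.ext_single fun i ↦ by
      change η (3 • Pi.single i 1) = _
      rw [AddChar.map_nsmul_eq_pow, hη, hc]
    exact DFunLike.congr_fun this v
  obtain ⟨s, hs⟩ := fr.exists_toral
    (η.compAddMonoidHom (-E6.rot - 2 • LinearMap.id : (Fin 6 → ℤ) →ₗ[ℤ] Fin 6 → ℤ).toAddMonoidHom)
  replace hs : ∀ v, ∀ x ∈ wt F h v, s x = η (-E6.rot v - 2 • v) • x := hs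
  have hrot3 (v) : E6.rot (E6.rot (E6.rot v)) = v := by
    rw [E6.rot_rot v, map_sub, map_neg, E6.rot_rot]; abel
  have hnw (v x) (hx : x ∈ wt F h v) : X 0 x ∈ wt F h (E6.rot v) :=
    E6Frame.apply_mem_wt E6.form_rot (fun v ↦ ⟨_, hrot3 v⟩) fr.apply_h hx
  have hsn (x) : s (X 0 x) = X 0 (g (s x)) := by
    have : s.toLinearEquiv.toLinearMap ∘ₗ (X 0).toLinearEquiv.toLinearMap =
        (X 0).toLinearEquiv.toLinearMap ∘ₗ g.toLinearEquiv.toLinearMap ∘ₗ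
          s.toLinearEquiv.toLinearMap :=
      LinearMap.ext_of_iSup_eq_top fr.iSup_wt fun v x hx ↦ by
        change s (X 0 x) = X 0 (g (s x))
        rw [hs _ _ (hnw v x hx), hs v x hx, map_smul, map_smul, hχ v x hx, map_smul, smul_smul,
          ← hηχ, ← AddChar.map_add_eq_mul, E6.rot_rot]
        congr 2
        abel
    exact LinearMap.congr_fun this x
  refine ⟨s.trans φ, fun i ↦ ?_, fun x ↦ ?_⟩
  · change φ (s (h i)) = h' i
    rw [hs 0 _ (fr.h_mem_wt i), map_zero, smul_zero, neg_zero, sub_zero, AddChar.map_zero_eq_one,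
      one_smul, hφ]
  · change φ (s (X 0 x)) = X' 0 (φ (s x))
    rw [hsn, hg]

theorem AdaptedFrame.gradingsEquiv [IsAlgClosed F] [FiniteDimensional F L] [IsSimple F L]
    {X' : Fin 3 → L ≃ₗ⁅F⁆ L} {h' e' f' : Fin 6 → L} {ε ε' : ZMod 3} (hE : Function.Injective E)
    (hε : ε ≠ 0) (hε' : ε' ≠ 0)
    (fr : AdaptedFrame E X ε h e f) (fr' : AdaptedFrame E X' ε' h' e' f')
    (h0 : jointEigenspace E X 0 = ⊥) (hd : ∀ a ≠ 0, finrank F (jointEigenspace E X a) = 3)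
    (hd' : ∀ a ≠ 0, finrank F (jointEigenspace E X' a) = 3) :
    GradingsEquiv F (jointEigenspace E X) (jointEigenspace E X') := by
  obtain ⟨ψ, hψh, hψn⟩ := fr.exists_lieEquiv fr'
  refine ⟨ψ, fun a ha ↦ ?_⟩
  have ha0 : a ≠ 0 := by
    rintro rfl
    exact ha h0
  have hb0 : (![a 0, ε' * ε * a 1, a 2] : Fin 3 → ZMod 3) ≠ 0 := fun hb ↦ ha0 <| by
    ext i
    fin_cases i
    · exact congrFun hb 0
    · exact (mul_eq_zero.mp (congrFun hb 1)).resolve_left (mul_ne_zero hε' hε)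
    · exact congrFun hb 2
  refine ⟨![a 0, ε' * ε * a 1, a 2], Submodule.eq_of_le_of_finrank_eq ?_ ?_⟩
  · rintro _ ⟨x, hx, rfl⟩
    have hψX (k : Fin 2) (b) : (⨆ v, ⨆ (_ : ![ε * E6.grad v 0, E6.grad v 1] = b), wt F h v) ≤
        LinearMap.eqLocus ((X' k.succ).toLinearEquiv.toLinearMap ∘ₗ ψ.toLinearEquiv.toLinearMap)
          (E (![ε' * ε * b 0, b 1] k) • ψ.toLinearEquiv.toLinearMap) := by
      refine iSup₂_le fun v hv y hy ↦ ?_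
      have h1 := fr'.apply_wt k v (ψ y) ((map_mem_wt_iff ψ hψh).mpr hy)
      have h2 : ε' * ε * (ε * E6.grad v 0) = ε' * E6.grad v 0 := by
        have : ∀ a b c : ZMod 3, b ≠ 0 → a * b * (b * c) = a * c := by decide
        exact this _ _ _ hε
      rw [← hv, Matrix.cons_val_zero, Matrix.cons_val_one, h2]
      exact h1
    have hmem := mem_iSup_of_apply_eq_smul hE fr.iSup_wt
      (t := fun k : Fin 2 ↦ (X k.succ).toLinearEquiv.toLinearMap) (b := Fin.tail a)
      (fun v y hy k ↦ fr.apply_wt k v y hy) (fun k ↦ hx k.succ)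
    intro i
    refine Fin.cases ?_ (fun k ↦ ?_) i
    · change X' 0 (ψ x) = E (a 0) • ψ x
      rw [← hψn, hx 0, map_smul]
    · have h1 : X' k.succ (ψ x) = E (![ε' * ε * a 1, a 2] k) • ψ x := hψX k _ hmem
      rw [Matrix.cons_val_succ]
      exact h1
  · rw [hd' _ hb0, ← hd a ha0]
    exact ψ.toLinearEquiv.finrank_map_eq _

end LieAlgebra

theorem jordan_grading_E6 (F : Type*) [Field F] [IsAlgClosed F] [CharZero F]
    (L : Type*) [LieRing L] [LieAlgebra F L] [FiniteDimensional F L]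
    [LieAlgebra.IsSimple F L] (hdim : finrank F L = 78)
    (hso : IsEmpty (L ≃ₗ⁅F⁆ (LieAlgebra.Orthogonal.so (Fin 13) F)))
    (hsp : IsEmpty (L ≃ₗ⁅F⁆ (LieAlgebra.Symplectic.sp (Fin 6) F))) :
    (∃ gr : (Fin 3 → ZMod 3) → Submodule F L, IsLieGrading F gr ∧
      ∀ a : Fin 3 → ZMod 3, a ≠ 0 → finrank F (gr a) = 3) ∧
    ∀ gr gr' : (Fin 3 → ZMod 3) → Submodule F L,
      IsLieGrading F gr → (∀ a : Fin 3 → ZMod 3, a ≠ 0 → finrank F (gr a) = 3) →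
      IsLieGrading F gr' → (∀ a : Fin 3 → ZMod 3, a ≠ 0 → finrank F (gr' a) = 3) →
      GradingsEquiv F gr gr' := by
  obtain ⟨E, hE⟩ := exists_addChar_injective F
  refine ⟨?_, fun gr gr' hgr hd hgr' hd' ↦ ?_⟩
  · obtain ⟨y, hy⟩ := LieAlgebra.exists_isCartanSubalgebra_engel F L
    obtain ⟨h, e, f, fr, -⟩ := LieAlgebra.exists_E6Frame hdim hso hsp (LieSubalgebra.engel F y)
    exact fr.exists_isLieGrading hdim
  · have key {gr : (Fin 3 → ZMod 3) → Submodule F L} (hgr : IsLieGrading F gr)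
        (hd : ∀ a : Fin 3 → ZMod 3, a ≠ 0 → finrank F (gr a) = 3) :
        ∃ (X : Fin 3 → L ≃ₗ⁅F⁆ L) (ε : ZMod 3) (h e f : Fin 6 → L),
          gr = LieAlgebra.jointEigenspace E X ∧ gr 0 = ⊥ ∧ ε ≠ 0 ∧
          LieAlgebra.AdaptedFrame E X ε h e f := by
      obtain ⟨X, hX, hX3, rfl⟩ := hgr.exists_eq_jointEigenspace hE
      have hX0 (x) (hx : ∀ i, X i x = x) : x = 0 :=
        LieAlgebra.eq_zero_of_forall_apply_eq hdim hE hX hX3 hd hx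
      obtain ⟨h, e, f, fr, hspan⟩ :=
        LieAlgebra.exists_E6Frame_span_eq hdim hso hsp hE hX hX3 hd
      obtain ⟨ε, h', e', f', hε, fr'⟩ := fr.exists_adaptedFrame hE hX hX3 hX0 hd hspan
      refine ⟨X, ε, h', e', f', rfl, (Submodule.eq_bot_iff _).mpr fun x hx ↦ ?_, hε, fr'⟩
      refine hX0 x fun i ↦ (hx i).trans ?_
      rw [Pi.zero_apply, AddChar.map_zero_eq_one, one_smul]
    obtain ⟨X, ε, h, e, f, rfl, h0, hε, fr⟩ := key hgr hd
    obtain ⟨X', ε', h', e', f', rfl, -, hε', fr'⟩ := key hgr' hd'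
    exact fr.gradingsEquiv hE hε hε' fr' h0 hd hd'
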